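/- arXiv:1812.11101 — 2 statements merged into one kernel-verified Lean document; each statement's English description precedes it below -/
import Mathlib

section
/- Shepp's determinant formula (unconditional form): for every positive integer n and every real h, F_n(h) = ∫_{(−∞,h)^{n+1}} det( M(s) ) ds₀ ds₁ ⋯ ds_n, where M(s) is the (n+1)×(n+1) matrix with entries M(s)_{i,j} = φ(s_i + a_{i,j}) for 0 ≤ i,j ≤ n, with a_{i,i} = 0, a_{i,j} = (i−j)h − (s_{j+1} + ⋯ + s_i) for i > j, and a_{i,j} = (i−j)h + (s_{i+1} + ⋯ + s_j) for i < j. -/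
open MeasureTheory ProbabilityTheory Real Set Filter

/-- The standard normal density `φ(x) = (2π)^{-1/2} exp(-x²/2)`. -/
noncomputable def stdPhi (x : ℝ) : ℝ := (Real.sqrt (2 * Real.pi))⁻¹ * Real.exp (-x ^ 2 / 2)

/-- The standard normal distribution function `Φ(x) = ∫_{-∞}^x φ(t) dt`. -/
noncomputable def stdCdf (x : ℝ) : ℝ := ∫ t in Set.Iic x, stdPhi t

/-- `S` is a Slepian process on the probability space `(Ω, μ)`: a stationary Gaussian
process with continuous sample paths, mean zero and covariance
`E[S(t)S(t')] = max 0 (1 - |t - t'|)` (e.g. `S(t) = W(t+1) - W(t)` for a standard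
Brownian motion `W`). -/
def IsSlepian {Ω : Type*} [MeasurableSpace Ω] (μ : Measure Ω) (S : ℝ → Ω → ℝ) : Prop :=
  IsProbabilityMeasure μ ∧
  (∀ t, Measurable (S t)) ∧
  (∀ ω, Continuous fun t => S t ω) ∧
  (∀ (n : ℕ) (t c : Fin n → ℝ), ∃ v : NNReal,
      Measure.map (fun ω => ∑ i, c i * S (t i) ω) μ = gaussianReal 0 v) ∧
  (∀ t, ∫ ω, S t ω ∂μ = 0) ∧
  (∀ t t', ∫ ω, S t ω * S t' ω ∂μ = max 0 (1 - |t - t'|))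

/-- `F_T(h)`: the probability that the process `S` stays below `h` on `[0, T]`. -/
noncomputable def slepF {Ω : Type*} [MeasurableSpace Ω] (μ : Measure Ω)
    (S : ℝ → Ω → ℝ) (T h : ℝ) : ℝ :=
  (μ {ω | ∀ t ∈ Set.Icc (0 : ℝ) T, S t ω < h}).toReal

/-- The shifts `a_{i,j}` in Shepp's determinant formula:
`a_{i,i} = 0`, `a_{i,j} = (i-j)h - (s_{j+1} + ⋯ + s_i)` for `i > j`, and
`a_{i,j} = (i-j)h + (s_{i+1} + ⋯ + s_j)` for `i < j`. -/
noncomputable def sheppA (n : ℕ) (h : ℝ) (s : Fin (n + 1) → ℝ) (i j : Fin (n + 1)) : ℝ :=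
  if i = j then 0
  else if j < i then (((i : ℕ) : ℝ) - ((j : ℕ) : ℝ)) * h - ∑ k ∈ Finset.Ioc j i, s k
  else (((i : ℕ) : ℝ) - ((j : ℕ) : ℝ)) * h + ∑ k ∈ Finset.Ioc i j, s k

namespace SheppKM

variable {m : ℕ}

/-- Convolving two centred Gaussian densities adds the variances. -/
lemma integral_gaussianPDFReal_sub (s t : NNReal) (hs : s ≠ 0) (ht : t ≠ 0) (a : ℝ) :
    ∫ x, gaussianPDFReal 0 t (a - x) ∂gaussianReal 0 s = gaussianPDFReal 0 (s + t) a := by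
  have hs' : (0 : ℝ) < s := NNReal.coe_pos.2 (pos_iff_ne_zero.2 hs)
  have ht' : (0 : ℝ) < t := NNReal.coe_pos.2 (pos_iff_ne_zero.2 ht)
  rw [integral_gaussianReal_eq_integral_smul hs]
  have key : ∀ x, gaussianPDFReal 0 s x • gaussianPDFReal 0 t (a - x)
      = gaussianPDFReal 0 (s + t) a * gaussianPDFReal (a * s / (s + t)) (s * t / (s + t)) x := by
    intro x
    simp only [gaussianPDFReal, smul_eq_mul, NNReal.coe_add, NNReal.coe_mul, NNReal.coe_div]
    have h1 : (√(2 * π * s))⁻¹ * (√(2 * π * t))⁻¹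
        = (√(2 * π * (s + t)))⁻¹ * (√(2 * π * (s * t / (s + t))))⁻¹ := by
      rw [← mul_inv, ← mul_inv, ← Real.sqrt_mul (by positivity), ← Real.sqrt_mul (by positivity)]
      congr 2
      field_simp
    have h2 : -(x - 0) ^ 2 / (2 * s) + -(a - x - 0) ^ 2 / (2 * t)
        = -(a - 0) ^ 2 / (2 * (s + t)) + -(x - a * s / (s + t)) ^ 2 / (2 * (s * t / (s + t))) := by
      field_simp
      ring
    calc _ = ((√(2 * π * s))⁻¹ * (√(2 * π * t))⁻¹) *
          rexp (-(x - 0) ^ 2 / (2 * s) + -(a - x - 0) ^ 2 / (2 * t)) := by rw [Real.exp_add]; ring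
      _ = _ := by rw [h1, h2, Real.exp_add]; ring
  simp_rw [key]
  rw [integral_const_mul, integral_gaussianPDFReal_eq_one, mul_one]
  positivity

lemma gaussianPDFReal_zero_le_inv (t : NNReal) (ht0 : t ≠ 0) (ht : t ≤ 1) (x : ℝ) :
    gaussianPDFReal 0 t x ≤ (t : ℝ)⁻¹ := by
  have ht' : (0 : ℝ) < t := NNReal.coe_pos.2 (pos_iff_ne_zero.2 ht0)
  have ht1 : (t : ℝ) ≤ 1 := by exact_mod_cast ht
  rw [gaussianPDFReal]
  have h1 : rexp (-(x - 0) ^ 2 / (2 * t)) ≤ 1 := by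
    rw [Real.exp_le_one_iff]
    exact div_nonpos_of_nonpos_of_nonneg (neg_nonpos.2 (sq_nonneg _)) (by positivity)
  have h2 : (t : ℝ) ≤ √(2 * π * t) := by
    apply Real.le_sqrt_of_sq_le
    nlinarith [Real.pi_gt_three]
  calc _ ≤ (√(2 * π * t))⁻¹ * 1 := by gcongr
    _ ≤ _ := by rw [mul_one]; gcongr

/-- The law of one step of `m` independent centred Gaussian walks of variance `s`. -/
noncomputable def stepLaw (m : ℕ) (s : NNReal) : Measure (Fin m → ℝ) :=
  Measure.pi fun _ => gaussianReal 0 s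

instance (s : NNReal) : IsProbabilityMeasure (stepLaw m s) := by
  unfold stepLaw; infer_instance

/-- The heat kernel on `ℝ^m`. -/
noncomputable def heatProd (t : NNReal) (y z : Fin m → ℝ) : ℝ :=
  ∏ i, gaussianPDFReal 0 t (y i - z i)

/-- The antisymmetrised heat kernel on `ℝ^m`. -/
noncomputable def heatDet (t : NNReal) (y z : Fin m → ℝ) : ℝ :=
  ∑ σ : Equiv.Perm (Fin m), (Equiv.Perm.sign σ : ℝ) * heatProd t (y ∘ σ) z

lemma heatDet_eq_det (t : NNReal) (y z : Fin m → ℝ) :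
    heatDet t y z = (Matrix.of fun i j => gaussianPDFReal 0 t (y j - z i)).det := by
  rw [← Matrix.det_transpose, Matrix.det_apply']
  simp [heatDet, heatProd]

lemma heatProd_nonneg (t : NNReal) (y z : Fin m → ℝ) : 0 ≤ heatProd t y z :=
  Finset.prod_nonneg fun _ _ => gaussianPDFReal_nonneg _ _ _

lemma heatProd_le (t : NNReal) (ht0 : t ≠ 0) (ht : t ≤ 1) (y z : Fin m → ℝ) :
    heatProd t y z ≤ ((t : ℝ)⁻¹) ^ m := by
  have := Finset.prod_le_prod (s := Finset.univ) (f := fun i => gaussianPDFReal 0 t (y i - z i))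
    (g := fun _ : Fin m => (t : ℝ)⁻¹) (fun _ _ => gaussianPDFReal_nonneg _ _ _)
    (fun i _ => gaussianPDFReal_zero_le_inv t ht0 ht _)
  simpa [heatProd] using this

lemma measurable_heatProd (t : NNReal) :
    Measurable fun p : (Fin m → ℝ) × (Fin m → ℝ) => heatProd t p.1 p.2 := by
  unfold heatProd
  refine Finset.measurable_prod _ fun i _ => ?_
  exact (measurable_gaussianPDFReal 0 t).comp (by fun_prop)

lemma measurable_heatProd_right (t : NNReal) (y : Fin m → ℝ) : Measurable (heatProd t y) := by
  unfold heatProd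
  refine Finset.measurable_prod _ fun i _ => ?_
  exact (measurable_gaussianPDFReal 0 t).comp (by fun_prop)

lemma measurable_heatDet_right (t : NNReal) (y : Fin m → ℝ) : Measurable (heatDet t y) := by
  unfold heatDet
  exact Finset.measurable_sum _ fun σ _ => (measurable_heatProd_right t (y ∘ σ)).const_mul _

lemma integrable_of_abs_le {α : Type*} [MeasurableSpace α] {ν : Measure α} [IsFiniteMeasure ν]
    {f : α → ℝ} (hf : Measurable f) {c : ℝ} (hc : ∀ x, |f x| ≤ c) : Integrable f ν :=
  Integrable.of_bound hf.aestronglyMeasurable c (ae_of_all _ hc)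

lemma abs_heatProd_le (t : NNReal) (ht0 : t ≠ 0) (ht : t ≤ 1) (y z : Fin m → ℝ) :
    |heatProd t y z| ≤ ((t : ℝ)⁻¹) ^ m := by
  rw [abs_of_nonneg (heatProd_nonneg t y z)]
  exact heatProd_le t ht0 ht y z

lemma abs_sum_sign_mul_le {f : Equiv.Perm (Fin m) → ℝ} {c : ℝ} (hf : ∀ σ, |f σ| ≤ c) :
    |∑ σ : Equiv.Perm (Fin m), (Equiv.Perm.sign σ : ℝ) * f σ| ≤ m.factorial * c := by
  refine (Finset.abs_sum_le_sum_abs _ _).trans ?_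
  refine (Finset.sum_le_sum (g := fun _ => c) fun σ _ => ?_).trans_eq ?_
  · rw [abs_mul]
    have : |((Equiv.Perm.sign σ : ℤ) : ℝ)| = 1 := by
      rw [← Int.cast_abs]; simp
    rw [this, one_mul]
    exact hf σ
  · simp [Fintype.card_perm]

lemma abs_heatDet_le (t : NNReal) (ht0 : t ≠ 0) (ht : t ≤ 1) (y z : Fin m → ℝ) :
    |heatDet t y z| ≤ m.factorial * ((t : ℝ)⁻¹) ^ m :=
  abs_sum_sign_mul_le fun _ => abs_heatProd_le t ht0 ht _ _

lemma integrable_heatProd_add (s t : NNReal) (ht0 : t ≠ 0) (ht : t ≤ 1) (y z : Fin m → ℝ) :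
    Integrable (fun e => heatProd t y (z + e)) (stepLaw m s) :=
  integrable_of_abs_le ((measurable_heatProd_right t y).comp (by fun_prop))
    fun _ => abs_heatProd_le t ht0 ht _ _

lemma integrable_heatDet_add (s t : NNReal) (ht0 : t ≠ 0) (ht : t ≤ 1) (y z : Fin m → ℝ) :
    Integrable (fun e => heatDet t y (z + e)) (stepLaw m s) :=
  integrable_of_abs_le ((measurable_heatDet_right t y).comp (by fun_prop))
    fun _ => abs_heatDet_le t ht0 ht _ _

lemma integral_heatProd_add (s t : NNReal) (hs : s ≠ 0) (ht : t ≠ 0) (y z : Fin m → ℝ) :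
    ∫ e, heatProd t y (z + e) ∂stepLaw m s = heatProd (s + t) y z := by
  unfold heatProd stepLaw
  rw [show (fun e : Fin m → ℝ => ∏ i, gaussianPDFReal 0 t (y i - (z + e) i))
    = fun e => ∏ i, (fun i x => gaussianPDFReal 0 t ((y i - z i) - x)) i (e i) from ?_,
    integral_fintype_prod_eq_prod (fun i x => gaussianPDFReal 0 t ((y i - z i) - x))]
  · simp_rw [integral_gaussianPDFReal_sub s t hs ht]
  · ext e
    simp [sub_sub]

lemma integral_heatDet_add (s t : NNReal) (hs : s ≠ 0) (ht0 : t ≠ 0) (ht : t ≤ 1)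
    (y z : Fin m → ℝ) :
    ∫ e, heatDet t y (z + e) ∂stepLaw m s = heatDet (s + t) y z := by
  unfold heatDet
  rw [integral_finsetSum _ fun σ _ => (integrable_heatProd_add s t ht0 ht _ z).const_mul _]
  simp_rw [integral_const_mul, integral_heatProd_add s t hs ht0]

lemma heatProd_eq_exp (t : NNReal) (y z : Fin m → ℝ) :
    heatProd t y z = (√(2 * π * t))⁻¹ ^ m * rexp (-∑ i, (y i - z i) ^ 2 / (2 * t)) := by
  unfold heatProd
  simp only [gaussianPDFReal, sub_zero, Finset.prod_mul_distrib, Finset.prod_const,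
    Finset.card_univ, Fintype.card_fin, ← Real.exp_sum, ← Finset.sum_neg_distrib, neg_div]

lemma inv_sqrt_le_inv (t : NNReal) (ht0 : t ≠ 0) (ht : t ≤ 1) :
    (√(2 * π * t))⁻¹ ≤ (t : ℝ)⁻¹ := by
  simpa [gaussianPDFReal] using gaussianPDFReal_zero_le_inv t ht0 ht 0

lemma abs_exp_neg_sub_exp_neg_le {A B M : ℝ} (hA : M ≤ A) (hB : M ≤ B) :
    |rexp (-A) - rexp (-B)| ≤ |A - B| * rexp (-M) := by
  wlog h : A ≤ B generalizing A B
  · rw [abs_sub_comm, abs_sub_comm A B]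
    exact this hB hA (le_of_not_ge h)
  have h1 : rexp (-B) = rexp (-A) * rexp (-(B - A)) := by rw [← Real.exp_add]; ring_nf
  have h2 : rexp (-B) ≤ rexp (-A) := by gcongr
  have h3 := Real.add_one_le_exp (-(B - A))
  have h4 : rexp (-A) ≤ rexp (-M) := by gcongr
  rw [abs_of_nonneg (by linarith), abs_of_nonpos (by linarith), h1]
  nlinarith [Real.exp_pos (-A)]

lemma add_le_sum_of_nonneg {f : Fin m → ℝ} (hf : ∀ i, 0 ≤ f i) {a b : Fin m} (hab : a ≠ b) :
    f a + f b ≤ ∑ i, f i := by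
  rw [← Finset.sum_pair hab]
  exact Finset.sum_le_sum_of_subset_of_nonneg (Finset.subset_univ _) fun i _ _ => hf i

lemma sq_div_le_sum_sq_div {t : ℝ} (ht : 0 < t) (v w : Fin m → ℝ) {a b : Fin m} (hab : a ≠ b)
    {d : ℝ} (hd : 0 ≤ d) (h : d ≤ |(v a - w a) - (v b - w b)|) :
    d ^ 2 / (4 * t) ≤ ∑ i, (v i - w i) ^ 2 / (2 * t) := by
  refine le_trans ?_ (add_le_sum_of_nonneg (fun i => by positivity) hab)
  have h2 : d ^ 2 ≤ ((v a - w a) - (v b - w b)) ^ 2 := by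
    rw [← sq_abs ((v a - w a) - (v b - w b))]; gcongr
  rw [← add_div, div_le_div_iff₀ (by positivity) (by positivity)]
  nlinarith [sq_nonneg ((v a - w a) + (v b - w b))]

lemma sub_abs_sub_le_abs_sub_sub (p q r s : ℝ) : |p - q| - |r - s| ≤ |(p - r) - (q - s)| :=
  (abs_sub_abs_le_abs_sub _ _).trans_eq (by ring_nf)

lemma pow_mul_exp_neg_le {x c : ℝ} (hx : 0 ≤ x) (hc : 0 < c) (k : ℕ) :
    x ^ k * rexp (-(c * x)) ≤ k.factorial / c ^ k := by
  have h := Real.pow_div_factorial_le_exp (c * x) (by positivity) k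
  rw [Real.exp_neg, ← div_eq_mul_inv, div_le_div_iff₀ (Real.exp_pos _) (by positivity)]
  rw [div_le_iff₀ (by positivity), mul_pow] at h
  linarith

lemma abs_heatProd_sub_swap_le (t : NNReal) (ht0 : t ≠ 0) (ht : t ≤ 1) (v w : Fin m → ℝ)
    {a b : Fin m} (hab : a ≠ b) {δ K : ℝ} (hδ : 0 < δ) (hδv : δ ≤ |v a - v b|)
    (hK : |v a - v b| ≤ K) (hw : |w a - w b| ≤ δ / 2) :
    |heatProd t v w - heatProd t v (w ∘ Equiv.swap a b)| ≤
      K * ((m + 1).factorial / (δ ^ 2 / 16) ^ (m + 1)) * |w a - w b| := by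
  have ht' : (0 : ℝ) < t := NNReal.coe_pos.2 (pos_iff_ne_zero.2 ht0)
  rw [heatProd_eq_exp, heatProd_eq_exp, ← mul_sub, abs_mul, abs_of_nonneg (by positivity)]
  have hA : (δ / 2) ^ 2 / (4 * t) ≤ ∑ i, (v i - w i) ^ 2 / (2 * (t : ℝ)) :=
    sq_div_le_sum_sq_div ht' v w hab (by positivity)
      (le_trans (by linarith) (sub_abs_sub_le_abs_sub_sub _ _ _ _))
  have hB : (δ / 2) ^ 2 / (4 * t) ≤
      ∑ i, (v i - (w ∘ Equiv.swap a b) i) ^ 2 / (2 * (t : ℝ)) := by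
    refine sq_div_le_sum_sq_div ht' v _ hab (by positivity)
      (le_trans ?_ (sub_abs_sub_le_abs_sub_sub _ _ _ _))
    simp only [Function.comp, Equiv.swap_apply_left, Equiv.swap_apply_right]
    rw [abs_sub_comm (w b)]
    linarith
  have hdiff : ∑ i, (v i - w i) ^ 2 / (2 * (t : ℝ)) -
      ∑ i, (v i - (w ∘ Equiv.swap a b) i) ^ 2 / (2 * (t : ℝ)) =
      -((v a - v b) * (w a - w b) / t) := by
    rw [← Finset.sum_sub_distrib, Finset.sum_eq_add a b hab]
    · simp only [Function.comp, Equiv.swap_apply_left, Equiv.swap_apply_right]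
      field_simp
      ring
    · rintro c - ⟨hca, hcb⟩
      simp [Equiv.swap_apply_of_ne_of_ne hca hcb]
    · simp
    · simp
  have h1 := abs_exp_neg_sub_exp_neg_le hA hB
  rw [hdiff, abs_neg, abs_div, abs_mul, abs_of_pos ht'] at h1
  have h2 := pow_mul_exp_neg_le (x := (t : ℝ)⁻¹) (c := δ ^ 2 / 16) (by positivity) (by positivity)
    (m + 1)
  have h3 : (δ / 2) ^ 2 / (4 * (t : ℝ)) = δ ^ 2 / 16 * (t : ℝ)⁻¹ := by field_simp; norm_num
  rw [h3] at h1
  calc _ ≤ (t : ℝ)⁻¹ ^ m * (K * |w a - w b| / t * rexp (-(δ ^ 2 / 16 * (t : ℝ)⁻¹))) := by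
        refine mul_le_mul (pow_le_pow_left₀ (by positivity) (inv_sqrt_le_inv t ht0 ht) m)
          (h1.trans ?_) (abs_nonneg _) (by positivity)
        gcongr
    _ = K * |w a - w b| * ((t : ℝ)⁻¹ ^ (m + 1) * rexp (-(δ ^ 2 / 16 * (t : ℝ)⁻¹))) := by
        rw [pow_succ, div_eq_mul_inv]; ring
    _ ≤ K * |w a - w b| * ((m + 1).factorial / (δ ^ 2 / 16) ^ (m + 1)) := by
        have : 0 ≤ K := (abs_nonneg _).trans hK
        gcongr
    _ = _ := by ring

lemma heatDet_comp_swap (t : NNReal) (y w : Fin m → ℝ) {a b : Fin m} (hab : a ≠ b) :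
    heatDet t y (w ∘ Equiv.swap a b) = -heatDet t y w := by
  have h := Matrix.det_permute (Equiv.swap a b)
    (Matrix.of fun i j => gaussianPDFReal 0 t (y j - w i))
  rw [Equiv.Perm.sign_swap hab, ← heatDet_eq_det] at h
  rw [heatDet_eq_det]
  simpa [Matrix.submatrix] using h

lemma StrictAnti.exists_gap {y : Fin m → ℝ} (hy : StrictAnti y) :
    ∃ δ > 0, ∀ i j, i < j → δ ≤ y i - y j := by
  have h : ∀ᶠ δ : ℝ in nhdsWithin 0 (Ioi 0), ∀ i j, i < j → δ ≤ y i - y j := by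
    simp only [eventually_all]
    intro i j hij
    exact mem_nhdsWithin_of_mem_nhds (Iic_mem_nhds (sub_pos.2 (hy hij)))
  obtain ⟨δ, h1, h2⟩ := (h.and self_mem_nhdsWithin).exists
  exact ⟨δ, h2, h1⟩

lemma abs_sub_ge_of_gap {y : Fin m → ℝ} {δ : ℝ} (h : ∀ i j, i < j → δ ≤ y i - y j)
    {i j : Fin m} (hij : i ≠ j) : δ ≤ |y i - y j| := by
  rcases lt_or_gt_of_ne hij with h' | h'
  · exact (h i j h').trans (le_abs_self _)
  · rw [abs_sub_comm]
    exact (h j i h').trans (le_abs_self _)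

/-- The antisymmetrised heat kernel is Lipschitz at the walls of the Weyl chamber, uniformly in
time. -/
lemma exists_abs_heatDet_le_mul {y : Fin m → ℝ} (hy : StrictAnti y) :
    ∃ L > 0, ∃ r₀ > 0, ∀ t : NNReal, t ≠ 0 → t ≤ 1 → ∀ (w : Fin m → ℝ) (a b : Fin m), a ≠ b →
      |w a - w b| ≤ r₀ → |heatDet t y w| ≤ L * |w a - w b| := by
  obtain ⟨δ, hδ, hgap⟩ := StrictAnti.exists_gap hy
  obtain ⟨K, hK0, hK⟩ : ∃ K > 0, ∀ i j, |y i - y j| ≤ K := by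
    refine ⟨∑ i, |y i| + ∑ i, |y i| + 1, by positivity, fun i j => ?_⟩
    have hi := Finset.single_le_sum (f := fun i => |y i|) (fun i _ => abs_nonneg _)
      (Finset.mem_univ i)
    have hj := Finset.single_le_sum (f := fun i => |y i|) (fun i _ => abs_nonneg _)
      (Finset.mem_univ j)
    have := abs_sub (y i) (y j)
    linarith
  refine ⟨m.factorial * (K * ((m + 1).factorial / (δ ^ 2 / 16) ^ (m + 1))), by positivity,
    δ / 2, by positivity, fun t ht0 ht w a b hab hw => ?_⟩
  have h2 : 2 * heatDet t y w = ∑ σ : Equiv.Perm (Fin m), (Equiv.Perm.sign σ : ℝ) *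
      (heatProd t (y ∘ σ) w - heatProd t (y ∘ σ) (w ∘ Equiv.swap a b)) := by
    simp_rw [mul_sub, Finset.sum_sub_distrib]
    change _ = heatDet t y w - heatDet t y (w ∘ Equiv.swap a b)
    rw [heatDet_comp_swap t y w hab]
    ring
  have h3 := abs_sum_sign_mul_le (f := fun σ : Equiv.Perm (Fin m) =>
      heatProd t (y ∘ σ) w - heatProd t (y ∘ σ) (w ∘ Equiv.swap a b)) fun σ =>
    abs_heatProd_sub_swap_le t ht0 ht (y ∘ σ) w hab hδ
      (abs_sub_ge_of_gap hgap (fun h => hab (σ.injective h))) (hK _ _) hw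
  rw [← h2, abs_mul, abs_two] at h3
  rw [mul_assoc]
  linarith [abs_nonneg (heatDet t y w)]

/-- The open Weyl chamber of strictly decreasing configurations. -/
def chamber (m : ℕ) : Set (Fin m → ℝ) := {w | StrictAnti w}

lemma measurableSet_chamber : MeasurableSet (chamber m) := by
  have : chamber m = ⋂ (i : Fin m) (j : Fin m) (_ : i < j), {w | w j < w i} := by
    ext w
    simp only [chamber, mem_ofPred_eq, mem_iInter]
    exact ⟨fun h i j hij => h hij, fun h i j hij => h i j hij⟩
  rw [this]
  exact MeasurableSet.iInter fun i => MeasurableSet.iInter fun j => MeasurableSet.iInter fun _ =>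
    measurableSet_lt (measurable_pi_apply j) (measurable_pi_apply i)

/-- Transition density to `y`, in `k + 1` steps of variance `s`, of a Gaussian walk that has to be
in the Weyl chamber at the `k` intermediate times. -/
noncomputable def killed (s : NNReal) (y : Fin m → ℝ) : ℕ → (Fin m → ℝ) → ℝ
  | 0, z => heatProd s y z
  | k + 1, z => ∫ e, (chamber m).indicator (killed s y k) (z + e) ∂stepLaw m s

lemma measurable_killed (s : NNReal) (k : ℕ) :
    Measurable fun p : (Fin m → ℝ) × (Fin m → ℝ) => killed s p.1 k p.2 := by
  induction k with
  | zero => exact measurable_heatProd s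
  | succ k ih =>
    refine StronglyMeasurable.measurable ?_
    change StronglyMeasurable fun p : (Fin m → ℝ) × (Fin m → ℝ) =>
      ∫ e, (chamber m).indicator (killed s p.1 k) (p.2 + e) ∂stepLaw m s
    refine StronglyMeasurable.integral_prod_right
      (f := fun (p : (Fin m → ℝ) × (Fin m → ℝ)) e =>
        (chamber m).indicator (killed s p.1 k) (p.2 + e)) ?_
    refine Measurable.stronglyMeasurable ?_
    exact (ih.indicator (measurable_snd measurableSet_chamber)).comp
      (f := fun q : ((Fin m → ℝ) × (Fin m → ℝ)) × (Fin m → ℝ) => (q.1.1, q.1.2 + q.2))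
      (by fun_prop)

lemma measurable_killed_right (s : NNReal) (y : Fin m → ℝ) (k : ℕ) : Measurable (killed s y k) :=
  (measurable_killed s k).comp measurable_prodMk_left

lemma succ_mul_ne_zero {s : NNReal} (hs : s ≠ 0) (k : ℕ) : ((k : NNReal) + 1) * s ≠ 0 :=
  mul_ne_zero (by positivity) hs

lemma succ_mul_le_one_of_succ {s : NNReal} {k : ℕ}
    (hk : (((k + 1 : ℕ) : NNReal) + 1) * s ≤ 1) : ((k : NNReal) + 1) * s ≤ 1 := by
  refine le_trans ?_ hk
  gcongr
  simp

lemma killed_nonneg (s : NNReal) (y : Fin m → ℝ) (k : ℕ) (z : Fin m → ℝ) :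
    0 ≤ killed s y k z := by
  induction k generalizing z with
  | zero => exact heatProd_nonneg s y z
  | succ k ih => exact integral_nonneg fun e => indicator_nonneg (fun w _ => ih w) _

lemma killed_le (s : NNReal) (hs : s ≠ 0) (y : Fin m → ℝ) (k : ℕ)
    (hk : ((k : NNReal) + 1) * s ≤ 1) (z : Fin m → ℝ) :
    killed s y k z ≤ heatProd (((k : NNReal) + 1) * s) y z := by
  induction k generalizing z with
  | zero => simp [killed]
  | succ k ih =>
    have hk' := succ_mul_le_one_of_succ hk
    have hst : (((k + 1 : ℕ) : NNReal) + 1) * s = s + ((k : NNReal) + 1) * s := by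
      push_cast; ring
    rw [hst, ← integral_heatProd_add s _ hs (succ_mul_ne_zero hs k)]
    refine integral_mono_of_nonneg
      (ae_of_all _ fun e => indicator_nonneg (fun w _ => killed_nonneg s y k w) _)
      (integrable_heatProd_add s _ (succ_mul_ne_zero hs k) hk' y z) (ae_of_all _ fun e => ?_)
    exact indicator_apply_le' (fun _ => ih hk' _) (fun _ => heatProd_nonneg _ _ _)

lemma integrable_indicator_killed (s : NNReal) (hs : s ≠ 0) (y : Fin m → ℝ) (k : ℕ)
    (hk : ((k : NNReal) + 1) * s ≤ 1) (z : Fin m → ℝ) :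
    Integrable (fun e => (chamber m).indicator (killed s y k) (z + e)) (stepLaw m s) := by
  refine integrable_of_abs_le
    (((measurable_killed_right s y k).indicator measurableSet_chamber).comp (by fun_prop))
    (c := ((((k : NNReal) + 1) * s : NNReal) : ℝ)⁻¹ ^ m) fun e => ?_
  rw [abs_of_nonneg (indicator_nonneg (fun w _ => killed_nonneg s y k w) _)]
  exact indicator_apply_le' (fun _ => (killed_le s hs y k hk _).trans
    (heatProd_le _ (succ_mul_ne_zero hs k) hk _ _)) (fun _ => by positivity)

lemma exists_inversion {σ : Equiv.Perm (Fin m)} (hσ : σ ≠ 1) : ∃ a b, a < b ∧ σ b < σ a := by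
  by_contra! h
  refine hσ (Equiv.ext fun i => ?_)
  have hmono : StrictMono σ := fun a b hab =>
    lt_of_le_of_ne (h a b hab) fun e => hab.ne (σ.injective e)
  exact congrFun ((hmono.range_inj strictMono_id).1 (by simp)) i

lemma abs_heatDet_sub_heatProd_le (s : NNReal) (hs : s ≠ 0) (hs1 : s ≤ 1) {y z : Fin m → ℝ}
    {δ : ℝ} (hδ : 0 ≤ δ) (hgap : ∀ i j, i < j → δ ≤ y i - y j) (hz : StrictAnti z) :
    |heatDet s y z - heatProd s y z| ≤
      m.factorial * ((s : ℝ)⁻¹ ^ m * rexp (-(δ ^ 2 / (4 * s)))) := by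
  have hs' : (0 : ℝ) < s := NNReal.coe_pos.2 (pos_iff_ne_zero.2 hs)
  have h : heatDet s y z - heatProd s y z = ∑ σ : Equiv.Perm (Fin m),
      (Equiv.Perm.sign σ : ℝ) * (if σ = 1 then 0 else heatProd s (y ∘ σ) z) := by
    rw [heatDet, ← Finset.add_sum_erase _ _ (Finset.mem_univ (1 : Equiv.Perm (Fin m))),
      ← Finset.add_sum_erase _ (fun σ : Equiv.Perm (Fin m) =>
      (Equiv.Perm.sign σ : ℝ) * (if σ = 1 then 0 else heatProd s (y ∘ σ) z))
        (Finset.mem_univ (1 : Equiv.Perm (Fin m)))]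
    simp only [Equiv.Perm.sign_one, Units.val_one, Int.cast_one, one_mul, Equiv.Perm.coe_one,
      Function.comp_id, add_sub_cancel_left, if_true, zero_add]
    refine Finset.sum_congr rfl fun σ hσ => ?_
    rw [if_neg (Finset.ne_of_mem_erase hσ)]
  rw [h]
  refine abs_sum_sign_mul_le fun σ => ?_
  split_ifs with hσ
  · rw [abs_zero]; positivity
  rw [abs_of_nonneg (heatProd_nonneg _ _ _), heatProd_eq_exp]
  obtain ⟨a, b, hab, hσab⟩ := exists_inversion hσ
  have h1 := sq_div_le_sum_sq_div hs' (y ∘ σ) z hab.ne hδ (by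
    have h2 := hgap _ _ hσab
    have h3 := hz hab
    rw [abs_sub_comm]
    refine le_trans ?_ (le_abs_self _)
    simp only [Function.comp]
    linarith)
  refine mul_le_mul (pow_le_pow_left₀ (by positivity) (inv_sqrt_le_inv s hs hs1) m)
    (Real.exp_le_exp.2 (neg_le_neg h1)) (by positivity) (by positivity)

/-- The increments with at least one coordinate larger than `r / 2`. -/
def largeJump (m : ℕ) (r : ℝ) : Set (Fin m → ℝ) := {e | ∃ i, r / 2 < |e i|}

lemma measurableSet_largeJump (r : ℝ) : MeasurableSet (largeJump m r) := by
  have : largeJump m r = ⋃ i, {e | r / 2 < |e i|} := by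
    ext e; simp [largeJump]
  rw [this]
  exact MeasurableSet.iUnion fun i => measurableSet_lt measurable_const (by fun_prop)

lemma gaussianReal_abs_gt_le (s : NNReal) (hs : s ≠ 0) {ρ : ℝ} (hρ : 0 ≤ ρ) :
    (gaussianReal 0 s).real {x | ρ < |x|} ≤ 2 * rexp (-(ρ ^ 2 / (2 * s))) := by
  have hs' : (0 : ℝ) < s := NNReal.coe_pos.2 (pos_iff_ne_zero.2 hs)
  have h1 := measure_ge_le_exp_mul_mgf (X := id) (μ := gaussianReal 0 s) ρ
    (t := ρ / s) (by positivity) (integrable_exp_mul_gaussianReal _)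
  have h2 := measure_le_le_exp_mul_mgf (X := id) (μ := gaussianReal 0 s) (-ρ)
    (t := -(ρ / s)) (by simp; positivity) (integrable_exp_mul_gaussianReal _)
  rw [mgf_id_gaussianReal, ← Real.exp_add] at h1 h2
  have e1 : -(ρ / s) * ρ + (0 * (ρ / s) + s * (ρ / s) ^ 2 / 2) = -(ρ ^ 2 / (2 * s)) := by
    field_simp; ring
  have e2 : - -(ρ / s) * -ρ + (0 * -(ρ / s) + s * (-(ρ / s)) ^ 2 / 2) = -(ρ ^ 2 / (2 * s)) := by
    field_simp; ring
  rw [e1] at h1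
  rw [e2] at h2
  refine (measureReal_mono (s₂ := {x | ρ ≤ id x} ∪ {x | id x ≤ -ρ}) ?_).trans
    ((measureReal_union_le _ _).trans (by linarith))
  intro x hx
  rcases lt_abs.1 (mem_ofPred_eq ▸ hx) with h | h
  · exact Or.inl h.le
  · right; simp only [id, mem_ofPred_eq]; linarith

lemma stepLaw_largeJump_le (s : NNReal) (hs : s ≠ 0) {r : ℝ} (hr : 0 ≤ r) :
    (stepLaw m s).real (largeJump m r) ≤ m * (2 * rexp (-((r / 2) ^ 2 / (2 * s)))) := by
  have : largeJump m r = ⋃ i, {e | r / 2 < |e i|} := by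
    ext e; simp [largeJump]
  rw [this]
  refine (measureReal_iUnion_fintype_le _).trans
    ((Finset.sum_le_sum (g := fun _ => 2 * rexp (-((r / 2) ^ 2 / (2 * s)))) fun i _ => ?_).trans_eq
      (by simp))
  have h := (measurePreserving_eval (fun _ : Fin m => gaussianReal 0 s) i).measureReal_preimage
    (s := {x | r / 2 < |x|}) (measurableSet_lt measurable_const (by fun_prop)).nullMeasurableSet
  change (stepLaw m s).real (Function.eval i ⁻¹' {x | r / 2 < |x|}) ≤ _
  rw [stepLaw, h]
  exact gaussianReal_abs_gt_le s hs (by positivity)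

/-- Optional stopping at the exit from the Weyl chamber, with the error made by overshooting. -/
lemma abs_heatDet_sub_killed_le (s : NNReal) (hs : s ≠ 0) {y : Fin m → ℝ} {β ε r : ℝ}
    (hβ : 0 ≤ β) (hε : 0 ≤ ε)
    (hbase : ∀ z ∈ chamber m, |heatDet s y z - heatProd s y z| ≤ β)
    (hwall : ∀ t : NNReal, t ≠ 0 → t ≤ 1 → ∀ (w : Fin m → ℝ) (a b : Fin m), a ≠ b →
      |w a - w b| ≤ r → |heatDet t y w| ≤ ε) (k : ℕ) (hk : ((k : NNReal) + 1) * s ≤ 1)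
    {z : Fin m → ℝ} (hz : z ∈ chamber m) :
    |heatDet (((k : NNReal) + 1) * s) y z - killed s y k z| ≤
      β + ε + k * (m.factorial * (s : ℝ)⁻¹ ^ m * (stepLaw m s).real (largeJump m r)) := by
  set M : ℝ := m.factorial * (s : ℝ)⁻¹ ^ m with hM
  have hM0 : 0 ≤ M := by positivity
  induction k generalizing z with
  | zero => simpa [killed] using (hbase z hz).trans (by linarith)
  | succ k ih =>
    have hk' := succ_mul_le_one_of_succ hk
    have ht0 := succ_mul_ne_zero hs k
    have hst : (((k + 1 : ℕ) : NNReal) + 1) * s = s + ((k : NNReal) + 1) * s := by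
      push_cast; ring
    rw [hst, ← integral_heatDet_add s _ hs ht0 hk', killed,
      ← integral_sub (integrable_heatDet_add s _ ht0 hk' y z)
        (integrable_indicator_killed s hs y k hk' z)]
    set B : ℝ := β + ε + k * (M * (stepLaw m s).real (largeJump m r)) with hB
    have hB0 : β + ε ≤ B := by
      have : 0 ≤ k * (M * (stepLaw m s).real (largeJump m r)) := by positivity
      linarith
    have hint : Integrable (fun e => B + (largeJump m r).indicator (fun _ => M) e)
        (stepLaw m s) :=
      (integrable_const _).add ((integrable_const _).indicator (measurableSet_largeJump r))
    have hval : ∫ e, (B + (largeJump m r).indicator (fun _ => M) e) ∂stepLaw m s =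
        β + ε + ((k + 1 : ℕ) : ℝ) * (M * (stepLaw m s).real (largeJump m r)) := by
      rw [integral_add (integrable_const _)
        ((integrable_const _).indicator (measurableSet_largeJump r)),
        integral_indicator_const _ (measurableSet_largeJump r)]
      simp only [integral_const, probReal_univ, smul_eq_mul, one_mul, hB]
      push_cast
      ring
    rw [← hval]
    refine (abs_integral_le_integral_abs).trans (integral_mono_of_nonneg
      (ae_of_all _ fun e => abs_nonneg _) hint (ae_of_all _ fun e => ?_))
    have hind : 0 ≤ (largeJump m r).indicator (fun _ => M) e := indicator_nonneg (fun _ _ => hM0) _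
    by_cases he : z + e ∈ chamber m
    · simp only [indicator_of_mem he]
      linarith [ih hk' he]
    · simp only [indicator_of_notMem he, sub_zero]
      by_cases hj : e ∈ largeJump m r
      · rw [indicator_of_mem hj]
        have h1 := abs_heatDet_le _ ht0 hk' y (z + e)
        have h2 : ((((k : NNReal) + 1) * s : NNReal) : ℝ)⁻¹ ≤ (s : ℝ)⁻¹ := by
          have hs' : (0 : ℝ) < s := NNReal.coe_pos.2 (pos_iff_ne_zero.2 hs)
          push_cast
          gcongr
          nlinarith [(Nat.cast_nonneg k : (0 : ℝ) ≤ k)]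
        have h3 : (m.factorial : ℝ) * ((((k : NNReal) + 1) * s : NNReal) : ℝ)⁻¹ ^ m ≤ M := by
          rw [hM]; gcongr
        linarith
      · obtain ⟨a, b, hab, hle⟩ : ∃ a b, a < b ∧ (z + e) a ≤ (z + e) b := by
          by_contra! h
          exact he fun a b hab => h a b hab
        simp only [largeJump, mem_ofPred_eq, not_exists, not_lt] at hj
        have hzab : z b < z a := hz hab
        have h1 : |(z + e) a - (z + e) b| ≤ r := by
          simp only [Pi.add_apply] at hle ⊢
          rw [abs_sub_comm, abs_of_nonneg (by linarith)]
          linarith [(abs_le.1 (hj a)).1, (abs_le.1 (hj b)).2]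
        linarith [hwall _ ht0 hk' _ a b hab.ne h1]

lemma tendsto_pow_mul_exp_neg_mul (k : ℕ) {c : ℝ} (hc : 0 < c) :
    Tendsto (fun n : ℕ => ((n : ℝ) + 1) ^ k * rexp (-(c * ((n : ℝ) + 1)))) atTop (nhds 0) := by
  have h := (Real.tendsto_pow_mul_exp_neg_atTop_nhds_zero k).comp
    ((tendsto_natCast_atTop_atTop.atTop_add (tendsto_const_nhds (x := (1 : ℝ)))).const_mul_atTop hc)
  have h2 := h.const_mul ((c ^ k)⁻¹)
  rw [mul_zero] at h2
  refine h2.congr fun n => ?_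
  simp only [Function.comp, mul_pow]
  field_simp

/-- The variance `1 / (k + 1)` of a step when a unit of time is cut into `k + 1` steps. -/
noncomputable def stepVar (k : ℕ) : NNReal := ((k : NNReal) + 1)⁻¹

lemma stepVar_ne_zero (k : ℕ) : stepVar k ≠ 0 := by unfold stepVar; positivity

lemma succ_mul_stepVar (k : ℕ) : ((k : NNReal) + 1) * stepVar k = 1 :=
  mul_inv_cancel₀ (by positivity)

lemma stepVar_le_one (k : ℕ) : stepVar k ≤ 1 := inv_le_one_of_one_le₀ (by simp)

lemma inv_coe_stepVar (k : ℕ) : ((stepVar k : NNReal) : ℝ)⁻¹ = (k : ℝ) + 1 := by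
  simp [stepVar]

/-- The Karlin–McGregor formula: the transition density of the walk killed outside the Weyl chamber
at the grid times converges to the antisymmetrised heat kernel. -/
lemma tendsto_killed {x y : Fin m → ℝ} (hx : StrictAnti x) (hy : StrictAnti y) :
    Tendsto (fun k => killed (stepVar k) y k x) atTop (nhds (heatDet 1 y x)) := by
  obtain ⟨δ, hδ, hgap⟩ := StrictAnti.exists_gap hy
  obtain ⟨L, hL, r₀, hr₀, hwall⟩ := exists_abs_heatDet_le_mul hy
  refine Metric.tendsto_atTop.2 fun ε hε => ?_
  set r : ℝ := min r₀ (ε / (2 * L)) with hr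
  have hr0 : 0 < r := by positivity
  have hrL : L * r ≤ ε / 2 := by
    calc L * r ≤ L * (ε / (2 * L)) := by gcongr; exact min_le_right _ _
      _ = ε / 2 := by field_simp
  have hlim := ((tendsto_pow_mul_exp_neg_mul m (c := δ ^ 2 / 4) (by positivity)).const_mul
    (m.factorial : ℝ)).add ((tendsto_pow_mul_exp_neg_mul (m + 1) (c := r ^ 2 / 8)
      (by positivity)).const_mul (m.factorial * (m * 2) : ℝ))
  simp only [mul_zero, add_zero] at hlim
  obtain ⟨K, hK⟩ := eventually_atTop.1 (hlim.eventually_lt_const (half_pos hε))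
  refine ⟨K, fun k hk => ?_⟩
  have hs := stepVar_ne_zero k
  have h1 := abs_heatDet_sub_killed_le (stepVar k) hs (y := y) (ε := L * r) (r := r)
    (by positivity) (by positivity)
    (fun z hz => abs_heatDet_sub_heatProd_le (stepVar k) hs (stepVar_le_one k) hδ.le hgap hz)
    (fun t ht0 ht w a b hab hw => (hwall t ht0 ht w a b hab (hw.trans (min_le_left _ _))).trans
      (by gcongr)) k (succ_mul_stepVar k).le hx
  have h2 := stepLaw_largeJump_le (m := m) (stepVar k) hs hr0.le
  have e1 : δ ^ 2 / (4 * (stepVar k : ℝ)) = δ ^ 2 / 4 * ((k : ℝ) + 1) := by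
    rw [← inv_coe_stepVar, div_mul_eq_div_div, div_eq_mul_inv]
  have e2 : (r / 2) ^ 2 / (2 * (stepVar k : ℝ)) = r ^ 2 / 8 * ((k : ℝ) + 1) := by
    rw [← inv_coe_stepVar, div_mul_eq_div_div, div_eq_mul_inv]
    ring
  rw [succ_mul_stepVar, inv_coe_stepVar, e1] at h1
  rw [e2] at h2
  have h3 : (k : ℝ) * (m.factorial * ((k : ℝ) + 1) ^ m *
      (stepLaw m (stepVar k)).real (largeJump m r)) ≤
      m.factorial * (m * 2) *
        (((k : ℝ) + 1) ^ (m + 1) * rexp (-(r ^ 2 / 8 * ((k : ℝ) + 1)))) := by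
    calc _ ≤ ((k : ℝ) + 1) * (m.factorial * ((k : ℝ) + 1) ^ m *
          (m * (2 * rexp (-(r ^ 2 / 8 * ((k : ℝ) + 1)))))) := by
          gcongr
          linarith
      _ = _ := by ring
  rw [dist_comm, Real.dist_eq]
  linarith [hK k hk]

lemma stepLaw_eq_withDensity (s : NNReal) (hs : s ≠ 0) :
    stepLaw m s = volume.withDensity fun e => ENNReal.ofReal (heatProd s e 0) := by
  refine Measure.pi_eq fun t ht => ?_
  rw [withDensity_apply _ (MeasurableSet.univ_pi ht), volume_pi, Measure.restrict_pi_pi]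
  have hint : ∀ i, Integrable (gaussianPDFReal 0 s) (volume.restrict (t i)) := fun i =>
    (integrable_gaussianPDFReal 0 s).restrict
  simp only [heatProd, Pi.zero_apply, sub_zero]
  rw [← ofReal_integral_eq_lintegral_ofReal (Integrable.fintype_prod hint)
    (ae_of_all _ fun e => Finset.prod_nonneg fun i _ => gaussianPDFReal_nonneg _ _ _),
    integral_fintype_prod_eq_prod (fun _ => gaussianPDFReal 0 s),
    ENNReal.ofReal_prod_of_nonneg fun i _ =>
      integral_nonneg fun x => gaussianPDFReal_nonneg _ _ _]
  exact Finset.prod_congr rfl fun i _ => (gaussianReal_apply_eq_integral 0 hs (t i)).symm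

/-- The position after the steps `0, …, j`. -/
def partialSum {k : ℕ} (ω : Fin k → Fin m → ℝ) (j : Fin k) : Fin m → ℝ :=
  ∑ i, if i ≤ j then ω i else 0

lemma partialSum_zero {k : ℕ} (ω : Fin (k + 1) → Fin m → ℝ) : partialSum ω 0 = ω 0 := by
  simp [partialSum]

lemma partialSum_succ {k : ℕ} (ω : Fin (k + 1) → Fin m → ℝ) (j : Fin k) :
    partialSum ω j.succ = ω 0 + partialSum (fun i => ω i.succ) j := by
  simp [partialSum, Fin.sum_univ_succ]

@[fun_prop]
lemma measurable_partialSum {k : ℕ} (j : Fin k) :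
    Measurable fun ω : Fin k → Fin m → ℝ => partialSum ω j := by
  unfold partialSum
  refine Finset.measurable_sum _ fun i _ => ?_
  split_ifs
  · exact measurable_pi_apply i
  · exact measurable_const

/-- The steps for which the walk started at `z` remains in the Weyl chamber. -/
def staysIn (k : ℕ) (z : Fin m → ℝ) : Set (Fin k → Fin m → ℝ) :=
  {ω | ∀ j, z + partialSum ω j ∈ chamber m}

lemma measurableSet_setOf_mem_staysIn {α : Type*} [MeasurableSpace α] {k : ℕ} {f : α → Fin m → ℝ}
    {g : α → Fin k → Fin m → ℝ} (hf : Measurable f) (hg : Measurable g) :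
    MeasurableSet {a | g a ∈ staysIn k (f a)} := by
  have : {a | g a ∈ staysIn k (f a)} = ⋂ j, {a | f a + partialSum (g a) j ∈ chamber m} := by
    ext; simp [staysIn]
  rw [this]
  exact MeasurableSet.iInter fun j =>
    measurableSet_chamber.preimage (hf.add ((measurable_partialSum j).comp hg))

lemma mem_staysIn_succ {k : ℕ} {z : Fin m → ℝ} {ω : Fin (k + 1) → Fin m → ℝ} :
    ω ∈ staysIn (k + 1) z ↔
      z + ω 0 ∈ chamber m ∧ (fun i : Fin k => ω i.succ) ∈ staysIn k (z + ω 0) := by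
  simp [staysIn, Fin.forall_fin_succ, partialSum_zero, partialSum_succ, add_assoc]

lemma lintegral_staysIn (s : NNReal) (hs : s ≠ 0) (y : Fin m → ℝ) (k : ℕ)
    (hk : ((k : NNReal) + 1) * s ≤ 1) (z : Fin m → ℝ) :
    ∫⁻ ω, (staysIn k z).indicator (fun ω => ENNReal.ofReal (heatProd s y (z + ∑ i, ω i))) ω
      ∂(Measure.pi fun _ : Fin k => stepLaw m s) = ENNReal.ofReal (killed s y k z) := by
  induction k generalizing z with
  | zero => simp [staysIn, killed]
  | succ k ih =>
    have hk' := succ_mul_le_one_of_succ hk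
    have hmp := (measurePreserving_piFinSuccAbove (fun _ : Fin (k + 1) => stepLaw m s) 0).symm
    rw [← hmp.lintegral_comp_emb (MeasurableEquiv.measurableEmbedding _), lintegral_prod]
    · have hstep : ∀ e : Fin m → ℝ, ∫⁻ ω : Fin k → Fin m → ℝ, (staysIn (k + 1) z).indicator
          (fun ω => ENNReal.ofReal (heatProd s y (z + ∑ i, ω i)))
          ((MeasurableEquiv.piFinSuccAbove (fun _ => Fin m → ℝ) 0).symm (e, ω))
          ∂(Measure.pi fun _ : Fin k => stepLaw m s) =
          ENNReal.ofReal ((chamber m).indicator (killed s y k) (z + e)) := by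
        intro e
        have hset : ∀ ω : Fin k → Fin m → ℝ, (staysIn (k + 1) z).indicator
            (fun ω => ENNReal.ofReal (heatProd s y (z + ∑ i, ω i)))
            ((MeasurableEquiv.piFinSuccAbove (fun _ => Fin m → ℝ) 0).symm (e, ω)) =
            (chamber m).indicator (fun _ => (staysIn k (z + e)).indicator (fun ω =>
              ENNReal.ofReal (heatProd s y (z + e + ∑ i, ω i))) ω) (z + e) := by
          intro ω
          have e1 : (MeasurableEquiv.piFinSuccAbove (fun _ => Fin m → ℝ) 0).symm (e, ω) =
            (Fin.cons e ω : Fin (k + 1) → Fin m → ℝ) := by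
            simp [MeasurableEquiv.piFinSuccAbove, Fin.insertNthEquiv]
          rw [e1]
          classical
          simp only [indicator_apply, mem_staysIn_succ, Fin.cons_zero, Fin.cons_succ,
            Fin.sum_univ_succ, add_assoc]
          split_ifs <;> simp_all
        simp_rw [hset]
        by_cases he : z + e ∈ chamber m
        · simp only [indicator_of_mem he]
          exact ih hk' _
        · simp [indicator_of_notMem he]
      refine (lintegral_congr hstep).trans ?_
      rw [killed, ofReal_integral_eq_lintegral_ofReal
        (integrable_indicator_killed s hs y k hk' z)
        (ae_of_all _ fun e => indicator_nonneg (fun w _ => killed_nonneg s y k w) _)]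
    · have hG : Measurable ((staysIn (k + 1) z).indicator
          (fun ω => ENNReal.ofReal (heatProd s y (z + ∑ i, ω i)))) :=
        ((measurable_heatProd_right s y).comp (by fun_prop)).ennreal_ofReal.indicator
          (measurableSet_setOf_mem_staysIn (f := fun _ => z) measurable_const measurable_id)
      exact (hG.comp (MeasurableEquiv.measurable _)).aemeasurable

/-- The walk of `k + 1` steps on `m` particles whose starting points `f` depend on the total
displacement: conditioning on the displacement. -/
lemma measure_staysIn_eq_lintegral (s : NNReal) (hs : s ≠ 0) (k : ℕ)
    (hk : ((k : NNReal) + 1) * s ≤ 1) {f : (Fin m → ℝ) → Fin m → ℝ} (hf : Measurable f)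
    {H : Set (Fin m → ℝ)} (hH : MeasurableSet H) :
    (Measure.pi fun _ : Fin (k + 1) => stepLaw m s)
      {ω | ∑ i, ω i ∈ H ∧ (fun i : Fin k => ω i.castSucc) ∈ staysIn k (f (∑ i, ω i))} =
      ∫⁻ d in H, ENNReal.ofReal (killed s (f d + d) k (f d)) := by
  set ν := Measure.pi fun _ : Fin k => stepLaw m s with hν
  have hmp := (measurePreserving_piFinSuccAbove (fun _ : Fin (k + 1) => stepLaw m s)
    (Fin.last k)).symm
  have hHm : MeasurableSet {ω : Fin (k + 1) → Fin m → ℝ |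
      ∑ i, ω i ∈ H ∧ (fun i : Fin k => ω i.castSucc) ∈ staysIn k (f (∑ i, ω i))} :=
    (hH.preimage (by fun_prop)).inter
      (measurableSet_setOf_mem_staysIn (hf.comp (by fun_prop)) (by fun_prop))
  set F : (Fin m → ℝ) → (Fin k → Fin m → ℝ) → ENNReal := fun d ω =>
    H.indicator (fun d => (staysIn k (f d)).indicator 1 ω) d with hF
  have hFm : Measurable fun p : (Fin m → ℝ) × (Fin k → Fin m → ℝ) => F p.1 p.2 := by
    have : (fun p : (Fin m → ℝ) × (Fin k → Fin m → ℝ) => F p.1 p.2) =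
        ({p | p.1 ∈ H} ∩ {p | p.2 ∈ staysIn k (f p.1)}).indicator 1 := by
      classical
      ext p
      simp only [hF, indicator_apply, mem_inter_iff, mem_ofPred_eq, Pi.one_apply]
      split_ifs <;> simp_all
    rw [this]
    exact measurable_one.indicator ((hH.preimage measurable_fst).inter
      (measurableSet_setOf_mem_staysIn (hf.comp measurable_fst) measurable_snd))
  have h1 : ∀ p : (Fin m → ℝ) × (Fin k → Fin m → ℝ),
      {ω : Fin (k + 1) → Fin m → ℝ | ∑ i, ω i ∈ H ∧
        (fun i : Fin k => ω i.castSucc) ∈ staysIn k (f (∑ i, ω i))}.indicator 1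
        ((MeasurableEquiv.piFinSuccAbove (fun _ => Fin m → ℝ) (Fin.last k)).symm p) =
      F (p.1 + ∑ i, p.2 i) p.2 := by
    rintro ⟨e, ω⟩
    have e1 : (MeasurableEquiv.piFinSuccAbove (fun _ => Fin m → ℝ) (Fin.last k)).symm (e, ω) =
        (Fin.snoc ω e : Fin (k + 1) → Fin m → ℝ) := by
      simp [MeasurableEquiv.piFinSuccAbove, Fin.insertNthEquiv]
    rw [e1]
    classical
    simp only [hF, indicator_apply, mem_ofPred_eq, Fin.sum_univ_castSucc, Fin.snoc_castSucc,
      Fin.snoc_last, add_comm e, Pi.one_apply]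
    split_ifs <;> simp_all
  rw [← lintegral_indicator_one hHm,
    ← hmp.lintegral_comp_emb (MeasurableEquiv.measurableEmbedding _)]
  simp_rw [h1]
  have hmap : Measurable fun p : (Fin m → ℝ) × (Fin k → Fin m → ℝ) =>
      ((p.1 + ∑ i, p.2 i, p.2) : (Fin m → ℝ) × (Fin k → Fin m → ℝ)) := by fun_prop
  have hFm' : Measurable fun p : (Fin m → ℝ) × (Fin k → Fin m → ℝ) =>
      F (p.1 + ∑ i, p.2 i) p.2 := hFm.comp hmap
  rw [lintegral_prod_symm' _ hFm']
  have hheat : Measurable fun e : Fin m → ℝ => ENNReal.ofReal (heatProd s e 0) :=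
    ((measurable_heatProd s).comp (measurable_id.prodMk measurable_const)).ennreal_ofReal
  have h2 : ∀ ω : Fin k → Fin m → ℝ, ∫⁻ e, F (e + ∑ i, ω i) ω ∂stepLaw m s =
      ∫⁻ d, ENNReal.ofReal (heatProd s (d - ∑ i, ω i) 0) * F d ω := by
    intro ω
    have hFω : Measurable fun e => F (e + ∑ i, ω i) ω :=
      hFm'.comp (measurable_id.prodMk measurable_const)
    rw [stepLaw_eq_withDensity s hs,
      lintegral_withDensity_eq_lintegral_mul _ hheat hFω,
      ← lintegral_add_right_eq_self
        (fun d => ENNReal.ofReal (heatProd s (d - ∑ i, ω i) 0) * F d ω) (∑ i, ω i)]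
    simp
  change ∫⁻ ω, ∫⁻ e, F (e + ∑ i, ω i) ω ∂stepLaw m s ∂ν = _
  simp_rw [h2]
  rw [lintegral_lintegral_swap]
  · rw [← lintegral_indicator hH]
    refine lintegral_congr fun d => ?_
    by_cases hd : d ∈ H
    · rw [indicator_of_mem hd, ← lintegral_staysIn s hs _ k hk]
      refine lintegral_congr fun ω => ?_
      classical
      simp only [hF, indicator_apply, if_pos hd, Pi.one_apply, mul_ite, mul_one, mul_zero]
      have : heatProd s (d - ∑ i, ω i) 0 = heatProd s (f d + d) (f d + ∑ i, ω i) := by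
        simp [heatProd]
      rw [this]
    · simp [hF, indicator_of_notMem hd]
  · have h3 : Measurable fun p : (Fin k → Fin m → ℝ) × (Fin m → ℝ) => F p.2 p.1 :=
      hFm.comp measurable_swap
    exact ((hheat.comp (g := fun e : Fin m → ℝ => ENNReal.ofReal (heatProd s e 0))
      (f := fun p : (Fin k → Fin m → ℝ) × (Fin m → ℝ) => p.2 - ∑ i, p.1 i)
      (by fun_prop)).mul h3).aemeasurable

lemma integral_sq_gaussianReal (v : NNReal) : ∫ x, x ^ 2 ∂gaussianReal 0 v = v := by
  rw [← variance_fun_id_gaussianReal (μ := 0) (v := v),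
    variance_of_integral_eq_zero aemeasurable_id' integral_id_gaussianReal]

lemma variance_eq_sum_of_map_eq_gaussianReal {ι Ω : Type*} [Fintype ι] [MeasurableSpace Ω]
    {μ : Measure Ω} {X : ι → Ω → ℝ} (hX : ∀ i, Measurable (X i)) (hXL : ∀ i, MemLp (X i) 2 μ)
    {c : ι → ℝ} {v : NNReal} (hv : μ.map (fun ω => ∑ i, c i * X i ω) = gaussianReal 0 v) :
    (v : ℝ) = ∑ i, ∑ j, c i * c j * ∫ ω, X i ω * X j ω ∂μ := by
  rw [← integral_sq_gaussianReal v, ← hv, integral_map (by fun_prop) (by fun_prop)]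
  have hi : ∀ i j, Integrable (fun ω => X i ω * X j ω) μ := fun i j =>
    (hXL i).integrable_mul (hXL j)
  have h2 : ∀ ω, (∑ i, c i * X i ω) ^ 2 = ∑ i, ∑ j, c i * c j * (X i ω * X j ω) := by
    intro ω
    rw [sq, Finset.sum_mul_sum]
    exact Finset.sum_congr rfl fun i _ => Finset.sum_congr rfl fun j _ => by ring
  simp_rw [h2]
  rw [integral_finsetSum _ fun i _ => integrable_finsetSum _ fun j _ => (hi i j).const_mul _]
  refine Finset.sum_congr rfl fun i _ => ?_
  rw [integral_finsetSum _ fun j _ => (hi i j).const_mul _]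
  exact Finset.sum_congr rfl fun j _ => integral_const_mul _ _

/-- Two centred Gaussian vectors with the same second moments have the same law. -/
lemma map_eq_map_of_gaussian {ι Ω Ω' : Type*} [Fintype ι] [MeasurableSpace Ω] [MeasurableSpace Ω']
    {μ : Measure Ω} {ν : Measure Ω'} [IsFiniteMeasure μ] [IsFiniteMeasure ν]
    {X : ι → Ω → ℝ} {Y : ι → Ω' → ℝ} (hX : ∀ i, Measurable (X i)) (hY : ∀ i, Measurable (Y i))
    (hXL : ∀ i, MemLp (X i) 2 μ) (hYL : ∀ i, MemLp (Y i) 2 ν)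
    (hXg : ∀ c : ι → ℝ, ∃ v : NNReal, μ.map (fun ω => ∑ i, c i * X i ω) = gaussianReal 0 v)
    (hYg : ∀ c : ι → ℝ, ∃ v : NNReal, ν.map (fun ω => ∑ i, c i * Y i ω) = gaussianReal 0 v)
    (hXY : ∀ i j, ∫ ω, X i ω * X j ω ∂μ = ∫ ω, Y i ω * Y j ω ∂ν) :
    μ.map (fun ω i => X i ω) = ν.map (fun ω i => Y i ω) := by
  classical
  refine Measure.ext_of_charFunDual (funext fun L => ?_)
  have hL : ∀ x : ι → ℝ, L x = ∑ i, L (Pi.single i 1) * x i := by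
    intro x
    conv_lhs => rw [← Finset.univ_sum_single x, map_sum]
    refine Finset.sum_congr rfl fun i _ => ?_
    rw [mul_comm, ← smul_eq_mul, ← map_smul, ← Pi.single_smul, smul_eq_mul, mul_one]
  obtain ⟨v, hv⟩ := hXg fun i => L (Pi.single i 1)
  obtain ⟨w, hw⟩ := hYg fun i => L (Pi.single i 1)
  have hvw : v = w := by
    rw [← NNReal.coe_inj, variance_eq_sum_of_map_eq_gaussianReal hX hXL hv,
      variance_eq_sum_of_map_eq_gaussianReal hY hYL hw]
    simp_rw [hXY]
  simp_rw [← hL] at hv hw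
  rw [charFunDual_eq_charFun_map_one, charFunDual_eq_charFun_map_one,
    Measure.map_map (by fun_prop) (by fun_prop), Measure.map_map (by fun_prop) (by fun_prop)]
  exact congrArg (charFun · 1) (hv.trans (hvw ▸ hw.symm))

lemma isGaussian_pi {ι E : Type*} [Fintype ι] [NormedAddCommGroup E] [NormedSpace ℝ E]
    [CompleteSpace E] [SecondCountableTopology E] [MeasurableSpace E] [BorelSpace E]
    (ν : ι → Measure E) [∀ i, IsGaussian (ν i)] : IsGaussian (Measure.pi ν) := by
  have h := iIndepFun.hasGaussianLaw (P := Measure.pi ν) (X := fun i (ω : ι → E) => ω i)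
    (fun i => ⟨by
      change IsGaussian ((Measure.pi ν).map (Function.eval i))
      rw [(measurePreserving_eval ν i).map_eq]; infer_instance⟩)
    (iIndepFun_pi (X := fun _ ω => ω) fun i => aemeasurable_id)
  have := h.isGaussian_map
  simpa using this

lemma integral_comp_eval_pi {ι E : Type*} [Fintype ι] [MeasurableSpace E] (ν : Measure E)
    [IsProbabilityMeasure ν] {g : E → ℝ} (hg : Measurable g) (j : ι) :
    ∫ ω, g (ω j) ∂(Measure.pi fun _ : ι => ν) = ∫ x, g x ∂ν := by
  have hmp := measurePreserving_eval (fun _ : ι => ν) j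
  conv_rhs => rw [← hmp.map_eq]
  exact (integral_map hmp.measurable.aemeasurable hg.aestronglyMeasurable).symm

lemma integral_eval_mul_eval_pi {ι E : Type*} [Fintype ι] [MeasurableSpace E] (ν : Measure E)
    [IsProbabilityMeasure ν] {f g : E → ℝ} (hf : Measurable f) (hg : Measurable g) {i j : ι}
    (hij : i ≠ j) (hg0 : ∫ x, g x ∂ν = 0) :
    ∫ ω, f (ω i) * g (ω j) ∂(Measure.pi fun _ : ι => ν) = 0 := by
  have h := (iIndepFun_pi (μ := fun _ : ι => ν) (X := fun _ ω => ω)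
    fun i => aemeasurable_id).indepFun hij
  have h' := (h.comp hf hg).integral_fun_mul_eq_mul_integral
    (hf.comp (measurable_pi_apply i)).aestronglyMeasurable
    (hg.comp (measurable_pi_apply j)).aestronglyMeasurable
  simpa [Function.comp_def, integral_comp_eval_pi ν hg j, hg0] using h'

instance (s : NNReal) : IsGaussian (stepLaw m s) := isGaussian_pi _

instance (k : ℕ) (s : NNReal) : IsGaussian (Measure.pi fun _ : Fin k => stepLaw m s) :=
  isGaussian_pi _

lemma integral_coord_stepLaw (s : NNReal) (i : Fin m) : ∫ e, e i ∂stepLaw m s = 0 :=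
  (integral_comp_eval_pi (gaussianReal 0 s) measurable_id i).trans integral_id_gaussianReal

lemma integral_coord_mul_coord_stepLaw (s : NNReal) (i i' : Fin m) :
    ∫ e, e i * e i' ∂stepLaw m s = if i = i' then (s : ℝ) else 0 := by
  split_ifs with h
  · subst h
    rw [← integral_sq_gaussianReal s,
      ← integral_comp_eval_pi (gaussianReal 0 s) (g := fun x => x ^ 2) (by fun_prop) i]
    exact integral_congr_ae (ae_of_all _ fun e => (sq _).symm)
  · exact integral_eval_mul_eval_pi _ measurable_id measurable_id h integral_id_gaussianReal

lemma integral_coord_mul_coord (s : NNReal) {k : ℕ} (j j' : Fin k) (i i' : Fin m) :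
    ∫ ω, ω j i * ω j' i' ∂(Measure.pi fun _ : Fin k => stepLaw m s) =
      if j = j' ∧ i = i' then (s : ℝ) else 0 := by
  by_cases h : j = j'
  · subst h
    simp only [true_and]
    rw [← integral_coord_mul_coord_stepLaw]
    exact integral_comp_eval_pi (stepLaw m s) (g := fun e => e i * e i') (by fun_prop) j
  · rw [if_neg (by simp [h])]
    exact integral_eval_mul_eval_pi _ (measurable_pi_apply i) (measurable_pi_apply i') h
      (integral_coord_stepLaw s _)

/-- The sum over the steps `j` of the coordinates `τ j`. -/
def selectSum {k : ℕ} (τ : Fin k → Fin m) (ω : Fin k → Fin m → ℝ) : ℝ := ∑ j, ω j (τ j)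

lemma measurable_selectSum {k : ℕ} (τ : Fin k → Fin m) : Measurable (selectSum τ) := by
  unfold selectSum; fun_prop

lemma memLp_coord (s : NNReal) {k : ℕ} (j : Fin k) (i : Fin m) :
    MemLp (fun ω : Fin k → Fin m → ℝ => ω j i) 2 (Measure.pi fun _ : Fin k => stepLaw m s) :=
  IsGaussian.memLp_dual (Measure.pi fun _ : Fin k => stepLaw m s)
    ((ContinuousLinearMap.proj i : (Fin m → ℝ) →L[ℝ] ℝ).comp
      (ContinuousLinearMap.proj j : (Fin k → Fin m → ℝ) →L[ℝ] (Fin m → ℝ))) 2 (by simp)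

lemma exists_map_sum_selectSum (s : NNReal) {ι : Type*} [Fintype ι] {k : ℕ}
    (τ : ι → Fin k → Fin m) (c : ι → ℝ) :
    ∃ v : NNReal, (Measure.pi fun _ : Fin k => stepLaw m s).map
      (fun ω => ∑ q, c q * selectSum (τ q) ω) = gaussianReal 0 v := by
  let L : StrongDual ℝ (Fin k → Fin m → ℝ) := ∑ q, c q • ∑ j,
    (ContinuousLinearMap.proj (τ q j) : (Fin m → ℝ) →L[ℝ] ℝ).comp (ContinuousLinearMap.proj j)
  have hL : (fun ω => ∑ q, c q * selectSum (τ q) ω) = L := by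
    ext ω; simp [L, selectSum]
  refine ⟨Var[L; Measure.pi fun _ : Fin k => stepLaw m s].toNNReal, ?_⟩
  rw [hL, IsGaussian.map_eq_gaussianReal]
  congr 1
  rw [← hL]
  have hint : ∀ j (i : Fin m), Integrable (fun ω : Fin k → Fin m → ℝ => ω j i)
      (Measure.pi fun _ : Fin k => stepLaw m s) := fun j i =>
    (memLp_coord s j i).integrable one_le_two
  simp only [selectSum]
  rw [integral_finsetSum _ fun q _ => (integrable_finsetSum _ fun j _ => hint j _).const_mul _]
  refine Finset.sum_eq_zero fun q _ => ?_
  rw [integral_const_mul, integral_finsetSum _ fun j _ => hint j _]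
  refine mul_eq_zero_of_right _ (Finset.sum_eq_zero fun j _ => ?_)
  rw [integral_comp_eval_pi (stepLaw m s) (g := fun e => e (τ q j)) (by fun_prop) j,
    integral_coord_stepLaw]

lemma memLp_selectSum (s : NNReal) {k : ℕ} (τ : Fin k → Fin m) :
    MemLp (selectSum τ) 2 (Measure.pi fun _ : Fin k => stepLaw m s) :=
  memLp_finsetSum _ fun j _ => memLp_coord s j (τ j)

lemma integral_selectSum_mul (s : NNReal) {k : ℕ} (τ τ' : Fin k → Fin m) :
    ∫ ω, selectSum τ ω * selectSum τ' ω ∂(Measure.pi fun _ : Fin k => stepLaw m s) =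
      ∑ j, if τ j = τ' j then (s : ℝ) else 0 := by
  simp only [selectSum, Finset.sum_mul_sum]
  have hi : ∀ j j', Integrable (fun ω : Fin k → Fin m → ℝ => ω j (τ j) * ω j' (τ' j'))
      (Measure.pi fun _ : Fin k => stepLaw m s) := fun j j' =>
    (memLp_coord s j (τ j)).integrable_mul (memLp_coord s j' (τ' j'))
  rw [integral_finsetSum _ fun j _ => integrable_finsetSum _ fun j' _ => hi j j']
  refine Finset.sum_congr rfl fun j _ => ?_
  rw [integral_finsetSum _ fun j' _ => hi j j']
  simp_rw [integral_coord_mul_coord]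
  rw [Finset.sum_eq_single j] <;> grind

/-- The index of the particle whose step `j` contributes to the increment of the underlying walk
over `[q / (k + 1), q / (k + 1) + 1]`. -/
def particle (n k : ℕ) (q : Fin (n * (k + 1) + 1)) (j : Fin (k + 1)) : Fin (n + 1) :=
  ⟨((q : ℕ) + (k - j)) / (k + 1), Nat.div_lt_of_lt_mul (by
    have := q.is_lt
    ring_nf at this ⊢
    omega)⟩

lemma sum_add_div (k q : ℕ) : ∑ j ∈ Finset.range (k + 1), (q + j) / (k + 1) = q := by
  induction q with
  | zero =>
    refine Finset.sum_eq_zero fun j hj => Nat.div_eq_of_lt ?_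
    simpa using hj
  | succ q ih =>
    rw [Finset.sum_range_succ'] at ih
    rw [Finset.sum_range_succ, show q + 1 + k = q + (k + 1) by ring,
      Nat.add_div_right _ (Nat.add_one_pos k)]
    simp only [show ∀ j, q + 1 + j = q + (j + 1) from fun j => by ring]
    simp only [add_zero] at ih
    omega

lemma sum_particle (n k : ℕ) (q : Fin (n * (k + 1) + 1)) :
    ∑ j, (particle n k q j : ℕ) = q := by
  rw [← sum_add_div k q, ← Fin.sum_univ_eq_sum_range (fun j => (q + j) / (k + 1)),
    ← Equiv.sum_comp Fin.revPerm]
  refine Finset.sum_congr rfl fun j _ => ?_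
  simp only [particle, Fin.revPerm_apply, Fin.val_rev]
  congr 2
  omega

lemma sum_particle_eq (n k : ℕ) (q q' : Fin (n * (k + 1) + 1)) :
    ∑ j, (if particle n k q j = particle n k q' j then ((stepVar k : NNReal) : ℝ) else 0) =
      max 0 (1 - |(q : ℝ) / (k + 1) - (q' : ℝ) / (k + 1)|) := by
  wlog hle : q ≤ q' generalizing q q'
  · rw [abs_sub_comm, ← this q' q (le_of_not_ge hle)]
    simp_rw [eq_comm]
  have hk : (0 : ℝ) < k + 1 := by positivity
  have hle' : (q : ℕ) ≤ q' := hle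
  have habs : |(q : ℝ) / (k + 1) - (q' : ℝ) / (k + 1)| = ((q' : ℝ) - q) / (k + 1) := by
    rw [← sub_div, abs_div, abs_of_pos hk, abs_sub_comm, abs_of_nonneg]
    simpa using hle'
  have hs : ((stepVar k : NNReal) : ℝ) = 1 / (k + 1) := by
    rw [← inv_coe_stepVar, one_div, inv_inv]
  rw [habs, hs]
  by_cases hfar : (q : ℕ) + (k + 1) ≤ q'
  · have hfar' : (q : ℝ) + (k + 1) ≤ q' := by exact_mod_cast hfar
    rw [max_eq_left]
    · refine Finset.sum_eq_zero fun j _ => if_neg fun he => ?_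
      have h1 : ((q : ℕ) + (k - j)) / (k + 1) = ((q' : ℕ) + (k - j)) / (k + 1) :=
        congrArg Fin.val he
      have h2 : ((q : ℕ) + (k - j) + (k + 1)) / (k + 1) ≤ ((q' : ℕ) + (k - j)) / (k + 1) :=
        Nat.div_le_div_right (by omega)
      rw [Nat.add_div_right _ (Nat.add_one_pos k)] at h2
      omega
    · rw [sub_nonpos, le_div_iff₀ hk]; linarith
  · have hnear : ((q' : ℝ)) ≤ q + (k + 1) := by
      push Not at hfar
      exact_mod_cast hfar.le
    rw [max_eq_right (by rw [sub_nonneg, div_le_iff₀ hk]; linarith)]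
    have hterm : ∀ j, (if particle n k q j = particle n k q' j then (1 : ℝ) / (k + 1) else 0) =
        (1 - ((particle n k q' j : ℕ) - (particle n k q j : ℕ) : ℝ)) / (k + 1) := by
      intro j
      have h1 : ((q : ℕ) + (k - j)) / (k + 1) ≤ ((q' : ℕ) + (k - j)) / (k + 1) :=
        Nat.div_le_div_right (by omega)
      have h2 : ((q' : ℕ) + (k - j)) / (k + 1) ≤ ((q : ℕ) + (k - j) + (k + 1)) / (k + 1) :=
        Nat.div_le_div_right (by omega)
      rw [Nat.add_div_right _ (Nat.add_one_pos k)] at h2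
      have h3 : (particle n k q' j : ℕ) = particle n k q j ∨
          (particle n k q' j : ℕ) = particle n k q j + 1 := by
        simp only [particle]; omega
      rcases h3 with h3 | h3
      · rw [if_pos (Fin.ext h3.symm), h3]; simp
      · rw [if_neg (fun h => by simp [h] at h3), h3]; simp
    simp_rw [hterm]
    rw [← Finset.sum_div, Finset.sum_sub_distrib, Finset.sum_sub_distrib, ← Nat.cast_sum,
      ← Nat.cast_sum, sum_particle, sum_particle]
    simp
    field_simp

lemma particle_of_eq {n k : ℕ} {q : Fin (n * (k + 1) + 1)} {i r : ℕ} (hr : r < k + 1)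
    (hq : (q : ℕ) = i * (k + 1) + r) (j : Fin (k + 1)) :
    (particle n k q j : ℕ) = if (j : ℕ) < r then i + 1 else i := by
  simp only [particle, hq]
  have hj := j.is_lt
  split_ifs with h
  · rw [show i * (k + 1) + r + (k - j) = (i + 1) * (k + 1) + (r - j - 1) by
      rw [add_mul, one_mul]; omega, Nat.add_comm, Nat.add_mul_div_right _ _ (Nat.add_one_pos k),
      Nat.div_eq_of_lt (by omega), zero_add]
  · rw [add_assoc, Nat.add_comm, Nat.add_mul_div_right _ _ (Nat.add_one_pos k),
      Nat.div_eq_of_lt (by omega), zero_add]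

variable {Ω : Type*} [MeasurableSpace Ω] {μ : Measure Ω} {S : ℝ → Ω → ℝ}

lemma memLp_of_isSlepian (hS : IsSlepian μ S) (t : ℝ) : MemLp (S t) 2 μ := by
  obtain ⟨v, hv⟩ := hS.2.2.2.1 1 (fun _ => t) (fun _ => 1)
  simp only [Finset.univ_unique, one_mul, Finset.sum_singleton] at hv
  have : MemLp id 2 (μ.map (S t)) := by
    change MemLp id 2 (μ.map fun ω => S t ω)
    rw [hv]; exact memLp_id_gaussianReal 2
  exact this.comp_of_map (hS.2.1 t).aemeasurable

/-- On the grid of mesh `1 / (k + 1)` the Slepian process is a Gaussian moving sum. -/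
lemma map_slepian_grid (hS : IsSlepian μ S) (n k : ℕ) :
    μ.map (fun ω (q : Fin (n * (k + 1) + 1)) => S ((q : ℝ) / (k + 1)) ω) =
      (Measure.pi fun _ : Fin (k + 1) => stepLaw (n + 1) (stepVar k)).map
        (fun ω q => selectSum (particle n k q) ω) := by
  have := hS.1
  refine map_eq_map_of_gaussian (fun q => hS.2.1 _) (fun q => measurable_selectSum _)
    (fun q => memLp_of_isSlepian hS _) (fun q => memLp_selectSum _ _)
    (fun c => hS.2.2.2.1 _ (fun q => (q : ℝ) / (k + 1)) c)
    (fun c => exists_map_sum_selectSum _ _ c) fun q q' => ?_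
  rw [integral_selectSum_mul, sum_particle_eq]
  exact hS.2.2.2.2.2 _ _

/-- The starting points of the non-intersecting walks with displacements `d`. -/
def startPt (h : ℝ) (n : ℕ) (d : Fin (n + 1) → ℝ) (i : Fin (n + 1)) : ℝ :=
  ∑ l ∈ Finset.Iio i, d l - (i : ℕ) * h

lemma startPt_succ (h : ℝ) (n : ℕ) (d : Fin (n + 1) → ℝ) (i : Fin n) :
    startPt h n d i.succ = startPt h n d i.castSucc + d i.castSucc - h := by
  have : Finset.Iio i.succ = insert i.castSucc (Finset.Iio i.castSucc) := by
    ext a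
    simp only [Finset.mem_Iio, Finset.mem_insert, Fin.lt_def, Fin.ext_iff, Fin.val_succ,
      Fin.val_castSucc]
    omega
  simp only [startPt, this]
  rw [Finset.sum_insert (by simp)]
  push_cast [Fin.val_succ, Fin.val_castSucc]
  ring

lemma forall_selectSum_lt_iff {n k : ℕ} {h : ℝ} {ω : Fin (k + 1) → Fin (n + 1) → ℝ} :
    (∀ q, selectSum (particle n k q) ω < h) ↔
      (∑ j, ω j) ∈ {d : Fin (n + 1) → ℝ | ∀ i, d i < h} ∧
        (fun j : Fin k => ω j.castSucc) ∈ staysIn k (startPt h n (∑ j, ω j)) := by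
  have hin : ∀ (i : Fin (n + 1)), (i : ℕ) * (k + 1) < n * (k + 1) + 1 := fun i =>
    Nat.lt_succ_of_le (Nat.mul_le_mul_right _ (Nat.le_of_lt_succ i.is_lt))
  have hin' : ∀ (i : Fin n) (r : Fin k), (i : ℕ) * (k + 1) + (r + 1) < n * (k + 1) + 1 := by
    intro i r
    have h1 : ((i : ℕ) + 1) * (k + 1) ≤ n * (k + 1) := Nat.mul_le_mul_right _ i.is_lt
    have := r.is_lt
    rw [add_mul, one_mul] at h1
    omega
  have hint : ∀ i : Fin (n + 1), selectSum (particle n k ⟨(i : ℕ) * (k + 1), hin i⟩) ω =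
      (∑ j, ω j) i := by
    intro i
    rw [selectSum, Finset.sum_apply]
    refine Finset.sum_congr rfl fun j _ => ?_
    congr 1
    exact Fin.ext (by rw [particle_of_eq (i := i) (r := 0) (Nat.add_one_pos k) rfl]; simp)
  have hfrac : ∀ (i : Fin n) (r : Fin k),
      selectSum (particle n k ⟨(i : ℕ) * (k + 1) + (r + 1), hin' i r⟩) ω - h =
      (startPt h n (∑ j, ω j) + partialSum (fun j : Fin k => ω j.castSucc) r) i.succ -
      (startPt h n (∑ j, ω j) + partialSum (fun j : Fin k => ω j.castSucc) r) i.castSucc := by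
    intro i r
    have hp : ∀ j, particle n k ⟨(i : ℕ) * (k + 1) + (r + 1), hin' i r⟩ j =
        if (j : ℕ) < r + 1 then i.succ else i.castSucc := by
      intro j
      have := r.is_lt
      refine Fin.ext ?_
      rw [particle_of_eq (i := i) (r := r + 1) (by omega) rfl]
      split_ifs <;> simp
    have hrk : ¬ (k < (r : ℕ) + 1) := by have := r.is_lt; omega
    simp only [Pi.add_apply, startPt_succ, selectSum, hp, Finset.sum_apply, Fin.sum_univ_castSucc,
      partialSum, Fin.val_castSucc, Fin.val_last, hrk, if_false, Fin.le_def]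
    have h1 : ∀ j : Fin k, ω j.castSucc (if (j : ℕ) < r + 1 then i.succ else i.castSucc) =
        ω j.castSucc i.castSucc + (if (j : ℕ) ≤ r then ω j.castSucc else 0) i.succ
          - (if (j : ℕ) ≤ r then ω j.castSucc else 0) i.castSucc := by
      intro j
      split_ifs <;> first | omega | simp
    simp_rw [h1]
    rw [Finset.sum_sub_distrib, Finset.sum_add_distrib]
    ring
  constructor
  · intro H
    refine ⟨fun i => hint i ▸ H _, fun r => Fin.strictAnti_iff_succ_lt.2 fun i => ?_⟩
    have := hfrac i r
    have := H ⟨(i : ℕ) * (k + 1) + (r + 1), hin' i r⟩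
    linarith
  · rintro ⟨H1, H2⟩ q
    have hdm := Nat.div_add_mod' (q : ℕ) (k + 1)
    have hmod := Nat.mod_lt (q : ℕ) (Nat.add_one_pos k)
    have hq := q.is_lt
    have hdiv : (q : ℕ) / (k + 1) ≤ n := by
      rw [← Nat.lt_succ_iff, Nat.div_lt_iff_lt_mul (Nat.add_one_pos k), Nat.succ_mul]; omega
    rcases Nat.eq_zero_or_eq_succ_pred ((q : ℕ) % (k + 1)) with h0 | h0
    · have e : q = ⟨((⟨q / (k + 1), by omega⟩ : Fin (n + 1)) : ℕ) * (k + 1), hin _⟩ :=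
        Fin.ext (by simp only; omega)
      rw [e, hint]
      exact H1 _
    · have hlt : (q : ℕ) / (k + 1) < n := by
        refine lt_of_le_of_ne hdiv fun hn => ?_
        rw [hn] at hdm
        omega
      have e : q = ⟨((⟨q / (k + 1), hlt⟩ : Fin n) : ℕ) * (k + 1) +
          (((⟨((q : ℕ) % (k + 1)).pred, by omega⟩ : Fin k) : ℕ) + 1), hin' _ _⟩ :=
        Fin.ext (by simp only; omega)
      have h1 := hfrac ⟨q / (k + 1), hlt⟩ ⟨((q : ℕ) % (k + 1)).pred, by omega⟩
      rw [← e] at h1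
      have h2 := Fin.strictAnti_iff_succ_lt.1 (H2 ⟨((q : ℕ) % (k + 1)).pred, by omega⟩)
        ⟨q / (k + 1), hlt⟩
      linarith

lemma startPt_add_self (h : ℝ) (n : ℕ) (d : Fin (n + 1) → ℝ) (i : Fin (n + 1)) :
    startPt h n d i + d i = ∑ l ∈ Finset.Iic i, d l - (i : ℕ) * h := by
  rw [startPt, ← Finset.Iio_insert, Finset.sum_insert (by simp)]
  ring

lemma add_sheppA_eq (h : ℝ) (n : ℕ) (d : Fin (n + 1) → ℝ) (i j : Fin (n + 1)) :
    d i + sheppA n h d i j = (startPt h n d + d) j - startPt h n d i := by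
  have hsub : ∀ a b : Fin (n + 1), a ≤ b →
      ∑ l ∈ Finset.Iic b, d l = ∑ l ∈ Finset.Iic a, d l + ∑ l ∈ Finset.Ioc a b, d l := by
    intro a b hab
    rw [← Finset.sum_union (Finset.disjoint_left.2 fun x hx hx' => by
      simp only [Finset.mem_Iic, Finset.mem_Ioc] at hx hx'; exact absurd hx (not_le.2 hx'.1))]
    refine Finset.sum_congr ?_ fun _ _ => rfl
    ext x
    simp only [Finset.mem_union, Finset.mem_Iic, Finset.mem_Ioc, Fin.le_def, Fin.lt_def] at hab ⊢
    omega
  have h1 := startPt_add_self h n d i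
  have h2 := startPt_add_self h n d j
  rw [Pi.add_apply, sheppA]
  split_ifs with hij hji
  · subst hij; ring
  · linarith [hsub j i hji.le]
  · linarith [hsub i j (le_of_not_gt hji)]

lemma stdPhi_eq (x : ℝ) : stdPhi x = gaussianPDFReal 0 1 x := by
  simp [stdPhi, gaussianPDFReal]

/-- The integrand of Shepp's formula. -/
noncomputable def sheppDensity (h : ℝ) (n : ℕ) (d : Fin (n + 1) → ℝ) : ℝ :=
  heatDet 1 (startPt h n d + d) (startPt h n d)

lemma det_stdPhi_eq (h : ℝ) (n : ℕ) (d : Fin (n + 1) → ℝ) :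
    Matrix.det (Matrix.of fun i j => stdPhi (d i + sheppA n h d i j)) = sheppDensity h n d := by
  simp_rw [sheppDensity, heatDet_eq_det, stdPhi_eq, add_sheppA_eq]

lemma continuous_heatDet {X : Type*} [TopologicalSpace X] (t : NNReal) {f g : X → Fin m → ℝ}
    (hf : Continuous f) (hg : Continuous g) : Continuous fun x => heatDet t (f x) (g x) := by
  simp only [heatDet, heatProd, gaussianPDFReal, Function.comp]
  fun_prop

lemma continuous_startPt {X : Type*} [TopologicalSpace X] {n : ℕ} {f : X → ℝ}
    {g : X → Fin (n + 1) → ℝ} (hf : Continuous f) (hg : Continuous g) :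
    Continuous fun x => startPt (f x) n (g x) := by
  unfold startPt
  fun_prop

lemma continuous_sheppDensity {X : Type*} [TopologicalSpace X] {n : ℕ} {f : X → ℝ}
    {g : X → Fin (n + 1) → ℝ} (hf : Continuous f) (hg : Continuous g) :
    Continuous fun x => sheppDensity (f x) n (g x) :=
  continuous_heatDet 1 ((continuous_startPt hf hg).add hg) (continuous_startPt hf hg)

lemma strictAnti_startPt {h : ℝ} {n : ℕ} {d : Fin (n + 1) → ℝ} (hd : ∀ i, d i < h) :
    StrictAnti (startPt h n d) :=
  Fin.strictAnti_iff_succ_lt.2 fun i => by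
    rw [startPt_succ]; linarith [hd i.castSucc]

lemma strictAnti_startPt_add {h : ℝ} {n : ℕ} {d : Fin (n + 1) → ℝ} (hd : ∀ i, d i < h) :
    StrictAnti (startPt h n d + d) :=
  Fin.strictAnti_iff_succ_lt.2 fun i => by
    rw [Pi.add_apply, Pi.add_apply, startPt_succ]; linarith [hd i.succ]

/-- The integration domain `(-∞, h)^{n+1}`. -/
def below (h : ℝ) (n : ℕ) : Set (Fin (n + 1) → ℝ) := {d | ∀ i, d i < h}

lemma measurableSet_below (h : ℝ) (n : ℕ) : MeasurableSet (below h n) := by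
  have : below h n = Set.univ.pi fun _ => Set.Iio h := by ext; simp [below]
  rw [this]
  exact MeasurableSet.univ_pi fun _ => measurableSet_Iio

lemma killed_stepVar_le (h : ℝ) (n k : ℕ) (d : Fin (n + 1) → ℝ) :
    killed (stepVar k) (startPt h n d + d) k (startPt h n d) ≤ heatProd 1 d 0 := by
  have h1 := killed_le (stepVar k) (stepVar_ne_zero k) (startPt h n d + d) k
    (succ_mul_stepVar k).le (startPt h n d)
  rw [succ_mul_stepVar] at h1
  simpa [heatProd] using h1

lemma tendsto_killed_startPt {h : ℝ} {n : ℕ} {d : Fin (n + 1) → ℝ} (hd : d ∈ below h n) :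
    Tendsto (fun k => killed (stepVar k) (startPt h n d + d) k (startPt h n d)) atTop
      (nhds (sheppDensity h n d)) :=
  tendsto_killed (strictAnti_startPt hd) (strictAnti_startPt_add hd)

lemma sheppDensity_nonneg {h : ℝ} {n : ℕ} {d : Fin (n + 1) → ℝ} (hd : d ∈ below h n) :
    0 ≤ sheppDensity h n d :=
  ge_of_tendsto' (tendsto_killed_startPt hd) fun _ => killed_nonneg _ _ _ _

lemma sheppDensity_le {h : ℝ} {n : ℕ} {d : Fin (n + 1) → ℝ} (hd : d ∈ below h n) :
    sheppDensity h n d ≤ heatProd 1 d 0 :=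
  le_of_tendsto' (tendsto_killed_startPt hd) fun k => killed_stepVar_le h n k d

lemma lintegral_heatProd_ne_top : ∫⁻ d : Fin m → ℝ, ENNReal.ofReal (heatProd 1 d 0) ≠ ⊤ := by
  have h := measure_univ (μ := stepLaw m 1)
  rw [stepLaw_eq_withDensity 1 one_ne_zero, withDensity_apply _ MeasurableSet.univ,
    Measure.restrict_univ] at h
  simp [h]

/-- The value of Shepp's integral, as an extended nonnegative real. -/
noncomputable def sheppIntegral (h : ℝ) (n : ℕ) : ENNReal :=
  ∫⁻ d in below h n, ENNReal.ofReal (sheppDensity h n d)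

lemma toReal_sheppIntegral (h : ℝ) (n : ℕ) :
    (sheppIntegral h n).toReal = ∫ d in below h n, sheppDensity h n d := by
  rw [integral_eq_lintegral_of_nonneg_ae]
  · rfl
  · exact (ae_restrict_iff' (measurableSet_below h n)).2 (ae_of_all _ fun d => sheppDensity_nonneg)
  · exact (continuous_sheppDensity continuous_const continuous_id).aestronglyMeasurable

lemma tendsto_sheppIntegral (h : ℝ) (n : ℕ) :
    Tendsto (fun l : ℕ => sheppIntegral (h - 1 / ((l : ℝ) + 1)) n) atTop
      (nhds (sheppIntegral h n)) := by
  have hmem : ∀ l : ℕ, h - 1 / ((l : ℝ) + 1) < h := fun l => by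
    have : 0 < 1 / ((l : ℝ) + 1) := by positivity
    linarith
  have hlim : Tendsto (fun l : ℕ => h - 1 / ((l : ℝ) + 1)) atTop (nhds h) := by
    simpa using tendsto_one_div_add_atTop_nhds_zero_nat.const_sub h
  have hmeas : ∀ h, Measurable fun d => ENNReal.ofReal (sheppDensity h n d) := fun h =>
    (continuous_sheppDensity continuous_const continuous_id).measurable.ennreal_ofReal
  simp only [sheppIntegral, ← lintegral_indicator (measurableSet_below _ n)]
  refine tendsto_lintegral_of_dominated_convergence (fun d => ENNReal.ofReal (heatProd 1 d 0))
    (fun l => (hmeas _).indicator (measurableSet_below _ n)) (fun l => ae_of_all _ fun d => ?_)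
    lintegral_heatProd_ne_top (ae_of_all _ fun d => ?_)
  · exact indicator_apply_le' (fun hd => ENNReal.ofReal_le_ofReal (sheppDensity_le hd))
      fun _ => zero_le
  · by_cases hd : d ∈ below h n
    · rw [indicator_of_mem hd]
      have hev : ∀ᶠ l : ℕ in atTop, d ∈ below (h - 1 / ((l : ℝ) + 1)) n :=
        eventually_all.2 fun i => hlim.eventually_const_lt (hd i)
      have : Tendsto (fun l : ℕ => sheppDensity (h - 1 / ((l : ℝ) + 1)) n d) atTop
          (nhds (sheppDensity h n d)) :=
        ((continuous_sheppDensity (f := fun x => x) continuous_id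
          (continuous_const (y := d))).tendsto h).comp hlim
      refine (ENNReal.tendsto_ofReal this).congr' ?_
      filter_upwards [hev] with l hl
      rw [indicator_of_mem hl]
    · rw [indicator_of_notMem hd]
      refine tendsto_const_nhds.congr fun l => ?_
      rw [indicator_of_notMem fun hl => hd fun i => (hl i).trans (hmem l)]

/-- The event that the process is below `h` at the grid points of mesh `1 / (k + 1)`. -/
def gridBelow (S : ℝ → Ω → ℝ) (n k : ℕ) (h : ℝ) : Set Ω :=
  {ω | ∀ q : Fin (n * (k + 1) + 1), S ((q : ℝ) / (k + 1)) ω < h}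

lemma measurableSet_gridBelow (hS : IsSlepian μ S) (n k : ℕ) (h : ℝ) :
    MeasurableSet (gridBelow S n k h) := by
  simp only [gridBelow, ofPred_forall]
  exact MeasurableSet.iInter fun q => measurableSet_lt (hS.2.1 _) measurable_const

lemma measure_gridBelow (hS : IsSlepian μ S) (n k : ℕ) (h : ℝ) :
    μ (gridBelow S n k h) = ∫⁻ d in below h n,
      ENNReal.ofReal (killed (stepVar k) (startPt h n d + d) k (startPt h n d)) := by
  have hA : MeasurableSet {x : Fin (n * (k + 1) + 1) → ℝ | ∀ q, x q < h} := by
    simp only [ofPred_forall]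
    exact MeasurableSet.iInter fun q => measurableSet_lt (measurable_pi_apply q) measurable_const
  have h1 := congrArg (fun ν => ν {x : Fin (n * (k + 1) + 1) → ℝ | ∀ q, x q < h})
    (map_slepian_grid hS n k)
  beta_reduce at h1
  rw [Measure.map_apply (measurable_pi_lambda _ fun q => hS.2.1 _) hA,
    Measure.map_apply (measurable_pi_lambda _ fun q => measurable_selectSum _) hA] at h1
  rw [← measure_staysIn_eq_lintegral (stepVar k) (stepVar_ne_zero k) k (succ_mul_stepVar k).le
    (f := startPt h n) (continuous_startPt continuous_const continuous_id).measurable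
    (measurableSet_below h n)]
  refine h1.trans (congrArg _ ?_)
  ext ω
  exact forall_selectSum_lt_iff

lemma tendsto_measure_gridBelow (hS : IsSlepian μ S) (n : ℕ) (h : ℝ) :
    Tendsto (fun k => μ (gridBelow S n k h)) atTop (nhds (sheppIntegral h n)) := by
  have hm : Measurable (startPt h n) :=
    (continuous_startPt continuous_const continuous_id).measurable
  simp only [measure_gridBelow hS, sheppIntegral]
  refine tendsto_lintegral_of_dominated_convergence (fun d => ENNReal.ofReal (heatProd 1 d 0))
    (fun k => ((measurable_killed (stepVar k) k).comp
      ((hm.add measurable_id).prodMk hm)).ennreal_ofReal)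
    (fun k => ae_of_all _ fun d => ENNReal.ofReal_le_ofReal (killed_stepVar_le h n k d))
    (ne_top_of_le_ne_top lintegral_heatProd_ne_top (setLIntegral_le_lintegral _ _)) ?_
  exact (ae_restrict_iff' (measurableSet_below h n)).2 (ae_of_all _ fun d hd =>
    ENNReal.tendsto_ofReal (tendsto_killed_startPt hd))

omit [MeasurableSpace Ω] in
lemma gridBelow_succ_subset (S : ℝ → Ω → ℝ) (n l : ℕ) (h : ℝ) :
    gridBelow S n (2 ^ (l + 1) - 1) h ⊆ gridBelow S n (2 ^ l - 1) h := by
  intro ω hω q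
  have hp : (2 ^ l - 1 : ℕ) + 1 = 2 ^ l := Nat.sub_add_cancel Nat.one_le_two_pow
  have hp' : (2 ^ (l + 1) - 1 : ℕ) + 1 = 2 ^ (l + 1) := Nat.sub_add_cancel Nat.one_le_two_pow
  have hc : ((2 ^ l - 1 : ℕ) : ℝ) + 1 = 2 ^ l := by exact_mod_cast hp
  have hc' : ((2 ^ (l + 1) - 1 : ℕ) : ℝ) + 1 = 2 ^ (l + 1) := by exact_mod_cast hp'
  have hlt : 2 * (q : ℕ) < n * (2 ^ (l + 1) - 1 + 1) + 1 := by
    have hq : (q : ℕ) ≤ n * 2 ^ l := (Nat.le_of_lt_succ q.is_lt).trans_eq (by rw [hp])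
    rw [hp', pow_succ]
    nlinarith
  have := hω ⟨_, hlt⟩
  rw [hc'] at this
  rw [hc]
  convert this using 2
  push_cast
  rw [pow_succ, mul_comm (2 : ℝ) q, mul_div_mul_right _ _ two_ne_zero]

lemma le_of_forall_mem_gridBelow (hS : IsSlepian μ S) {n : ℕ} {h : ℝ} {ω : Ω}
    (hω : ∀ l, ω ∈ gridBelow S n (2 ^ l - 1) h) {t : ℝ} (ht : t ∈ Set.Icc (0 : ℝ) n) :
    S t ω ≤ h := by
  have hpow : Tendsto (fun l : ℕ => (2 : ℝ) ^ l) atTop atTop :=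
    tendsto_pow_atTop_atTop_of_one_lt one_lt_two
  have hlim : Tendsto (fun l : ℕ => (⌊t * 2 ^ l⌋₊ : ℝ) / 2 ^ l) atTop (nhds t) :=
    (tendsto_nat_floor_mul_div_atTop ht.1).comp hpow
  refine le_of_tendsto' (((hS.2.2.1 ω).tendsto t).comp hlim) fun l => ?_
  have hp : (2 ^ l - 1 : ℕ) + 1 = 2 ^ l := Nat.sub_add_cancel Nat.one_le_two_pow
  have hfl : ⌊t * 2 ^ l⌋₊ < n * ((2 ^ l - 1) + 1) + 1 := by
    rw [hp, Nat.lt_succ_iff]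
    refine Nat.floor_le_of_le ?_
    push_cast
    gcongr
    exact ht.2
  have := hω l ⟨_, hfl⟩
  rw [show ((2 ^ l - 1 : ℕ) : ℝ) + 1 = 2 ^ l by exact_mod_cast hp] at this
  exact this.le

lemma measure_forall_lt_eq (hS : IsSlepian μ S) (n : ℕ) (h : ℝ) :
    μ {ω | ∀ t ∈ Set.Icc (0 : ℝ) n, S t ω < h} = sheppIntegral h n := by
  have := hS.1
  refine le_antisymm ?_ ?_
  · refine ge_of_tendsto' (tendsto_measure_gridBelow hS n h) fun k => measure_mono fun ω hω q => ?_
    refine hω _ ⟨by positivity, ?_⟩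
    rw [div_le_iff₀ (by positivity)]
    exact_mod_cast Nat.le_of_lt_succ q.is_lt
  · refine le_of_tendsto' (tendsto_sheppIntegral h n) fun l => ?_
    set h' := h - 1 / ((l : ℝ) + 1)
    have hh' : h' < h := sub_lt_self _ (by positivity)
    have hsub : Tendsto (fun l : ℕ => 2 ^ l - 1) atTop atTop :=
      tendsto_atTop_mono (fun l => Nat.le_sub_one_of_lt Nat.lt_two_pow_self) tendsto_id
    have h1 := (tendsto_measure_gridBelow hS n h').comp hsub
    have h2 := tendsto_measure_iInter_atTop (μ := μ)
      (fun l => (measurableSet_gridBelow hS n (2 ^ l - 1) h').nullMeasurableSet)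
      (antitone_nat_of_succ_le fun l => gridBelow_succ_subset S n l h')
      ⟨0, measure_ne_top μ _⟩
    rw [tendsto_nhds_unique h1 h2]
    exact measure_mono fun ω hω t ht =>
      (le_of_forall_mem_gridBelow hS (fun l => mem_iInter.1 hω l) ht).trans_lt hh'

end SheppKM

/-- Shepp's determinant formula (unconditional form): for every positive integer `n`,
`F_n(h) = ∫_{(-∞,h)^{n+1}} det(φ(s_i + a_{i,j}))_{i,j=0}^n ds₀ ⋯ ds_n`. -/
theorem shepp_determinant_formula {Ω : Type*} [MeasurableSpace Ω] (μ : Measure Ω)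
    (S : ℝ → Ω → ℝ) (hS : IsSlepian μ S) (n : ℕ) (hn : 0 < n) (h : ℝ) :
    slepF μ S (n : ℝ) h =
      ∫ s in {s : Fin (n + 1) → ℝ | ∀ i, s i < h},
        Matrix.det (Matrix.of fun i j => stdPhi (s i + sheppA n h s i j)) := by
  simp_rw [slepF, SheppKM.measure_forall_lt_eq hS, SheppKM.toReal_sheppIntegral,
    SheppKM.det_stdPhi_eq]
  rfl
end

section
/- For every real h, F_2(h) = Φ(h)³ + φ(h)²Φ(h) + (φ(h)²/2)·[(h² − 1)Φ(h) + hφ(h)] + ∫_0^∞ Φ(h − y)² φ(h + y) dy − 2φ(h)Φ(h)·[hΦ(h) + φ(h)] − (1/√2) ∫_0^∞ Φ(h − y) φ(√2·h) [Φ(√2·y) − 1/2] dy, where F_2(h) is the probability that the Slepian process stays below h on the time interval [0,2]. -/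
open MeasureTheory ProbabilityTheory Real Set Filter

section DyadicExit

open Topology NNReal

variable {Ω E : Type*}

/-- Restriction of a continuous-time filtration to the grid `k / 2 ^ j`. -/
noncomputable def gridFiltration [mΩ : MeasurableSpace Ω] (ℱ : Filtration ℝ≥0 mΩ) (j : ℕ) :
    Filtration ℕ mΩ where
  seq k := ℱ ((k : ℝ≥0) / 2 ^ j)
  mono' a b hab := ℱ.mono (by gcongr)
  le' k := ℱ.le _

/-- The first index `k ≤ L * 2 ^ j` at which `Y (k / 2 ^ j)` lies outside `C`, and `L * 2 ^ j`
if there is none. -/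
noncomputable def gridExit (Y : ℝ≥0 → Ω → E) (C : Set E) (L j : ℕ) (ω : Ω) : ℕ :=
  hittingBtwn (fun k : ℕ => Y ((k : ℝ≥0) / 2 ^ j)) Cᶜ 0 (L * 2 ^ j) ω

lemma gridExit_of_forall_mem {Y : ℝ≥0 → Ω → E} {C : Set E} {L j : ℕ} {ω : Ω}
    (h : ∀ k : ℕ, k ≤ L * 2 ^ j → Y ((k : ℝ≥0) / 2 ^ j) ω ∈ C) :
    gridExit Y C L j ω = L * 2 ^ j := by
  unfold gridExit
  rw [hittingBtwn_def]
  simp only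
  rw [if_neg]
  rintro ⟨k, hk, hk'⟩
  exact hk' (h k hk.2)

variable [TopologicalSpace E]

lemma tendsto_apply_gridExit {Y : ℝ≥0 → Ω → E} {C : Set E} {G : E → ℝ} {ω : Ω}
    (hYc : Continuous fun s => Y s ω) (hC : IsOpen C) (hG : Continuous G)
    (hG0 : ∀ y ∈ closure C, y ∉ C → G y = 0) (hY0 : Y 0 ω ∈ C) (L : ℕ) {j₀ k₀ : ℕ}
    (hk₀ : k₀ ≤ L * 2 ^ j₀) (hout : Y ((k₀ : ℝ≥0) / 2 ^ j₀) ω ∉ C) :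
    Tendsto (fun j => G (Y ((gridExit Y C L j ω : ℝ≥0) / 2 ^ j) ω)) atTop (𝓝 0) := by
  have hex : ∀ j, ∃ k ∈ Set.Icc 0 (L * 2 ^ (j + j₀)),
      Y ((k : ℝ≥0) / 2 ^ (j + j₀)) ω ∈ Cᶜ := by
    intro j
    refine ⟨k₀ * 2 ^ j, ⟨Nat.zero_le _, ?_⟩, ?_⟩
    · rw [pow_add]; nlinarith [Nat.mul_le_mul_right (2 ^ j) hk₀]
    · have : ((k₀ * 2 ^ j : ℕ) : ℝ≥0) / 2 ^ (j + j₀) = (k₀ : ℝ≥0) / 2 ^ j₀ := by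
        push_cast; rw [pow_add]; field_simp
      rw [this]; exact hout
  set t : ℕ → ℝ≥0 := fun j => (gridExit Y C L (j + j₀) ω : ℝ≥0) / 2 ^ (j + j₀) with ht
  have hmem : ∀ j, Y (t j) ω ∉ C := fun j => hittingBtwn_mem_set (hex j)
  have hpos : ∀ j, 0 < gridExit Y C L (j + j₀) ω := by
    intro j
    rcases Nat.eq_zero_or_pos (gridExit Y C L (j + j₀) ω) with h0 | h0
    · exfalso
      apply hmem j
      simp only [ht, h0]
      simpa using hY0
    · exact h0
  have hprev : ∀ j, Y (((gridExit Y C L (j + j₀) ω - 1 : ℕ) : ℝ≥0) / 2 ^ (j + j₀)) ω ∈ C := by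
    intro j
    have := notMem_of_lt_hittingBtwn (u := fun k : ℕ => Y ((k : ℝ≥0) / 2 ^ (j + j₀)))
      (s := Cᶜ) (n := 0) (m := L * 2 ^ (j + j₀)) (ω := ω) (k := gridExit Y C L (j + j₀) ω - 1)
      (Nat.sub_lt (hpos j) one_pos) (Nat.zero_le _)
    simpa using this
  have hanti : Antitone t := by
    refine antitone_nat_of_succ_le fun j => ?_
    have hle : gridExit Y C L (j + 1 + j₀) ω ≤ 2 * gridExit Y C L (j + j₀) ω := by
      refine hittingBtwn_le_of_mem (Nat.zero_le _) ?_ ?_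
      · have : gridExit Y C L (j + j₀) ω ≤ L * 2 ^ (j + j₀) := hittingBtwn_le ω
        calc 2 * gridExit Y C L (j + j₀) ω ≤ 2 * (L * 2 ^ (j + j₀)) := by gcongr
          _ = L * 2 ^ (j + 1 + j₀) := by ring
      · have : ((2 * gridExit Y C L (j + j₀) ω : ℕ) : ℝ≥0) / 2 ^ (j + 1 + j₀) = t j := by
          simp only [ht]; push_cast
          rw [show j + 1 + j₀ = (j + j₀) + 1 by ring, pow_succ]; field_simp
        rw [this]; exact hmem j
    have h2 : (gridExit Y C L (j + 1 + j₀) ω : ℝ≥0) ≤ 2 * gridExit Y C L (j + j₀) ω := by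
      exact_mod_cast hle
    simp only [ht]
    calc (gridExit Y C L (j + 1 + j₀) ω : ℝ≥0) / 2 ^ (j + 1 + j₀)
        ≤ 2 * gridExit Y C L (j + j₀) ω / 2 ^ (j + 1 + j₀) := by gcongr
      _ = (gridExit Y C L (j + j₀) ω : ℝ≥0) / 2 ^ (j + j₀) := by
          rw [show j + 1 + j₀ = (j + j₀) + 1 by ring, pow_succ]; field_simp
  have hlim : Tendsto t atTop (𝓝 (⨅ j, t j)) := tendsto_atTop_ciInf hanti (OrderBot.bddBelow _)
  set T := ⨅ j, t j
  have hpow : Tendsto (fun j : ℕ => (1 : ℝ≥0) / 2 ^ (j + j₀)) atTop (𝓝 0) := by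
    have h1 : Tendsto (fun j : ℕ => ((1 : ℝ≥0) / 2) ^ (j + j₀)) atTop (𝓝 0) :=
      (NNReal.tendsto_pow_atTop_nhds_zero_of_lt_one (by
        rw [div_lt_one (by norm_num)]; norm_num)).comp (tendsto_add_atTop_nat j₀)
    simpa [div_pow] using h1
  have hlim' : Tendsto (fun j => ((gridExit Y C L (j + j₀) ω - 1 : ℕ) : ℝ≥0) / 2 ^ (j + j₀))
      atTop (𝓝 T) := by
    have : (fun j => ((gridExit Y C L (j + j₀) ω - 1 : ℕ) : ℝ≥0) / 2 ^ (j + j₀))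
        = fun j => t j - 1 / 2 ^ (j + j₀) := by
      funext j
      simp only [ht]
      rw [Nat.cast_tsub, Nat.cast_one, NNReal.sub_div]
    rw [this]
    simpa using hlim.sub hpow
  have hTout : Y T ω ∉ C :=
    hC.isClosed_compl.mem_of_tendsto ((hYc.tendsto T).comp hlim) (Eventually.of_forall hmem)
  have hTcl : Y T ω ∈ closure C :=
    mem_closure_of_tendsto ((hYc.tendsto T).comp hlim') (Eventually.of_forall hprev)
  have := (hG.tendsto _).comp ((hYc.tendsto T).comp hlim)
  rw [hG0 _ hTcl hTout] at this
  exact (tendsto_add_atTop_iff_nat j₀).1 this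

/-- Optional stopping at the exit from an open set `C`: if `G (Y s)` is a martingale and `G`
vanishes on the boundary of `C`, only the paths staying in `C` contribute to its mean. -/
lemma integral_eq_integral_indicator_stay [MeasurableSpace E] [OpensMeasurableSpace E]
    [mΩ : MeasurableSpace Ω]
    {μ : Measure Ω} [IsProbabilityMeasure μ] {ℱ : Filtration ℝ≥0 mΩ} {Y : ℝ≥0 → Ω → E}
    {C : Set E} {G : E → ℝ}
    (hY : ∀ s, Measurable[ℱ s] (Y s)) (hYc : ∀ ω, Continuous fun s => Y s ω)
    (hC : IsOpen C) (hG : Continuous G) (hG0 : ∀ y ∈ closure C, y ∉ C → G y = 0)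
    (hY0 : ∀ ω, Y 0 ω ∈ C) (hM : Martingale (fun s ω => G (Y s ω)) ℱ μ) (L : ℕ) :
    ∫ ω, G (Y 0 ω) ∂μ =
      ∫ ω, indicator {ω | ∀ j k : ℕ, k ≤ L * 2 ^ j → Y ((k : ℝ≥0) / 2 ^ j) ω ∈ C}
        (fun ω => G (Y L ω)) ω ∂μ := by
  set S : Set Ω := {ω | ∀ j k : ℕ, k ≤ L * 2 ^ j → Y ((k : ℝ≥0) / 2 ^ j) ω ∈ C} with hS
  have hSm : MeasurableSet S := by
    simp only [hS, Set.ofPred_forall]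
    exact MeasurableSet.iInter fun j => MeasurableSet.iInter fun k => MeasurableSet.iInter fun _ =>
      ((hY _).mono (ℱ.le _) le_rfl) hC.measurableSet
  have hLj : ∀ j : ℕ, ((L * 2 ^ j : ℕ) : ℝ≥0) / 2 ^ j = L := by
    intro j; push_cast; field_simp
  have hMj : ∀ j, Martingale (fun (k : ℕ) ω => G (Y ((k : ℝ≥0) / 2 ^ j) ω))
      (gridFiltration ℱ j) μ := fun j =>
    ⟨fun k => hM.1 _, fun a b hab => hM.2 _ _ (by gcongr)⟩
  have hτ : ∀ j, IsStoppingTime (gridFiltration ℱ j)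
      (fun ω => ((gridExit Y C L j ω : ℕ) : WithTop ℕ)) := fun j =>
    Adapted.isStoppingTime_hittingBtwn (fun k => hY _) hC.measurableSet.compl
  have hle : ∀ j ω, ((gridExit Y C L j ω : ℕ) : WithTop ℕ) ≤ ((L * 2 ^ j : ℕ) : WithTop ℕ) :=
    fun j ω => WithTop.coe_le_coe.2 (hittingBtwn_le ω)
  have hce : ∀ j, (fun ω => G (Y ((gridExit Y C L j ω : ℝ≥0) / 2 ^ j) ω)) =ᵐ[μ]
      μ[fun ω => G (Y L ω) | (hτ j).measurableSpace] := by
    intro j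
    have := (hMj j).stoppedValue_ae_eq_condExp_of_le_const (hτ j) (hle j)
    have e : (fun ω => G (Y L ω)) = fun ω => G (Y (((L * 2 ^ j : ℕ) : ℝ≥0) / 2 ^ j) ω) := by
      simp only [hLj]
    rw [e]
    exact this
  have hGint : Integrable (fun ω => G (Y L ω)) μ := hM.integrable _
  have hms : ∀ j, (hτ j).measurableSpace ≤ mΩ := fun j => (hτ j).measurableSpace_le
  have hUI := hGint.uniformIntegrable_condExp hms
  have hlim : ∀ᵐ ω ∂μ, Tendsto
      (fun j => (μ[fun ω => G (Y L ω) | (hτ j).measurableSpace]) ω) atTop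
      (𝓝 (indicator S (fun ω => G (Y L ω)) ω)) := by
    filter_upwards [ae_all_iff.2 hce] with ω hω
    simp only [← hω]
    by_cases hωS : ω ∈ S
    · rw [indicator_of_mem hωS]
      have : ∀ j, gridExit Y C L j ω = L * 2 ^ j := fun j => gridExit_of_forall_mem (hωS j)
      simp only [this, hLj]
      exact tendsto_const_nhds
    · rw [indicator_of_notMem hωS]
      simp only [hS, Set.mem_ofPred_eq, not_forall] at hωS
      obtain ⟨j₀, k₀, hk, ho⟩ := hωS
      exact tendsto_apply_gridExit (hYc ω) hC hG hG0 (hY0 ω) L hk ho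
  have hgi : Integrable (indicator S fun ω => G (Y L ω)) μ := hGint.indicator hSm
  have hL1 := tendsto_Lp_finite_of_tendsto_ae le_rfl ENNReal.one_ne_top hUI.1
    (memLp_one_iff_integrable.2 hgi) hUI.2.1 hlim
  have hconv := tendsto_integral_of_L1' _ hgi.aestronglyMeasurable
    (Eventually.of_forall fun j => integrable_condExp) hL1
  have hconst : ∀ j, ∫ ω, (μ[fun ω => G (Y L ω) | (hτ j).measurableSpace]) ω ∂μ
      = ∫ ω, G (Y L ω) ∂μ := fun j => integral_condExp (hms j)
  simp only [hconst] at hconv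
  rw [tendsto_nhds_unique hconv tendsto_const_nhds]
  have h0 : ∫ ω, G (Y 0 ω) ∂μ = ∫ ω, (μ[fun ω => G (Y L ω) | ℱ 0]) ω ∂μ :=
    integral_congr_ae (hM.2 0 L zero_le).symm
  rw [h0, integral_condExp (ℱ.le _)]

end DyadicExit

section WeylChamber

open Topology NNReal

/-- The probability that a planar Brownian motion with covariance matrix `!![2, -1; -1, 2]`,
started at `x` in the open positive quadrant and with drift `z` in that quadrant, never leaves it:
an alternating sum of exponentials over the Weyl group of type `A₂`. -/
noncomputable def stayProb (z x : ℝ × ℝ) : ℝ :=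
  1 - exp (-(z.1 * x.1)) - exp (-(z.2 * x.2)) + exp (-((z.1 + z.2) * x.1 + z.2 * x.2))
    + exp (-(z.1 * x.1 + (z.1 + z.2) * x.2)) - exp (-((z.1 + z.2) * x.1 + (z.1 + z.2) * x.2))

/-- The open positive quadrant. -/
def posQuadrant : Set (ℝ × ℝ) := {y | 0 < y.1 ∧ 0 < y.2}

lemma isOpen_posQuadrant : IsOpen posQuadrant :=
  (isOpen_lt continuous_const continuous_fst).inter (isOpen_lt continuous_const continuous_snd)

lemma stayProb_eq_zero_of_frontier (z y : ℝ × ℝ) (hy : y ∈ closure posQuadrant)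
    (hy' : y ∉ posQuadrant) : stayProb z y = 0 := by
  have hcl : y ∈ {y : ℝ × ℝ | 0 ≤ y.1 ∧ 0 ≤ y.2} := by
    have hsub : posQuadrant ⊆ {y : ℝ × ℝ | 0 ≤ y.1 ∧ 0 ≤ y.2} := fun w hw => ⟨hw.1.le, hw.2.le⟩
    refine closure_minimal hsub ?_ hy
    exact (isClosed_le continuous_const continuous_fst).inter
      (isClosed_le continuous_const continuous_snd)
  have h0 : y.1 = 0 ∨ y.2 = 0 := by
    by_contra! h
    exact hy' ⟨lt_of_le_of_ne hcl.1 h.1.symm, lt_of_le_of_ne hcl.2 h.2.symm⟩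
  rcases h0 with h0 | h0 <;> simp [stayProb, h0]

lemma continuous_stayProb : Continuous fun w : (ℝ × ℝ) × (ℝ × ℝ) => stayProb w.1 w.2 := by
  unfold stayProb; fun_prop

lemma abs_stayProb_le {z x : ℝ × ℝ} (hz : z ∈ posQuadrant) (hx : x ∈ posQuadrant) :
    |stayProb z x| ≤ 6 := by
  obtain ⟨hz1, hz2⟩ := hz
  obtain ⟨hx1, hx2⟩ := hx
  have key : ∀ t : ℝ, 0 ≤ t → 0 ≤ exp (-t) ∧ exp (-t) ≤ 1 := fun t ht =>
    ⟨(exp_pos _).le, exp_le_one_iff.2 (by linarith)⟩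
  have h1 := key (z.1 * x.1) (by positivity)
  have h2 := key (z.2 * x.2) (by positivity)
  have h3 := key ((z.1 + z.2) * x.1 + z.2 * x.2) (by positivity)
  have h4 := key (z.1 * x.1 + (z.1 + z.2) * x.2) (by positivity)
  have h5 := key ((z.1 + z.2) * x.1 + (z.1 + z.2) * x.2) (by positivity)
  rw [stayProb, abs_le]
  constructor <;> linarith

/-- `V` is, with respect to the filtration `ℱ`, a centred planar Brownian motion with covariance
matrix `!![2, -1; -1, 2]` (the Cartan matrix of type `A₂`) and continuous paths. -/
structure IsCartanBM {Ω : Type*} {mΩ : MeasurableSpace Ω} (V₁ V₂ : ℝ≥0 → Ω → ℝ)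
    (ℱ : Filtration ℝ≥0 mΩ) (μ : Measure Ω) : Prop where
  meas_fst : ∀ s, Measurable[ℱ s] (V₁ s)
  meas_snd : ∀ s, Measurable[ℱ s] (V₂ s)
  cont_fst : ∀ ω, Continuous fun s => V₁ s ω
  cont_snd : ∀ ω, Continuous fun s => V₂ s ω
  zero_fst : ∀ ω, V₁ 0 ω = 0
  zero_snd : ∀ ω, V₂ 0 ω = 0
  law_incr : ∀ (c₁ c₂ : ℝ) (s t : ℝ≥0), s ≤ t →
    Measure.map (fun ω => c₁ * (V₁ t ω - V₁ s ω) + c₂ * (V₂ t ω - V₂ s ω)) μ =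
      gaussianReal 0 (2 * ((t : ℝ) - s) * (c₁ ^ 2 + c₂ ^ 2 - c₁ * c₂)).toNNReal
  indep_incr : ∀ (c₁ c₂ : ℝ) (s t : ℝ≥0), s ≤ t →
    Indep (MeasurableSpace.comap
      (fun ω => c₁ * (V₁ t ω - V₁ s ω) + c₂ * (V₂ t ω - V₂ s ω)) inferInstance) (ℱ s) μ

variable {Ω : Type*} {mΩ : MeasurableSpace Ω} {μ : Measure Ω} {V₁ V₂ : ℝ≥0 → Ω → ℝ}
  {ℱ : Filtration ℝ≥0 mΩ}

lemma integral_exp_of_map_eq_gaussianReal {D : Ω → ℝ} {v : ℝ≥0} (hD : AEMeasurable D μ)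
    (h : μ.map D = gaussianReal 0 v) :
    Integrable (fun ω => exp (D ω)) μ ∧ ∫ ω, exp (D ω) ∂μ = exp (v / 2) := by
  constructor
  · have := integrable_exp_mul_gaussianReal (μ := 0) (v := v) 1
    rw [← h] at this
    simpa [Function.comp_def] using this.comp_aemeasurable hD
  · have := mgf_gaussianReal h 1
    simpa [mgf] using this

lemma IsCartanBM.measurable_incr (hV : IsCartanBM V₁ V₂ ℱ μ) (c₁ c₂ : ℝ) (s t : ℝ≥0) :
    Measurable fun ω => c₁ * (V₁ t ω - V₁ s ω) + c₂ * (V₂ t ω - V₂ s ω) := by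
  have h1 : ∀ s, Measurable (V₁ s) := fun s => (hV.meas_fst s).mono (ℱ.le s) le_rfl
  have h2 : ∀ s, Measurable (V₂ s) := fun s => (hV.meas_snd s).mono (ℱ.le s) le_rfl
  fun_prop

lemma IsCartanBM.integral_exp_incr (hV : IsCartanBM V₁ V₂ ℱ μ) (c₁ c₂ : ℝ) {s t : ℝ≥0}
    (hst : s ≤ t) :
    Integrable (fun ω => exp (c₁ * (V₁ t ω - V₁ s ω) + c₂ * (V₂ t ω - V₂ s ω))) μ ∧
      ∫ ω, exp (c₁ * (V₁ t ω - V₁ s ω) + c₂ * (V₂ t ω - V₂ s ω)) ∂μ =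
        exp (((t : ℝ) - s) * (c₁ ^ 2 + c₂ ^ 2 - c₁ * c₂)) := by
  have h := integral_exp_of_map_eq_gaussianReal (hV.measurable_incr c₁ c₂ s t).aemeasurable
    (hV.law_incr c₁ c₂ s t hst)
  refine ⟨h.1, h.2.trans ?_⟩
  have hq : 0 ≤ c₁ ^ 2 + c₂ ^ 2 - c₁ * c₂ := by nlinarith [sq_nonneg (c₁ - c₂), sq_nonneg (c₁ + c₂)]
  have hts : (0 : ℝ) ≤ (t : ℝ) - s := sub_nonneg.2 (by exact_mod_cast hst)
  rw [Real.coe_toNNReal _ (by positivity)]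
  congr 1; ring

lemma IsCartanBM.martingale_exp [IsProbabilityMeasure μ] (hV : IsCartanBM V₁ V₂ ℱ μ)
    (c₁ c₂ : ℝ) :
    Martingale (fun (s : ℝ≥0) ω =>
      exp (c₁ * V₁ s ω + c₂ * V₂ s ω - s * (c₁ ^ 2 + c₂ ^ 2 - c₁ * c₂))) ℱ μ := by
  set Q := c₁ ^ 2 + c₂ ^ 2 - c₁ * c₂ with hQ
  have hadapt : ∀ s : ℝ≥0, Measurable[ℱ s]
      (fun ω => exp (c₁ * V₁ s ω + c₂ * V₂ s ω - s * Q)) := fun s => by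
    have h1 := hV.meas_fst s
    have h2 := hV.meas_snd s
    fun_prop
  have hGint : ∀ s : ℝ≥0, Integrable (fun ω => exp (c₁ * V₁ s ω + c₂ * V₂ s ω - s * Q)) μ := by
    intro s
    have := (hV.integral_exp_incr c₁ c₂ (zero_le (a := s))).1.mul_const (exp (-(s * Q)))
    refine this.congr (Eventually.of_forall fun ω => ?_)
    simp only [hV.zero_fst, hV.zero_snd, ← exp_add]
    congr 1; ring
  refine ⟨fun s => (hadapt s).stronglyMeasurable, fun s t hst => ?_⟩
  have hfac : (fun ω => exp (c₁ * V₁ t ω + c₂ * V₂ t ω - t * Q)) =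
      (fun ω => exp (c₁ * V₁ s ω + c₂ * V₂ s ω - s * Q)) * fun ω =>
        exp (c₁ * (V₁ t ω - V₁ s ω) + c₂ * (V₂ t ω - V₂ s ω)) * exp (-((t - s) * Q)) := by
    funext ω
    simp only [Pi.mul_apply, ← exp_add]
    congr 1; ring
  have hNint := ((hV.integral_exp_incr c₁ c₂ hst).1.mul_const (exp (-((t - s) * Q))))
  have h1 := condExp_mul_of_stronglyMeasurable_left (μ := μ) (m := ℱ s)
    (hadapt s).stronglyMeasurable (hfac ▸ hGint t) hNint
  have hDm := hV.measurable_incr c₁ c₂ s t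
  have hNm : Measurable[MeasurableSpace.comap
      (fun ω => c₁ * (V₁ t ω - V₁ s ω) + c₂ * (V₂ t ω - V₂ s ω)) inferInstance]
      (fun ω => exp (c₁ * (V₁ t ω - V₁ s ω) + c₂ * (V₂ t ω - V₂ s ω)) * exp (-((t - s) * Q))) :=
    ((measurable_exp.comp (comap_measurable _)).mul_const _)
  have h2 := condExp_indep_eq (μ := μ) hDm.comap_le (ℱ.le s) hNm.stronglyMeasurable
    (hV.indep_incr c₁ c₂ s t hst)
  simp only
  rw [hfac]
  filter_upwards [h1, h2] with ω hω1 hω2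
  rw [hω1, Pi.mul_apply, hω2, integral_mul_const, (hV.integral_exp_incr c₁ c₂ hst).2, ← exp_add,
    ← hQ]
  simp

lemma IsCartanBM.martingale_exp_drift [IsProbabilityMeasure μ] (hV : IsCartanBM V₁ V₂ ℱ μ)
    (z x : ℝ × ℝ) {c₁ c₂ : ℝ} (hc : c₁ * z.1 + c₂ * z.2 = c₁ ^ 2 + c₂ ^ 2 - c₁ * c₂) :
    Martingale (fun (s : ℝ≥0) ω =>
      exp (-(c₁ * (x.1 + z.1 * s + V₁ s ω) + c₂ * (x.2 + z.2 * s + V₂ s ω)))) ℱ μ := by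
  have h := (hV.martingale_exp (-c₁) (-c₂)).smul (exp (-(c₁ * x.1 + c₂ * x.2)))
  convert h using 1
  funext s ω
  simp only [Pi.smul_apply, smul_eq_mul, ← exp_add]
  congr 1
  linear_combination (-(s : ℝ)) * hc

lemma IsCartanBM.martingale_stayProb [IsProbabilityMeasure μ] (hV : IsCartanBM V₁ V₂ ℱ μ)
    (z x : ℝ × ℝ) :
    Martingale (fun (s : ℝ≥0) ω =>
      stayProb z (x.1 + z.1 * s + V₁ s ω, x.2 + z.2 * s + V₂ s ω)) ℱ μ := by
  have hone : Martingale (fun (_ : ℝ≥0) (_ : Ω) => (1 : ℝ)) ℱ μ := martingale_const ℱ μ 1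
  have h1 := hV.martingale_exp_drift z x (c₁ := z.1) (c₂ := 0) (by ring)
  have h2 := hV.martingale_exp_drift z x (c₁ := 0) (c₂ := z.2) (by ring)
  have h3 := hV.martingale_exp_drift z x (c₁ := z.1 + z.2) (c₂ := z.2) (by ring)
  have h4 := hV.martingale_exp_drift z x (c₁ := z.1) (c₂ := z.1 + z.2) (by ring)
  have h5 := hV.martingale_exp_drift z x (c₁ := z.1 + z.2) (c₂ := z.1 + z.2) (by ring)
  convert ((((hone.sub h1).sub h2).add h3).add h4).sub h5 using 1
  funext s ω
  simp [stayProb]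

lemma tendsto_exp_neg_of_tendsto_atTop {u v : ℕ → ℝ} (hu : Tendsto u atTop atTop)
    (hv : Tendsto v atTop atTop) {a b : ℝ} (ha : 0 ≤ a) (hb : 0 ≤ b) (hab : 0 < a + b) :
    Tendsto (fun n => exp (-(a * u n + b * v n))) atTop (𝓝 0) := by
  refine tendsto_exp_neg_atTop_nhds_zero.comp ?_
  rcases ha.eq_or_lt with rfl | ha'
  · simpa using hv.const_mul_atTop (by linarith)
  · refine tendsto_atTop_mono' _ ?_ (hu.const_mul_atTop ha')
    filter_upwards [hv.eventually_ge_atTop 0] with n hn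
    have := mul_nonneg hb hn
    linarith

lemma tendsto_stayProb_one {z : ℝ × ℝ} (hz : z ∈ posQuadrant) {u v : ℕ → ℝ}
    (hu : Tendsto u atTop atTop) (hv : Tendsto v atTop atTop) :
    Tendsto (fun n => stayProb z (u n, v n)) atTop (𝓝 1) := by
  obtain ⟨h1, h2⟩ := hz
  have e1 := tendsto_exp_neg_of_tendsto_atTop hu hv h1.le le_rfl (by linarith)
  have e2 := tendsto_exp_neg_of_tendsto_atTop hu hv le_rfl h2.le (by linarith)
  have e3 := tendsto_exp_neg_of_tendsto_atTop hu hv (add_pos h1 h2).le h2.le (by linarith)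
  have e4 := tendsto_exp_neg_of_tendsto_atTop hu hv h1.le (add_pos h1 h2).le (by linarith)
  have e5 := tendsto_exp_neg_of_tendsto_atTop hu hv (add_pos h1 h2).le (add_pos h1 h2).le
    (by linarith)
  have := ((((tendsto_const_nhds (x := (1 : ℝ))).sub e1).sub e2).add e3 |>.add e4).sub e5
  simpa [stayProb] using this

/-- The probability that a planar Brownian motion with Cartan covariance and drift inside the
positive quadrant stays in that quadrant at all dyadic times. -/
theorem IsCartanBM.measureReal_stay [IsProbabilityMeasure μ] (hV : IsCartanBM V₁ V₂ ℱ μ)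
    (hlim₁ : ∀ ω, Tendsto (fun n : ℕ => V₁ n ω / n) atTop (𝓝 0))
    (hlim₂ : ∀ ω, Tendsto (fun n : ℕ => V₂ n ω / n) atTop (𝓝 0))
    {z x : ℝ × ℝ} (hz : z ∈ posQuadrant) (hx : x ∈ posQuadrant) :
    μ.real {ω | ∀ j k : ℕ,
      0 < x.1 + z.1 * ((k : ℝ≥0) / 2 ^ j : ℝ≥0) + V₁ ((k : ℝ≥0) / 2 ^ j) ω ∧
      0 < x.2 + z.2 * ((k : ℝ≥0) / 2 ^ j : ℝ≥0) + V₂ ((k : ℝ≥0) / 2 ^ j) ω} =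
    stayProb z x := by
  set Y : ℝ≥0 → Ω → ℝ × ℝ := fun s ω => (x.1 + z.1 * s + V₁ s ω, x.2 + z.2 * s + V₂ s ω) with hYdef
  have hYm : ∀ s, Measurable[ℱ s] (Y s) := fun s => by
    have h1 := hV.meas_fst s
    have h2 := hV.meas_snd s
    exact (h1.const_add _).prodMk (h2.const_add _)
  have hYc : ∀ ω, Continuous fun s => Y s ω := fun ω => by
    have h1 := hV.cont_fst ω
    have h2 := hV.cont_snd ω
    fun_prop
  have hY0 : ∀ ω, Y 0 ω = x := fun ω => by simp [hYdef, hV.zero_fst, hV.zero_snd]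
  have hGc : Continuous (stayProb z) := continuous_stayProb.comp (Continuous.prodMk_right z)
  set A : Set Ω := {ω | ∀ j k : ℕ, Y ((k : ℝ≥0) / 2 ^ j) ω ∈ posQuadrant} with hA
  set B : ℕ → Set Ω := fun L =>
    {ω | ∀ j k : ℕ, k ≤ L * 2 ^ j → Y ((k : ℝ≥0) / 2 ^ j) ω ∈ posQuadrant} with hB
  have hmeasY : ∀ s, MeasurableSet {ω | Y s ω ∈ posQuadrant} := fun s =>
    ((hYm s).mono (ℱ.le _) le_rfl) isOpen_posQuadrant.measurableSet
  have hAm : MeasurableSet A := by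
    simp only [hA, Set.ofPred_forall]
    exact MeasurableSet.iInter fun j => MeasurableSet.iInter fun k => hmeasY _
  have hBm : ∀ L, MeasurableSet (B L) := fun L => by
    simp only [hB, Set.ofPred_forall]
    exact MeasurableSet.iInter fun j => MeasurableSet.iInter fun k => MeasurableSet.iInter fun _ =>
      hmeasY _
  have hstay : ∀ L : ℕ, stayProb z x = ∫ ω, indicator (B L) (fun ω => stayProb z (Y L ω)) ω ∂μ := by
    intro L
    have := integral_eq_integral_indicator_stay (μ := μ) (ℱ := ℱ) hYm hYc isOpen_posQuadrant hGc
      (stayProb_eq_zero_of_frontier z) (fun ω => by rw [hY0]; exact hx)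
      (hV.martingale_stayProb z x) L
    rw [← this]
    simp [hY0]
  have hgrid : ∀ L : ℕ, ∀ ω ∈ B L, Y L ω ∈ posQuadrant := fun L ω hω => by
    simpa using hω 0 L (by simp)
  have htend : Tendsto (fun L : ℕ => ∫ ω, indicator (B L) (fun ω => stayProb z (Y L ω)) ω ∂μ) atTop
      (𝓝 (∫ ω, indicator A (fun _ => (1 : ℝ)) ω ∂μ)) := by
    refine tendsto_integral_of_dominated_convergence (fun _ => 6) (fun L => ?_)
      (integrable_const _) (fun L => Eventually.of_forall fun ω => ?_)
      (Eventually.of_forall fun ω => ?_)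
    · refine (Measurable.indicator ?_ (hBm L)).aestronglyMeasurable
      exact hGc.measurable.comp ((hYm _).mono (ℱ.le _) le_rfl)
    · by_cases hω : ω ∈ B L
      · rw [indicator_of_mem hω, Real.norm_eq_abs]
        exact abs_stayProb_le hz (hgrid L ω hω)
      · rw [indicator_of_notMem hω]; simp
    · by_cases hω : ω ∈ A
      · have hωB : ∀ L, ω ∈ B L := fun L j k _ => hω j k
        simp only [indicator_of_mem hω, indicator_of_mem (hωB _)]
        have aux : ∀ (V : ℝ≥0 → Ω → ℝ) (a b : ℝ), 0 < b →
            Tendsto (fun n : ℕ => V n ω / n) atTop (𝓝 0) →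
            Tendsto (fun n : ℕ => a + b * ((n : ℝ≥0) : ℝ) + V n ω) atTop atTop := by
          intro V a b hb hVl
          have h1 : Tendsto (fun n : ℕ => b + V n ω / n) atTop (𝓝 (b + 0)) :=
            tendsto_const_nhds.add hVl
          rw [add_zero] at h1
          have h2 := h1.pos_mul_atTop hb tendsto_natCast_atTop_atTop
          have h3 := tendsto_atTop_add_const_left _ a h2
          refine h3.congr' ?_
          filter_upwards [eventually_gt_atTop 0] with n hn
          have : (n : ℝ) ≠ 0 := by positivity
          simp only [NNReal.coe_natCast]
          field_simp
          ring
        exact tendsto_stayProb_one hz (aux V₁ _ _ hz.1 (hlim₁ ω)) (aux V₂ _ _ hz.2 (hlim₂ ω))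
      · rw [indicator_of_notMem hω]
        simp only [hA, Set.mem_ofPred_eq, not_forall] at hω
        obtain ⟨j, k, hjk⟩ := hω
        refine tendsto_const_nhds.congr' ?_
        filter_upwards [eventually_ge_atTop k] with L hL
        rw [indicator_of_notMem]
        exact fun h => hjk (h j k (hL.trans (Nat.le_mul_of_pos_right _ (by positivity))))
  simp only [← hstay] at htend
  have := tendsto_nhds_unique htend tendsto_const_nhds
  rw [integral_indicator_const _ hAm] at this
  rw [smul_eq_mul, mul_one] at this
  exact this

end WeylChamber

section SlepianGaussian

open NNReal

variable {Ω : Type*} [MeasurableSpace Ω] {μ : Measure Ω} {S : ℝ → Ω → ℝ}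

lemma IsSlepian.measurable_span (hS : IsSlepian μ S) {X : Ω → ℝ}
    (hX : X ∈ Submodule.span ℝ (range S)) : Measurable X := by
  induction hX using Submodule.span_induction with
  | mem x h => obtain ⟨t, rfl⟩ := h; exact hS.2.1 t
  | zero => exact measurable_zero
  | add x y _ _ hx hy => exact hx.add hy
  | smul a x _ hx => exact hx.const_smul a

lemma IsSlepian.map_span_eq (hS : IsSlepian μ S) {X : Ω → ℝ}
    (hX : X ∈ Submodule.span ℝ (range S)) : ∃ v : ℝ≥0, μ.map X = gaussianReal 0 v := by
  obtain ⟨n, c, g, rfl⟩ := Submodule.mem_span_set'.1 hX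
  choose t ht using fun i => (g i).2
  obtain ⟨v, hv⟩ := hS.2.2.2.1 n t c
  refine ⟨v, ?_⟩
  rw [← hv]
  congr 1
  ext ω
  simp [← ht]

lemma IsSlepian.map_span (hS : IsSlepian μ S) {X : Ω → ℝ}
    (hX : X ∈ Submodule.span ℝ (range S)) :
    μ.map X = gaussianReal 0 (Var[X; μ]).toNNReal := by
  obtain ⟨v, hv⟩ := hS.map_span_eq hX
  have h : Var[X; μ] = v := by
    rw [← variance_id_gaussianReal (μ := 0) (v := v), ← hv,
      variance_map aemeasurable_id (hS.measurable_span hX).aemeasurable]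
    rfl
  rw [hv, h, Real.toNNReal_coe]

lemma IsSlepian.memLp_span (hS : IsSlepian μ S) {X : Ω → ℝ}
    (hX : X ∈ Submodule.span ℝ (range S)) : MemLp X 2 μ := by
  obtain ⟨v, hv⟩ := hS.map_span_eq hX
  have := memLp_id_gaussianReal (μ := 0) (v := v) 2
  rw [← hv] at this
  exact this.comp_of_map (hS.measurable_span hX).aemeasurable

lemma IsSlepian.memLp (hS : IsSlepian μ S) (t : ℝ) : MemLp (S t) 2 μ :=
  hS.memLp_span (Submodule.subset_span ⟨t, rfl⟩)

lemma IsSlepian.covariance_eq (hS : IsSlepian μ S) (t u : ℝ) :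
    cov[S t, S u; μ] = max 0 (1 - |t - u|) := by
  have := hS.1
  rw [covariance_eq_sub (hS.memLp t) (hS.memLp u), hS.2.2.2.2.1 t, zero_mul, sub_zero]
  exact hS.2.2.2.2.2 t u

lemma IsSlepian.isGaussianProcess (hS : IsSlepian μ S) {T : Type*} {X : T → Ω → ℝ}
    (hX : ∀ i, X i ∈ Submodule.span ℝ (range S)) : IsGaussianProcess X μ where
  hasGaussianLaw I := by
    refine ⟨isGaussian_of_map_eq_gaussianReal fun L => ?_⟩
    have hm : Measurable fun ω => I.restrict (X · ω) :=
      measurable_pi_lambda _ fun i => hS.measurable_span (hX i)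
    classical
    rw [Measure.map_map L.continuous.measurable hm]
    have hL : L ∘ (fun ω => I.restrict (X · ω)) =
        ∑ i : I, L (Pi.single i 1) • X i := by
      ext ω
      have := LinearMap.pi_apply_eq_sum_univ (L : (I → ℝ) →ₗ[ℝ] ℝ) (I.restrict (X · ω))
      simp only [Function.comp_apply, Finset.sum_apply, Pi.smul_apply, smul_eq_mul]
      simp only [ContinuousLinearMap.coe_coe] at this
      rw [this]
      refine Finset.sum_congr rfl fun i _ => ?_
      rw [smul_eq_mul, mul_comm, Finset.restrict]
      congr 2
      ext j
      simp [Pi.single_apply, eq_comm]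
    obtain ⟨v, hv⟩ := hS.map_span_eq (X := L ∘ (fun ω => I.restrict (X · ω))) (by
      rw [hL]
      exact Submodule.sum_mem _ fun i _ => Submodule.smul_mem _ _ (hX i))
    exact ⟨0, v, hv⟩

lemma IsSlepian.indepFun_of_covariance_eq_zero (hS : IsSlepian μ S) {T U : Type*}
    {X : T → Ω → ℝ} {Y : U → Ω → ℝ} (hX : ∀ i, X i ∈ Submodule.span ℝ (range S))
    (hY : ∀ i, Y i ∈ Submodule.span ℝ (range S)) (h : ∀ i j, cov[X i, Y j; μ] = 0) :
    IndepFun (fun ω i => X i ω) (fun ω j => Y j ω) μ :=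
  IsGaussianProcess.indepFun_of_covariance_eq_zero
    (hS.isGaussianProcess fun i => by cases i <;> simp [hX, hY])
    (fun i => (hS.measurable_span (hX i)).aemeasurable)
    (fun i => (hS.measurable_span (hY i)).aemeasurable) h

/-- With `t = s / (1 + s)`, the part of `-(1 + s) * S (c + t)` that is independent of
`(S c, S (c + 1))`. -/
noncomputable def bridgePart {Ω : Type*} (S : ℝ → Ω → ℝ) (c : ℝ) (s : ℝ≥0) : Ω → ℝ :=
  S c + (s : ℝ) • S (c + 1) + (-(1 + s : ℝ)) • S (c + s / (1 + s))

lemma bridgePart_mem_span {Ω : Type*} (S : ℝ → Ω → ℝ) (c : ℝ) (s : ℝ≥0) :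
    bridgePart S c s ∈ Submodule.span ℝ (range S) :=
  add_mem (add_mem (Submodule.subset_span ⟨_, rfl⟩)
    (Submodule.smul_mem _ _ (Submodule.subset_span ⟨_, rfl⟩)))
    (Submodule.smul_mem _ _ (Submodule.subset_span ⟨_, rfl⟩))

lemma IsSlepian.covariance_bridgePart_left (hS : IsSlepian μ S) (c : ℝ) (s : ℝ≥0) {Y : Ω → ℝ}
    (hY : MemLp Y 2 μ) :
    cov[bridgePart S c s, Y; μ] =
      cov[S c, Y; μ] + s * cov[S (c + 1), Y; μ] - (1 + s) * cov[S (c + s / (1 + s)), Y; μ] := by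
  have := hS.1
  have hm := hS.memLp
  rw [bridgePart, covariance_add_left ((hm _).add ((hm _).const_smul _)) ((hm _).const_smul _) hY,
    covariance_add_left (hm _) ((hm _).const_smul _) hY, covariance_smul_left, covariance_smul_left]
  ring

lemma IsSlepian.covariance_bridgePart_eval (hS : IsSlepian μ S) (c : ℝ) (s : ℝ≥0) (u : ℝ) :
    cov[bridgePart S c s, S u; μ] =
      max 0 (1 - |c - u|) + s * max 0 (1 - |c + 1 - u|)
        - (1 + s) * max 0 (1 - |c + s / (1 + s) - u|) := by
  rw [hS.covariance_bridgePart_left _ _ (hS.memLp u)]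
  simp only [hS.covariance_eq]

end SlepianGaussian

section SlepianBridge

open NNReal

variable {Ω : Type*} [MeasurableSpace Ω] {μ : Measure Ω} {S : ℝ → Ω → ℝ}

lemma div_one_add_mem_Ico (s : ℝ≥0) : (s : ℝ) / (1 + s) ∈ Ico (0 : ℝ) 1 := by
  have hs := s.coe_nonneg
  exact ⟨by positivity, by rw [div_lt_one (by positivity)]; linarith⟩

lemma one_add_mul_div_one_add (s : ℝ≥0) : (1 + s : ℝ) * (s / (1 + s)) = s := by
  have hs := s.coe_nonneg
  field_simp

lemma IsSlepian.covariance_bridgePart_nat (hS : IsSlepian μ S) {c u : ℝ}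
    (hcu : c - u = -2 ∨ c - u = -1 ∨ c - u = 0 ∨ c - u = 1) (s : ℝ≥0) :
    cov[bridgePart S c s, S u; μ] = 0 := by
  rw [hS.covariance_bridgePart_eval]
  have ht := div_one_add_mem_Ico s
  have hst := one_add_mul_div_one_add s
  set t : ℝ := s / (1 + s)
  obtain ⟨h0, h1⟩ := ht
  rw [show c + 1 - u = (c - u) + 1 by ring, show c + t - u = (c - u) + t by ring]
  rcases hcu with h | h | h | h <;> rw [h]
  · rw [abs_of_neg (by linarith : (-2 : ℝ) + t < 0),
      max_eq_left (by linarith : 1 - -(-2 + t) ≤ 0)]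
    norm_num
  · rw [abs_of_neg (by linarith : (-1 : ℝ) + t < 0),
      max_eq_right (by linarith : (0:ℝ) ≤ 1 - -(-1 + t))]
    norm_num
    linarith
  · rw [abs_of_nonneg (by linarith : (0 : ℝ) ≤ 0 + t),
      max_eq_right (by linarith : (0:ℝ) ≤ 1 - (0 + t))]
    norm_num
    linarith
  · rw [abs_of_nonneg (by linarith : (0 : ℝ) ≤ 1 + t), max_eq_left (by linarith : 1 - (1 + t) ≤ 0)]
    norm_num

lemma IsSlepian.covariance_bridgePart_self (hS : IsSlepian μ S) (c : ℝ) {s u : ℝ≥0} (hsu : s ≤ u) :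
    cov[bridgePart S c s, bridgePart S c u; μ] = 2 * s := by
  rw [hS.covariance_bridgePart_left _ _ (hS.memLp_span (bridgePart_mem_span S c u)),
    covariance_comm (S c), covariance_comm (S (c + 1)), covariance_comm (S (c + s / (1 + s))),
    hS.covariance_bridgePart_nat (by simp), hS.covariance_bridgePart_nat (by simp),
    hS.covariance_bridgePart_eval]
  have hs := div_one_add_mem_Ico s
  have hu := div_one_add_mem_Ico u
  have hs' := one_add_mul_div_one_add s
  have hu' := one_add_mul_div_one_add u
  have hle : (s : ℝ) / (1 + s) ≤ u / (1 + u) := by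
    rw [div_le_div_iff₀ (by positivity) (by positivity)]
    have : (s : ℝ) ≤ u := hsu
    linarith
  set a : ℝ := s / (1 + s)
  set b : ℝ := u / (1 + u)
  obtain ⟨h0, h1⟩ := hs
  obtain ⟨h2, h3⟩ := hu
  rw [show c - (c + a) = -a by ring, show c + 1 - (c + a) = 1 - a by ring,
    show c + b - (c + a) = b - a by ring, abs_neg, abs_of_nonneg h0,
    abs_of_nonneg (by linarith : 0 ≤ 1 - a), abs_of_nonneg (by linarith : 0 ≤ b - a),
    max_eq_right (by linarith), max_eq_right (by linarith), max_eq_right (by linarith)]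
  linear_combination ((1 : ℝ) + u - u) * hs' + (1 + s) * (-1) * hu' + (1+u)*hs' - (u:ℝ) * hs'

lemma IsSlepian.covariance_bridgePart_succ (hS : IsSlepian μ S) (c : ℝ) (s u : ℝ≥0) :
    cov[bridgePart S c s, bridgePart S (c + 1) u; μ] = -min (s : ℝ) u := by
  rw [hS.covariance_bridgePart_left _ _ (hS.memLp_span (bridgePart_mem_span S (c + 1) u)),
    covariance_comm (S c), covariance_comm (S (c + 1)), covariance_comm (S (c + s / (1 + s))),
    hS.covariance_bridgePart_nat (by simp), hS.covariance_bridgePart_nat (by simp),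
    hS.covariance_bridgePart_eval]
  have hs := div_one_add_mem_Ico s
  have hu := div_one_add_mem_Ico u
  have hs' := one_add_mul_div_one_add s
  have hu' := one_add_mul_div_one_add u
  have hle : (s : ℝ) / (1 + s) ≤ u / (1 + u) ↔ (s : ℝ) ≤ u := by
    rw [div_le_div_iff₀ (by positivity) (by positivity)]
    constructor <;> intro <;> linarith
  set a : ℝ := s / (1 + s)
  set b : ℝ := u / (1 + u)
  obtain ⟨h0, h1⟩ := hs
  obtain ⟨h2, h3⟩ := hu
  rw [show c + 1 - (c + a) = 1 - a by ring, show c + 1 + 1 - (c + a) = 2 - a by ring,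
    show c + 1 + b - (c + a) = 1 + b - a by ring,
    abs_of_nonneg (by linarith : 0 ≤ 1 - a), abs_of_nonneg (by linarith : 0 ≤ 2 - a),
    abs_of_nonneg (by linarith : 0 ≤ 1 + b - a), max_eq_right (by linarith : 0 ≤ 1 - (1 - a)),
    max_eq_left (by linarith : 1 - (2 - a) ≤ 0)]
  rcases le_total (s : ℝ) u with h | h
  · rw [min_eq_left h, max_eq_left (by linarith [hle.2 h])]
    linear_combination -hs'
  · have hba : b ≤ a := by
      by_contra! hab
      rcases h.eq_or_lt with h | h
      · simp [a, b, h] at hab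
      · linarith [hle.1 hab.le]
    rw [min_eq_right h, max_eq_right (by linarith)]
    linear_combination (-1 + (1 + (u:ℝ))) * hs' - (1 + s) * hu'

/-- The filtration generated by the two bridge parts. -/
noncomputable def bridgeFiltration (hS : IsSlepian μ S) (c : ℝ) :
    Filtration ℝ≥0 ‹MeasurableSpace Ω› :=
  Filtration.natural (fun s ω => (bridgePart S c s ω, bridgePart S (c + 1) s ω)) fun s =>
    ((hS.measurable_span (bridgePart_mem_span S c s)).prodMk
      (hS.measurable_span (bridgePart_mem_span S (c + 1) s))).stronglyMeasurable

lemma IsSlepian.continuous_bridgePart (hS : IsSlepian μ S) (c : ℝ) (ω : Ω) :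
    Continuous fun s => bridgePart S c s ω := by
  have h := hS.2.2.1 ω
  have h2 : Continuous fun s : ℝ≥0 => S (c + s / (1 + s)) ω := by
    refine h.comp (continuous_const.add (NNReal.continuous_coe.div₀ (by fun_prop) fun s => ?_))
    positivity
  simp only [bridgePart, Pi.add_apply, Pi.smul_apply, smul_eq_mul]
  exact (continuous_const.add (NNReal.continuous_coe.mul continuous_const)).add
    ((continuous_const.add NNReal.continuous_coe).neg.mul h2)

/-- The increment over `[s, t]` of a linear combination of the two bridge parts. -/
noncomputable def bridgeIncr {Ω : Type*} (S : ℝ → Ω → ℝ) (c c₁ c₂ : ℝ) (s t : ℝ≥0) : Ω → ℝ :=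
  c₁ • (bridgePart S c t - bridgePart S c s)
    + c₂ • (bridgePart S (c + 1) t - bridgePart S (c + 1) s)

lemma bridgeIncr_mem_span {Ω : Type*} (S : ℝ → Ω → ℝ) (c c₁ c₂ : ℝ) (s t : ℝ≥0) :
    bridgeIncr S c c₁ c₂ s t ∈ Submodule.span ℝ (range S) :=
  add_mem (Submodule.smul_mem _ _ (sub_mem (bridgePart_mem_span _ _ _) (bridgePart_mem_span _ _ _)))
    (Submodule.smul_mem _ _ (sub_mem (bridgePart_mem_span _ _ _) (bridgePart_mem_span _ _ _)))

lemma IsSlepian.covariance_bridgeIncr_left (hS : IsSlepian μ S) (c c₁ c₂ : ℝ) (s t : ℝ≥0)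
    {Y : Ω → ℝ} (hY : MemLp Y 2 μ) :
    cov[bridgeIncr S c c₁ c₂ s t, Y; μ] =
      c₁ * (cov[bridgePart S c t, Y; μ] - cov[bridgePart S c s, Y; μ])
        + c₂ * (cov[bridgePart S (c + 1) t, Y; μ] - cov[bridgePart S (c + 1) s, Y; μ]) := by
  have := hS.1
  have hm := fun c s => hS.memLp_span (bridgePart_mem_span S c s)
  rw [bridgeIncr, covariance_add_left (((hm _ _).sub (hm _ _)).const_smul _)
    (((hm _ _).sub (hm _ _)).const_smul _) hY, covariance_smul_left, covariance_smul_left,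
    covariance_sub_left (hm _ _) (hm _ _) hY, covariance_sub_left (hm _ _) (hm _ _) hY]

lemma IsSlepian.covariance_bridgeIncr_bridgePart (hS : IsSlepian μ S) (c c₁ c₂ : ℝ) {s t u : ℝ≥0}
    (hst : s ≤ t) (hus : u ≤ s) :
    cov[bridgeIncr S c c₁ c₂ s t, bridgePart S c u; μ] = 0 ∧
    cov[bridgeIncr S c c₁ c₂ s t, bridgePart S (c + 1) u; μ] = 0 := by
  have hm := fun c s => hS.memLp_span (bridgePart_mem_span S c s)
  have h1 : ((u : ℝ) ≤ s) := hus
  have h2 : ((u : ℝ) ≤ t) := hus.trans hst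
  constructor
  · rw [hS.covariance_bridgeIncr_left _ _ _ _ _ (hm _ _), covariance_comm,
      hS.covariance_bridgePart_self c (hus.trans hst), covariance_comm,
      hS.covariance_bridgePart_self c hus, covariance_comm,
      hS.covariance_bridgePart_succ, covariance_comm, hS.covariance_bridgePart_succ,
      min_eq_left h1, min_eq_left h2]
    ring
  · rw [hS.covariance_bridgeIncr_left _ _ _ _ _ (hm _ _),
      hS.covariance_bridgePart_succ, hS.covariance_bridgePart_succ, covariance_comm,
      hS.covariance_bridgePart_self _ (hus.trans hst), covariance_comm,
      hS.covariance_bridgePart_self _ hus, min_eq_right h1, min_eq_right h2]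
    ring

lemma IsSlepian.variance_bridgeIncr (hS : IsSlepian μ S) (c c₁ c₂ : ℝ) {s t : ℝ≥0}
    (hst : s ≤ t) :
    Var[bridgeIncr S c c₁ c₂ s t; μ] = 2 * ((t : ℝ) - s) * (c₁ ^ 2 + c₂ ^ 2 - c₁ * c₂) := by
  have hmi := hS.memLp_span (bridgeIncr_mem_span S c c₁ c₂ s t)
  have hm := fun c s => hS.memLp_span (bridgePart_mem_span S c s)
  have h := hS.covariance_bridgeIncr_bridgePart c c₁ c₂ hst le_rfl
  have h1 : ((s : ℝ) ≤ t) := hst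
  rw [← covariance_self hmi.aemeasurable, hS.covariance_bridgeIncr_left _ _ _ _ _ hmi,
    covariance_comm, covariance_comm (bridgePart S c s), h.1,
    covariance_comm (bridgePart S (c + 1) t), covariance_comm (bridgePart S (c + 1) s), h.2,
    hS.covariance_bridgeIncr_left _ _ _ _ _ (hm _ _),
    hS.covariance_bridgeIncr_left _ _ _ _ _ (hm _ _),
    covariance_comm (bridgePart S (c + 1) t) (bridgePart S c t),
    covariance_comm (bridgePart S (c + 1) s) (bridgePart S c t)]
  simp only [hS.covariance_bridgePart_succ, hS.covariance_bridgePart_self _ hst,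
    hS.covariance_bridgePart_self _ le_rfl, min_self, min_eq_left h1, min_eq_right h1]
  ring

theorem IsSlepian.isCartanBM (hS : IsSlepian μ S) (c : ℝ) :
    IsCartanBM (bridgePart S c) (bridgePart S (c + 1)) (bridgeFiltration hS c) μ where
  meas_fst s := measurable_fst.comp
    (Filtration.stronglyAdapted_natural (u := fun s ω =>
      (bridgePart S c s ω, bridgePart S (c + 1) s ω)) _ s).measurable
  meas_snd s := measurable_snd.comp
    (Filtration.stronglyAdapted_natural (u := fun s ω =>
      (bridgePart S c s ω, bridgePart S (c + 1) s ω)) _ s).measurable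
  cont_fst := hS.continuous_bridgePart c
  cont_snd := hS.continuous_bridgePart (c + 1)
  zero_fst ω := by simp [bridgePart]
  zero_snd ω := by simp [bridgePart]
  law_incr c₁ c₂ s t hst := by
    rw [← hS.variance_bridgeIncr c c₁ c₂ hst]
    exact hS.map_span (bridgeIncr_mem_span S c c₁ c₂ s t)
  indep_incr c₁ c₂ s t hst := by
    have h := hS.indepFun_of_covariance_eq_zero (X := fun _ : Unit => bridgeIncr S c c₁ c₂ s t)
      (Y := fun p : Iic s × Bool => bridgePart S (if p.2 then c else c + 1) p.1)
      (fun _ => bridgeIncr_mem_span S c c₁ c₂ s t) (fun p => bridgePart_mem_span S _ _)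
      (fun _ p => by
        have := hS.covariance_bridgeIncr_bridgePart c c₁ c₂ hst p.1.2
        rcases p with ⟨p, _ | _⟩
        · simpa using this.2
        · simpa using this.1)
    rw [IndepFun_iff_Indep] at h
    refine indep_of_indep_of_le_left (indep_of_indep_of_le_right h ?_) ?_
    · have hY := comap_measurable (m := MeasurableSpace.pi)
        (fun ω (p : Iic s × Bool) => bridgePart S (if p.2 then c else c + 1) p.1 ω)
      refine iSup₂_le fun u hu => Measurable.comap_le ?_
      exact ((measurable_pi_apply ((⟨u, hu⟩, true) : Iic s × Bool)).comp hY).prodMk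
        ((measurable_pi_apply ((⟨u, hu⟩, false) : Iic s × Bool)).comp hY)
    · exact Measurable.comap_le ((measurable_pi_apply ()).comp (comap_measurable
        (m := MeasurableSpace.pi) (fun ω (_ : Unit) => bridgeIncr S c c₁ c₂ s t ω)))

end SlepianBridge

section SlepianCondition

open NNReal Topology

variable {Ω : Type*} [MeasurableSpace Ω] {μ : Measure Ω} {S : ℝ → Ω → ℝ}

lemma IsSlepian.tendsto_bridgePart_div (hS : IsSlepian μ S) (c : ℝ) (ω : Ω) :
    Tendsto (fun n : ℕ => bridgePart S c n ω / n) atTop (𝓝 0) := by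
  have h1 : Tendsto (fun n : ℕ => (n : ℝ) / (1 + n)) atTop (𝓝 1) := by
    refine (tendsto_natCast_div_add_atTop (1 : ℝ)).congr fun n => by rw [add_comm]
  have h2 : Tendsto (fun n : ℕ => S (c + n / (1 + n)) ω) atTop (𝓝 (S (c + 1) ω)) :=
    ((hS.2.2.1 ω).tendsto (c + 1)).comp (tendsto_const_nhds.add h1)
  have h3 : Tendsto (fun n : ℕ => S c ω * (1 / (n : ℝ)) + S (c + 1) ω
      - (1 / (n : ℝ) + 1) * S (c + n / (1 + n)) ω) atTop (𝓝 (S c ω * 0 + S (c + 1) ω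
        - (0 + 1) * S (c + 1) ω)) :=
    ((tendsto_one_div_atTop_nhds_zero_nat.const_mul _).add_const _).sub
      ((tendsto_one_div_atTop_nhds_zero_nat.add_const 1).mul h2)
  rw [show S c ω * 0 + S (c + 1) ω - (0 + 1) * S (c + 1) ω = 0 by ring] at h3
  refine h3.congr' ?_
  filter_upwards [eventually_gt_atTop 0] with n hn
  have : (n : ℝ) ≠ 0 := by positivity
  simp only [bridgePart, Pi.add_apply, Pi.smul_apply, smul_eq_mul, NNReal.coe_natCast]
  field_simp
  ring

/-- The conditional probability that `S` stays below `h` on `[0, 2]` given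
`(S 1, (S 0, S 2)) = w`. -/
noncomputable def condStayProb (h : ℝ) (w : ℝ × ℝ × ℝ) : ℝ :=
  {w : ℝ × ℝ × ℝ | w.1 < h ∧ w.2.1 < h ∧ w.2.2 < h}.indicator
    (fun w => stayProb (h - w.1, h - w.2.2) (h - w.2.1, h - w.1)) w

lemma measurableSet_below (h : ℝ) :
    MeasurableSet {w : ℝ × ℝ × ℝ | w.1 < h ∧ w.2.1 < h ∧ w.2.2 < h} :=
  (measurableSet_lt measurable_fst measurable_const).inter
    ((measurableSet_lt measurable_snd.fst measurable_const).inter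
      (measurableSet_lt measurable_snd.snd measurable_const))

lemma measurable_condStayProb (h : ℝ) : Measurable (condStayProb h) := by
  refine Measurable.indicator ?_ ?_
  · unfold stayProb
    fun_prop
  · exact measurableSet_below h

lemma abs_condStayProb_le (h : ℝ) (w : ℝ × ℝ × ℝ) : |condStayProb h w| ≤ 6 := by
  by_cases hw : w ∈ {w : ℝ × ℝ × ℝ | w.1 < h ∧ w.2.1 < h ∧ w.2.2 < h}
  · rw [condStayProb, indicator_of_mem hw]
    obtain ⟨h1, h2, h3⟩ := hw
    exact abs_stayProb_le ⟨sub_pos.2 h1, sub_pos.2 h3⟩ ⟨sub_pos.2 h2, sub_pos.2 h1⟩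
  · rw [condStayProb, indicator_of_notMem hw]
    norm_num

lemma integrable_condStayProb (h : ℝ) (ν : Measure (ℝ × ℝ × ℝ)) [IsFiniteMeasure ν] :
    Integrable (condStayProb h) ν :=
  .of_bound (measurable_condStayProb h).aestronglyMeasurable 6
    (ae_of_all _ fun w => abs_condStayProb_le h w)

lemma tendsto_condStayProb (h : ℝ) (w : ℝ × ℝ × ℝ) :
    Tendsto (fun n : ℕ => condStayProb (h - 1 / ((n : ℝ) + 1)) w) atTop
      (𝓝 (condStayProb h w)) := by
  have hlim : Tendsto (fun n : ℕ => h - 1 / ((n : ℝ) + 1)) atTop (𝓝 h) := by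
    simpa using tendsto_one_div_add_atTop_nhds_zero_nat.const_sub h
  by_cases hw : w ∈ {w : ℝ × ℝ × ℝ | w.1 < h ∧ w.2.1 < h ∧ w.2.2 < h}
  · have hc : Continuous fun h : ℝ => stayProb (h - w.1, h - w.2.2) (h - w.2.1, h - w.1) := by
      unfold stayProb
      fun_prop
    rw [condStayProb, indicator_of_mem hw]
    refine ((hc.tendsto h).comp hlim).congr' ?_
    filter_upwards [hlim.eventually_const_lt hw.1, hlim.eventually_const_lt hw.2.1,
      hlim.eventually_const_lt hw.2.2] with n h1 h2 h3
    rw [condStayProb, indicator_of_mem]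
    · rfl
    · exact ⟨h1, h2, h3⟩
  · rw [condStayProb, indicator_of_notMem hw]
    refine tendsto_const_nhds.congr fun n => ?_
    rw [condStayProb, indicator_of_notMem]
    intro hw'
    have : 0 < 1 / ((n : ℝ) + 1) := by positivity
    exact hw ⟨hw'.1.trans (by linarith), hw'.2.1.trans (by linarith), hw'.2.2.trans (by linarith)⟩

/-- The event that `S` is below `h` on a countable dense subset of `[0, 2]`, written in terms of
the bridge parts. -/
def gridBelow (S : ℝ → Ω → ℝ) (h : ℝ) : Set Ω :=
  {ω | (S 1 ω < h ∧ S 0 ω < h ∧ S 2 ω < h) ∧ ∀ j k : ℕ,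
    0 < h - S 0 ω + (h - S 1 ω) * ((k : ℝ≥0) / 2 ^ j : ℝ≥0) + bridgePart S 0 ((k : ℝ≥0) / 2 ^ j) ω ∧
    0 < h - S 1 ω + (h - S 2 ω) * ((k : ℝ≥0) / 2 ^ j : ℝ≥0) + bridgePart S 1 ((k : ℝ≥0) / 2 ^ j) ω}

lemma IsSlepian.map_eval_zero_one_two (hS : IsSlepian μ S) :
    μ.map (fun ω => (S 1 ω, S 0 ω, S 2 ω)) =
      (gaussianReal 0 1).prod ((gaussianReal 0 1).prod (gaussianReal 0 1)) := by
  have := hS.1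
  have hm := hS.2.1
  have hspan : ∀ t, S t ∈ Submodule.span ℝ (range S) := fun t => Submodule.subset_span ⟨t, rfl⟩
  have hlaw : ∀ t, μ.map (S t) = gaussianReal 0 1 := fun t => by
    rw [hS.map_span (hspan t), ← covariance_self (hm t).aemeasurable, hS.covariance_eq]
    simp
  have h1 := hS.indepFun_of_covariance_eq_zero (X := fun _ : Unit => S 1)
    (Y := fun b : Bool => S (if b then 0 else 2)) (fun _ => hspan _) (fun _ => hspan _)
    (fun _ b => by rw [hS.covariance_eq]; cases b <;> norm_num)
  have h2 := hS.indepFun_of_covariance_eq_zero (X := fun _ : Unit => S 0)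
    (Y := fun _ : Unit => S 2) (fun _ => hspan _) (fun _ => hspan _)
    (fun _ b => by rw [hS.covariance_eq]; norm_num)
  have h1' : IndepFun (S 1) (fun ω => (S 0 ω, S 2 ω)) μ :=
    h1.comp (φ := fun f : Unit → ℝ => f ()) (ψ := fun f : Bool → ℝ => (f true, f false))
      (by fun_prop) (by fun_prop)
  have h2' : IndepFun (S 0) (S 2) μ :=
    h2.comp (φ := fun f : Unit → ℝ => f ()) (ψ := fun f : Unit → ℝ => f ())
      (by fun_prop) (by fun_prop)
  rw [(indepFun_iff_map_prod_eq_prod_map_map (hm 1).aemeasurable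
    ((hm 0).prodMk (hm 2)).aemeasurable).1 h1',
    (indepFun_iff_map_prod_eq_prod_map_map (hm 0).aemeasurable (hm 2).aemeasurable).1 h2',
    hlaw, hlaw, hlaw]

lemma IsSlepian.measureReal_gridBelow (hS : IsSlepian μ S) (h : ℝ) :
    μ.real (gridBelow S h) = ∫ w, condStayProb h w
      ∂((gaussianReal 0 1).prod ((gaussianReal 0 1).prod (gaussianReal 0 1))) := by
  have := hS.1
  have hm := hS.2.1
  have hspan : ∀ t, S t ∈ Submodule.span ℝ (range S) := fun t => Submodule.subset_span ⟨t, rfl⟩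
  set X : Ω → ℝ × ℝ × ℝ := fun ω => (S 1 ω, S 0 ω, S 2 ω) with hX
  set Y : Ω → Bool × ℝ≥0 → ℝ := fun ω p => bridgePart S (if p.1 then 0 else 1) p.2 ω with hY
  have hXm : Measurable X := (hm 1).prodMk ((hm 0).prodMk (hm 2))
  have hYm : Measurable Y :=
    measurable_pi_lambda _ fun p => hS.measurable_span (bridgePart_mem_span _ _ _)
  have hXY : IndepFun X Y μ := by
    have h1 := hS.indepFun_of_covariance_eq_zero (X := fun i : Fin 3 => S (![1, 0, 2] i))
      (Y := fun p : Bool × ℝ≥0 => bridgePart S (if p.1 then 0 else 1) p.2)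
      (fun _ => hspan _) (fun _ => bridgePart_mem_span _ _ _)
      (fun i p => by
        rw [covariance_comm]
        refine hS.covariance_bridgePart_nat ?_ _
        rcases p with ⟨_ | _, s⟩ <;> fin_cases i <;> norm_num)
    exact h1.comp (φ := fun f : Fin 3 → ℝ => (f 0, f 1, f 2)) (ψ := id)
      (by fun_prop) measurable_id
  set B : Set ((ℝ × ℝ × ℝ) × (Bool × ℝ≥0 → ℝ)) :=
    {v | (v.1.1 < h ∧ v.1.2.1 < h ∧ v.1.2.2 < h) ∧ ∀ j k : ℕ,
      0 < h - v.1.2.1 + (h - v.1.1) * ((k : ℝ≥0) / 2 ^ j : ℝ≥0) + v.2 (true, (k : ℝ≥0) / 2 ^ j) ∧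
      0 < h - v.1.1 + (h - v.1.2.2) * ((k : ℝ≥0) / 2 ^ j : ℝ≥0) + v.2 (false, (k : ℝ≥0) / 2 ^ j)}
    with hB
  have hBm : MeasurableSet B := by
    simp only [hB, Set.ofPred_and, Set.ofPred_forall]
    refine MeasurableSet.inter (measurable_fst (measurableSet_below h))
      (MeasurableSet.iInter fun j => MeasurableSet.iInter fun k => ?_)
    exact (measurableSet_lt measurable_const (by fun_prop)).inter
      (measurableSet_lt measurable_const (by fun_prop))
  have hAB : gridBelow S h = (fun ω => (X ω, Y ω)) ⁻¹' B := by
    ext ω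
    simp [gridBelow, hB, hX, hY]
  have hsec : ∀ w, (μ.map Y) (Prod.mk w ⁻¹' B) = ENNReal.ofReal (condStayProb h w) := by
    intro w
    by_cases hw : w ∈ {w : ℝ × ℝ × ℝ | w.1 < h ∧ w.2.1 < h ∧ w.2.2 < h}
    · rw [condStayProb, indicator_of_mem hw, Measure.map_apply hYm (measurable_prodMk_left hBm)]
      have hV := hS.isCartanBM 0
      rw [zero_add] at hV
      rw [← hV.measureReal_stay (z := (h - w.1, h - w.2.2)) (x := (h - w.2.1, h - w.1))
        (hS.tendsto_bridgePart_div 0) (hS.tendsto_bridgePart_div 1)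
        ⟨sub_pos.2 hw.1, sub_pos.2 hw.2.2⟩ ⟨sub_pos.2 hw.2.1, sub_pos.2 hw.1⟩, ofReal_measureReal]
      congr 1
      ext ω
      have hw' : w.1 < h ∧ w.2.1 < h ∧ w.2.2 < h := hw
      simp [hB, hY, hw']
    · rw [condStayProb, indicator_of_notMem hw, ENNReal.ofReal_zero]
      have : Prod.mk w ⁻¹' B = ∅ := by
        ext y
        simp only [mem_preimage, mem_empty_iff_false, iff_false]
        exact fun hy => hw hy.1
      rw [this, measure_empty]
  have hnn : ∀ w, 0 ≤ condStayProb h w := by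
    intro w
    by_cases hw : w ∈ {w : ℝ × ℝ × ℝ | w.1 < h ∧ w.2.1 < h ∧ w.2.2 < h}
    · have hV := hS.isCartanBM 0
      rw [zero_add] at hV
      rw [condStayProb, indicator_of_mem hw,
        ← hV.measureReal_stay (z := (h - w.1, h - w.2.2)) (x := (h - w.2.1, h - w.1))
        (hS.tendsto_bridgePart_div 0) (hS.tendsto_bridgePart_div 1)
        ⟨sub_pos.2 hw.1, sub_pos.2 hw.2.2⟩ ⟨sub_pos.2 hw.2.1, sub_pos.2 hw.1⟩]
      exact measureReal_nonneg
    · rw [condStayProb, indicator_of_notMem hw]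
  have hYp : IsProbabilityMeasure (μ.map Y) := Measure.isProbabilityMeasure_map hYm.aemeasurable
  rw [hAB, measureReal_def, ← Measure.map_apply (hXm.prodMk hYm) hBm,
    (indepFun_iff_map_prod_eq_prod_map_map hXm.aemeasurable hYm.aemeasurable).1 hXY,
    Measure.prod_apply hBm, hS.map_eval_zero_one_two, integral_eq_lintegral_of_nonneg_ae
      (ae_of_all _ hnn) (measurable_condStayProb h).aestronglyMeasurable]
  simp only [hsec]

lemma bridgePart_add {Ω : Type*} (S : ℝ → Ω → ℝ) (c h : ℝ) (s : ℝ≥0) (ω : Ω) :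
    h - S c ω + (h - S (c + 1) ω) * s + bridgePart S c s ω =
      (1 + s) * (h - S (c + s / (1 + s)) ω) := by
  simp only [bridgePart, Pi.add_apply, Pi.smul_apply, smul_eq_mul]
  ring

lemma IsSlepian.le_of_forall_grid (hS : IsSlepian μ S) {c h : ℝ} {ω : Ω}
    (hlt : ∀ j k : ℕ, 0 < h - S c ω + (h - S (c + 1) ω) * ((k : ℝ≥0) / 2 ^ j : ℝ≥0)
      + bridgePart S c ((k : ℝ≥0) / 2 ^ j) ω) {t : ℝ} (ht : t ∈ Ico c (c + 1)) :
    S t ω ≤ h := by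
  have h1t : 0 < 1 - (t - c) := by linarith [ht.2]
  set s : ℝ := (t - c) / (1 - (t - c)) with hs
  have hs0 : 0 ≤ s := div_nonneg (by linarith [ht.1]) h1t.le
  have hts : t = c + s / (1 + s) := by
    rw [hs]
    field_simp
    ring
  have hr : Tendsto (fun j : ℕ => (⌊s * 2 ^ j⌋₊ : ℝ) / 2 ^ j) atTop (𝓝 s) :=
    (tendsto_nat_floor_mul_div_atTop hs0).comp (tendsto_pow_atTop_atTop_of_one_lt one_lt_two)
  have hc : ContinuousAt (fun x : ℝ => S (c + x / (1 + x)) ω) s := by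
    refine (hS.2.2.1 ω).continuousAt.comp ?_
    refine continuousAt_const.add (continuousAt_id.div (continuousAt_const.add continuousAt_id) ?_)
    positivity
  rw [hts]
  refine le_of_tendsto (hc.tendsto.comp hr) (Eventually.of_forall fun j => ?_)
  have := hlt j ⌊s * 2 ^ j⌋₊
  rw [bridgePart_add] at this
  have := pos_of_mul_pos_right this (by positivity)
  simp only [Function.comp_apply]
  push_cast at this
  linarith

lemma below_subset_gridBelow {Ω : Type*} (S : ℝ → Ω → ℝ) (h : ℝ) :
    {ω | ∀ t ∈ Icc (0 : ℝ) 2, S t ω < h} ⊆ gridBelow S h := by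
  intro ω hω
  refine ⟨⟨hω 1 (by norm_num), hω 0 (by norm_num), hω 2 (by norm_num)⟩, fun j k => ?_⟩
  have hs := div_one_add_mem_Ico ((k : ℝ≥0) / 2 ^ j)
  have h0 := bridgePart_add S 0 h ((k : ℝ≥0) / 2 ^ j) ω
  have h1 := bridgePart_add S 1 h ((k : ℝ≥0) / 2 ^ j) ω
  rw [zero_add] at h0
  rw [one_add_one_eq_two] at h1
  rw [h0, h1]
  constructor
  · exact mul_pos (by positivity) (sub_pos.2 (hω _ ⟨by linarith [hs.1], by linarith [hs.2]⟩))
  · exact mul_pos (by positivity) (sub_pos.2 (hω _ ⟨by linarith [hs.1], by linarith [hs.2]⟩))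

lemma IsSlepian.gridBelow_subset_below (hS : IsSlepian μ S) {h h' : ℝ} (hh : h' < h) :
    gridBelow S h' ⊆ {ω | ∀ t ∈ Icc (0 : ℝ) 2, S t ω < h} := by
  intro ω hω t ht
  refine lt_of_le_of_lt ?_ hh
  rcases lt_or_ge t 1 with h1 | h1
  · exact hS.le_of_forall_grid (c := 0) (fun j k => by simpa using (hω.2 j k).1)
      ⟨ht.1, by simpa using h1⟩
  · rcases ht.2.eq_or_lt with rfl | h2
    · exact hω.1.2.2.le
    · exact hS.le_of_forall_grid (c := 1)
        (fun j k => by rw [one_add_one_eq_two]; exact (hω.2 j k).2) ⟨h1, by linarith⟩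

theorem IsSlepian.slepF_two_eq_integral (hS : IsSlepian μ S) (h : ℝ) :
    slepF μ S 2 h = ∫ w, condStayProb h w
      ∂((gaussianReal 0 1).prod ((gaussianReal 0 1).prod (gaussianReal 0 1))) := by
  have := hS.1
  refine le_antisymm ?_ ?_
  · rw [← hS.measureReal_gridBelow]
    exact measureReal_mono (below_subset_gridBelow S h)
  · have hlim := tendsto_integral_of_dominated_convergence
      (μ := (gaussianReal 0 1).prod ((gaussianReal 0 1).prod (gaussianReal 0 1)))
      (F := fun n : ℕ => condStayProb (h - 1 / ((n : ℝ) + 1))) (f := condStayProb h)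
      (fun _ => 6) (fun n => (measurable_condStayProb _).aestronglyMeasurable)
      (integrable_const _) (fun n => ae_of_all _ fun w => abs_condStayProb_le _ w)
      (ae_of_all _ fun w => tendsto_condStayProb h w)
    refine le_of_tendsto hlim (Eventually.of_forall fun n => ?_)
    rw [← hS.measureReal_gridBelow]
    exact measureReal_mono (hS.gridBelow_subset_below
      (by have : 0 < 1 / ((n : ℝ) + 1) := by positivity
          linarith))

end SlepianCondition

section NormalIntegrals

open Topology

lemma stdPhi_eq_gaussianPDFReal : stdPhi = gaussianPDFReal 0 1 := by
  ext x
  simp [stdPhi, gaussianPDFReal]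

lemma stdPhi_nonneg (x : ℝ) : 0 ≤ stdPhi x := by unfold stdPhi; positivity

lemma continuous_stdPhi : Continuous stdPhi := by unfold stdPhi; fun_prop

lemma stdPhi_neg (x : ℝ) : stdPhi (-x) = stdPhi x := by simp [stdPhi]

lemma integrable_stdPhi : Integrable stdPhi := by
  rw [stdPhi_eq_gaussianPDFReal]; exact integrable_gaussianPDFReal 0 1

lemma integral_stdPhi : ∫ x, stdPhi x = 1 := by
  rw [stdPhi_eq_gaussianPDFReal]; exact integral_gaussianPDFReal_eq_one 0 one_ne_zero

lemma stdPhi_le_one (x : ℝ) : stdPhi x ≤ 1 := by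
  unfold stdPhi
  refine mul_le_one₀ (inv_le_one_of_one_le₀ ?_) (exp_nonneg _) ?_
  · rw [one_le_sqrt]; nlinarith [pi_gt_three]
  · rw [exp_le_one_iff]; nlinarith [sq_nonneg x]

lemma stdPhi_le_exp (x : ℝ) : stdPhi x ≤ exp (1 / 2) * exp x := by
  have h1 : (√(2 * π))⁻¹ ≤ 1 := by
    refine inv_le_one_of_one_le₀ ?_
    rw [one_le_sqrt]; nlinarith [pi_gt_three]
  have h2 : exp (-x ^ 2 / 2) ≤ exp (1 / 2) * exp x := by
    rw [← exp_add, exp_le_exp]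
    nlinarith [sq_nonneg (x + 1)]
  unfold stdPhi
  nlinarith [exp_nonneg (-x ^ 2 / 2)]

lemma hasDerivAt_stdPhi (x : ℝ) : HasDerivAt stdPhi (-x * stdPhi x) x := by
  have h : HasDerivAt (fun x : ℝ => -x ^ 2 / 2) (-x) x := by
    have := ((hasDerivAt_pow 2 x).neg).div_const 2
    exact this.congr_deriv (by simp; ring)
  have := h.exp.const_mul (√(2 * π))⁻¹
  exact this.congr_deriv (by unfold stdPhi; ring)

lemma hasDerivAt_stdCdf (x : ℝ) : HasDerivAt stdCdf (stdPhi x) x := by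
  have h : ∀ y, stdCdf y = stdCdf 0 + ∫ t in (0 : ℝ)..y, stdPhi t := fun y => by
    rw [← intervalIntegral.integral_Iic_sub_Iic integrable_stdPhi.integrableOn
      integrable_stdPhi.integrableOn]
    simp [stdCdf]
  rw [show stdCdf = fun y => stdCdf 0 + ∫ t in (0 : ℝ)..y, stdPhi t from funext h]
  exact (intervalIntegral.integral_hasDerivAt_right (continuous_stdPhi.intervalIntegrable _ _)
    (continuous_stdPhi.stronglyMeasurableAtFilter _ _) continuous_stdPhi.continuousAt).const_add _

lemma continuous_stdCdf : Continuous stdCdf :=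
  continuous_iff_continuousAt.2 fun x => (hasDerivAt_stdCdf x).continuousAt

lemma stdCdf_nonneg (x : ℝ) : 0 ≤ stdCdf x :=
  setIntegral_nonneg measurableSet_Iic fun t _ => stdPhi_nonneg t

lemma stdCdf_le_one (x : ℝ) : stdCdf x ≤ 1 := by
  rw [← integral_stdPhi]
  exact setIntegral_le_integral integrable_stdPhi (ae_of_all _ stdPhi_nonneg)

lemma stdCdf_le_exp (x : ℝ) : stdCdf x ≤ exp (1 / 2) * exp x := by
  have h : ∫ t in Iic x, exp (1 / 2) * exp t = exp (1 / 2) * exp x := by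
    rw [integral_const_mul, integral_exp_Iic]
  rw [← h]
  exact setIntegral_mono integrable_stdPhi.integrableOn
    ((integrableOn_exp_Iic x).const_mul _) stdPhi_le_exp

lemma stdCdf_zero : stdCdf 0 = 1 / 2 := by
  have h1 : ∫ t in Ioi (0 : ℝ), stdPhi t = stdCdf 0 := by
    have := integral_comp_neg_Iic (0 : ℝ) stdPhi
    simp only [stdPhi_neg, neg_zero] at this
    exact this.symm
  have h2 := integral_add_compl (measurableSet_Iic (a := (0 : ℝ))) integrable_stdPhi
  rw [integral_stdPhi, compl_Iic, h1] at h2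
  change stdCdf 0 + stdCdf 0 = 1 at h2
  linarith

/-- The antiderivative `x Φ(x) + φ(x)` of `Φ`. -/
noncomputable def stdCdfInt (x : ℝ) : ℝ := x * stdCdf x + stdPhi x

/-- The antiderivative of `stdCdfInt`. -/
noncomputable def stdCdfIntInt (x : ℝ) : ℝ := ((x ^ 2 + 1) * stdCdf x + x * stdPhi x) / 2

lemma hasDerivAt_stdCdfInt (x : ℝ) : HasDerivAt stdCdfInt (stdCdf x) x := by
  have := ((hasDerivAt_id x).mul (hasDerivAt_stdCdf x)).add (hasDerivAt_stdPhi x)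
  exact this.congr_deriv (by simp only [id]; ring)

lemma hasDerivAt_stdCdfIntInt (x : ℝ) : HasDerivAt stdCdfIntInt (stdCdfInt x) x := by
  have := (((((hasDerivAt_id x).pow 2).add_const 1).mul (hasDerivAt_stdCdf x)).add
    ((hasDerivAt_id x).mul (hasDerivAt_stdPhi x))).div_const 2
  exact this.congr_deriv (by simp [stdCdfInt]; ring)

lemma tendsto_pow_mul_atBot_of_le_exp {f : ℝ → ℝ} (n : ℕ) (h0 : ∀ x, 0 ≤ f x)
    (h1 : ∀ x, f x ≤ exp (1 / 2) * exp x) :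
    Tendsto (fun x => x ^ n * f x) atBot (𝓝 0) := by
  have h2 : Tendsto (fun x : ℝ => exp (1 / 2) * (|x| ^ n * exp x)) atBot (𝓝 0) := by
    have := ((tendsto_pow_mul_exp_neg_atTop_nhds_zero n).comp tendsto_neg_atBot_atTop).const_mul
      (exp (1 / 2))
    rw [mul_zero] at this
    refine this.congr' ?_
    filter_upwards [eventually_le_atBot 0] with x hx
    simp [abs_of_nonpos hx]
  refine squeeze_zero_norm (fun x => ?_) h2
  rw [norm_mul, norm_pow, norm_eq_abs, norm_eq_abs, abs_of_nonneg (h0 x)]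
  have := mul_le_mul_of_nonneg_left (h1 x) (pow_nonneg (abs_nonneg x) n)
  linarith

lemma tendsto_stdCdf_atBot : Tendsto stdCdf atBot (𝓝 0) := by
  simpa using tendsto_pow_mul_atBot_of_le_exp 0 stdCdf_nonneg stdCdf_le_exp

lemma tendsto_stdCdfInt_atBot : Tendsto stdCdfInt atBot (𝓝 0) := by
  have h1 := tendsto_pow_mul_atBot_of_le_exp 1 stdCdf_nonneg stdCdf_le_exp
  have h2 := tendsto_pow_mul_atBot_of_le_exp 0 stdPhi_nonneg stdPhi_le_exp
  simpa [stdCdfInt] using! h1.add h2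

lemma tendsto_stdCdfIntInt_atBot : Tendsto stdCdfIntInt atBot (𝓝 0) := by
  have h1 := tendsto_pow_mul_atBot_of_le_exp 2 stdCdf_nonneg stdCdf_le_exp
  have h2 := tendsto_pow_mul_atBot_of_le_exp 0 stdCdf_nonneg stdCdf_le_exp
  have h3 := tendsto_pow_mul_atBot_of_le_exp 1 stdPhi_nonneg stdPhi_le_exp
  have := ((h1.add h2).add h3).div_const 2
  simp only [add_zero, zero_div] at this
  refine this.congr fun x => ?_
  rw [stdCdfIntInt]
  ring

/-- Integral over a left half-line of the derivative of a function vanishing at `-∞`. -/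
lemma integral_Ioi_sub_of_hasDerivAt {G g : ℝ → ℝ} (hG : ∀ x, HasDerivAt G (g x) x)
    (hg : ∀ x, 0 ≤ g x) (hlim : Tendsto G atBot (𝓝 0)) (a : ℝ) :
    IntegrableOn (fun y => g (a - y)) (Ioi 0) ∧ ∫ y in Ioi (0 : ℝ), g (a - y) = G a := by
  have hd : ∀ y, HasDerivAt (fun y => -G (a - y)) (g (a - y)) y := fun y => by
    have := ((hG (a - y)).comp y ((hasDerivAt_id y).const_sub a)).neg
    simpa using! this
  have ht : Tendsto (fun y => -G (a - y)) atTop (𝓝 0) := by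
    have h1 : Tendsto (fun y : ℝ => a - y) atTop atBot :=
      tendsto_atBot_add_const_left _ a tendsto_neg_atTop_atBot
    simpa using (hlim.comp h1).neg
  refine ⟨integrableOn_Ioi_deriv_of_nonneg' (fun y _ => hd y) (fun y _ => hg _) ht, ?_⟩
  rw [integral_Ioi_of_hasDerivAt_of_nonneg' (fun y _ => hd y) (fun y _ => hg _) ht]
  simp

lemma stdCdfInt_nonneg (x : ℝ) : 0 ≤ stdCdfInt x := by
  rw [← (integral_Ioi_sub_of_hasDerivAt hasDerivAt_stdCdfInt stdCdf_nonneg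
    tendsto_stdCdfInt_atBot x).2]
  exact setIntegral_nonneg measurableSet_Ioi fun t _ => stdCdf_nonneg _

lemma integrableOn_stdPhi_sub (a : ℝ) : IntegrableOn (fun y => stdPhi (a - y)) (Ioi 0) :=
  (integral_Ioi_sub_of_hasDerivAt hasDerivAt_stdCdf stdPhi_nonneg tendsto_stdCdf_atBot a).1

lemma integral_stdPhi_sub (a : ℝ) : ∫ y in Ioi (0 : ℝ), stdPhi (a - y) = stdCdf a :=
  (integral_Ioi_sub_of_hasDerivAt hasDerivAt_stdCdf stdPhi_nonneg tendsto_stdCdf_atBot a).2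

lemma integrableOn_stdCdf_sub (a : ℝ) : IntegrableOn (fun y => stdCdf (a - y)) (Ioi 0) :=
  (integral_Ioi_sub_of_hasDerivAt hasDerivAt_stdCdfInt stdCdf_nonneg tendsto_stdCdfInt_atBot a).1

lemma integral_stdCdf_sub (a : ℝ) : ∫ y in Ioi (0 : ℝ), stdCdf (a - y) = stdCdfInt a :=
  (integral_Ioi_sub_of_hasDerivAt hasDerivAt_stdCdfInt stdCdf_nonneg tendsto_stdCdfInt_atBot a).2

lemma integrableOn_stdCdfInt_sub (a : ℝ) : IntegrableOn (fun y => stdCdfInt (a - y)) (Ioi 0) :=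
  (integral_Ioi_sub_of_hasDerivAt hasDerivAt_stdCdfIntInt stdCdfInt_nonneg
    tendsto_stdCdfIntInt_atBot a).1

lemma integral_stdCdfInt_sub (a : ℝ) :
    ∫ y in Ioi (0 : ℝ), stdCdfInt (a - y) = stdCdfIntInt a :=
  (integral_Ioi_sub_of_hasDerivAt hasDerivAt_stdCdfIntInt stdCdfInt_nonneg
    tendsto_stdCdfIntInt_atBot a).2

end NormalIntegrals

section SlepianIntegral

open Topology

lemma stdPhi_mul_stdPhi (x y : ℝ) :
    stdPhi x * stdPhi y = (2 * π)⁻¹ * exp (-(x ^ 2 + y ^ 2) / 2) := by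
  unfold stdPhi
  have h : (√(2 * π))⁻¹ * (√(2 * π))⁻¹ = (2 * π)⁻¹ := by
    rw [← mul_inv, mul_self_sqrt (by positivity)]
  rw [show -(x ^ 2 + y ^ 2) / 2 = -x ^ 2 / 2 + -y ^ 2 / 2 by ring, exp_add, ← h]
  ring

lemma stdPhi_mul_mul_mul_exp {x y z e u v w : ℝ}
    (h : x ^ 2 + y ^ 2 + z ^ 2 + 2 * e = u ^ 2 + v ^ 2 + w ^ 2) :
    stdPhi x * (stdPhi y * (stdPhi z * exp (-e))) = stdPhi u * (stdPhi v * stdPhi w) := by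
  rw [show stdPhi x * (stdPhi y * (stdPhi z * exp (-e)))
      = (stdPhi x * stdPhi y) * (stdPhi z * exp (-e)) by ring,
    show stdPhi u * (stdPhi v * stdPhi w) = (stdPhi u * stdPhi v) * stdPhi w by ring,
    stdPhi_mul_stdPhi, stdPhi_mul_stdPhi]
  unfold stdPhi
  have : exp (-(x ^ 2 + y ^ 2) / 2) * (exp (-z ^ 2 / 2) * exp (-e)) =
      exp (-(u ^ 2 + v ^ 2) / 2) * exp (-w ^ 2 / 2) := by
    rw [← exp_add, ← exp_add, ← exp_add]
    congr 1
    linarith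
  linear_combination (2 * π)⁻¹ * (√(2 * π))⁻¹ * this

lemma stdPhi_mul_stayProb (h q p r : ℝ) :
    stdPhi (h - q) * (stdPhi (h - p) * (stdPhi (h - r) * stayProb (q, r) (p, q))) =
      stdPhi (h - q) * stdPhi (h - p) * stdPhi (h - r)
        - stdPhi h * stdPhi (h - q - p) * stdPhi (h - r)
        - stdPhi h * stdPhi (h - p) * stdPhi (h - q - r)
        + stdPhi h ^ 2 * stdPhi (h - q - p - r)
        + stdPhi (h + q) * stdPhi (h - q - p) * stdPhi (h - q - r)
        - stdPhi (√2 * h) * stdPhi (√2 * q) * stdPhi (h - q - p - r) := by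
  have h2 : √2 ^ 2 = 2 := sq_sqrt zero_le_two
  have e1 := stdPhi_mul_mul_mul_exp (x := h - q) (y := h - p) (z := h - r) (e := q * p)
    (u := h) (v := h - q - p) (w := h - r) (by ring)
  have e2 := stdPhi_mul_mul_mul_exp (x := h - q) (y := h - p) (z := h - r) (e := r * q)
    (u := h) (v := h - p) (w := h - q - r) (by ring)
  have e3 := stdPhi_mul_mul_mul_exp (x := h - q) (y := h - p) (z := h - r)
    (e := (q + r) * p + r * q) (u := h) (v := h) (w := h - q - p - r) (by ring)
  have e4 := stdPhi_mul_mul_mul_exp (x := h - q) (y := h - p) (z := h - r)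
    (e := q * p + (q + r) * q) (u := h + q) (v := h - q - p) (w := h - q - r) (by ring)
  have e5 := stdPhi_mul_mul_mul_exp (x := h - q) (y := h - p) (z := h - r)
    (e := (q + r) * p + (q + r) * q) (u := √2 * h) (v := √2 * q) (w := h - q - p - r)
    (by rw [mul_pow, mul_pow, h2]; ring)
  unfold stayProb
  linear_combination -e1 - e2 + e3 + e4 - e5

lemma integral_gaussianReal_of_below (h : ℝ) {f : ℝ → ℝ} (hf : ∀ s, h ≤ s → f s = 0) :
    ∫ s, f s ∂(gaussianReal 0 1) = ∫ q in Ioi (0 : ℝ), stdPhi (h - q) * f (h - q) := by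
  rw [integral_gaussianReal_eq_integral_smul one_ne_zero, ← stdPhi_eq_gaussianPDFReal,
    ← integral_sub_left_eq_self _ _ h, setIntegral_eq_integral_of_forall_compl_eq_zero]
  · rfl
  · intro q hq
    rw [hf _ (by simpa using hq), mul_zero]

lemma integral_condStayProb_eq_iterated (h : ℝ) :
    ∫ w, condStayProb h w
      ∂((gaussianReal 0 1).prod ((gaussianReal 0 1).prod (gaussianReal 0 1))) =
    ∫ q in Ioi (0 : ℝ), ∫ p in Ioi (0 : ℝ), ∫ r in Ioi (0 : ℝ),
      stdPhi (h - q) * (stdPhi (h - p) * (stdPhi (h - r) * stayProb (q, r) (p, q))) := by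
  have hz : ∀ w : ℝ × ℝ × ℝ, (h ≤ w.1 ∨ h ≤ w.2.1 ∨ h ≤ w.2.2) → condStayProb h w = 0 :=
    fun w hw => indicator_of_notMem (fun hw' => by
      rcases hw with hw | hw | hw
      · exact hw.not_gt hw'.1
      · exact hw.not_gt hw'.2.1
      · exact hw.not_gt hw'.2.2) _
  rw [integral_prod _ (integrable_condStayProb h _),
    integral_gaussianReal_of_below h fun s hs => by simp [hz (s, _) (.inl hs)]]
  refine setIntegral_congr_fun measurableSet_Ioi fun q hq => ?_
  have hi : Integrable (fun v : ℝ × ℝ => condStayProb h (h - q, v))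
      ((gaussianReal 0 1).prod (gaussianReal 0 1)) :=
    .of_bound ((measurable_condStayProb h).comp measurable_prodMk_left).aestronglyMeasurable 6
      (ae_of_all _ fun w => abs_condStayProb_le h _)
  rw [integral_prod _ hi,
    integral_gaussianReal_of_below h fun s hs => by simp [hz (_, s, _) (.inr (.inl hs))],
    ← integral_const_mul]
  refine setIntegral_congr_fun measurableSet_Ioi fun p hp => ?_
  rw [integral_gaussianReal_of_below h fun s hs => hz (_, _, s) (.inr (.inr hs)),
    ← integral_const_mul, ← integral_const_mul]
  refine setIntegral_congr_fun measurableSet_Ioi fun r hr => ?_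
  rw [condStayProb, indicator_of_mem]
  · simp
  · simp only [mem_Ioi] at hq hp hr
    exact ⟨by simpa using hq, by simpa using hp, by simpa using hr⟩

lemma integral_stdPhi_mul_stayProb_right (h q p : ℝ) :
    ∫ r in Ioi (0 : ℝ),
      stdPhi (h - q) * (stdPhi (h - p) * (stdPhi (h - r) * stayProb (q, r) (p, q))) =
      (stdPhi (h - q) * stdCdf h - stdPhi h * stdCdf (h - q)) * stdPhi (h - p)
        + (stdPhi (h + q) * stdCdf (h - q) - stdPhi h * stdCdf h) * stdPhi (h - q - p)
        + (stdPhi h ^ 2 - stdPhi (√2 * h) * stdPhi (√2 * q)) * stdCdf (h - q - p) := by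
  have key : ∀ r, stdPhi (h - q) * (stdPhi (h - p) * (stdPhi (h - r) * stayProb (q, r) (p, q))) =
      (stdPhi (h - q) * stdPhi (h - p) - stdPhi h * stdPhi (h - q - p)) * stdPhi (h - r)
      + (stdPhi (h + q) * stdPhi (h - q - p) - stdPhi h * stdPhi (h - p)) * stdPhi (h - q - r)
      + (stdPhi h ^ 2 - stdPhi (√2 * h) * stdPhi (√2 * q)) * stdPhi (h - q - p - r) := fun r => by
    rw [stdPhi_mul_stayProb]; ring
  have i1 := integrableOn_stdPhi_sub h
  have i2 := integrableOn_stdPhi_sub (h - q)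
  have i3 := integrableOn_stdPhi_sub (h - q - p)
  simp only [key]
  rw [integral_add ((i1.const_mul _).fun_add (i2.const_mul _)) (i3.const_mul _),
    integral_add (i1.const_mul _) (i2.const_mul _), integral_const_mul, integral_const_mul,
    integral_const_mul, integral_stdPhi_sub, integral_stdPhi_sub, integral_stdPhi_sub]
  ring

lemma integral_integral_stdPhi_mul_stayProb (h q : ℝ) :
    ∫ p in Ioi (0 : ℝ), ∫ r in Ioi (0 : ℝ),
      stdPhi (h - q) * (stdPhi (h - p) * (stdPhi (h - r) * stayProb (q, r) (p, q))) =
      stdCdf h ^ 2 * stdPhi (h - q) + (-2 * stdPhi h * stdCdf h) * stdCdf (h - q)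
        + stdPhi h ^ 2 * stdCdfInt (h - q) + stdCdf (h - q) ^ 2 * stdPhi (h + q)
        - stdPhi (√2 * h) * (stdPhi (√2 * q) * stdCdfInt (h - q)) := by
  have i1 := integrableOn_stdPhi_sub h
  have i2 := integrableOn_stdPhi_sub (h - q)
  have i3 := integrableOn_stdCdf_sub (h - q)
  simp only [integral_stdPhi_mul_stayProb_right]
  rw [integral_add ((i1.const_mul _).fun_add (i2.const_mul _)) (i3.const_mul _),
    integral_add (i1.const_mul _) (i2.const_mul _), integral_const_mul, integral_const_mul,
    integral_const_mul, integral_stdPhi_sub, integral_stdPhi_sub, integral_stdCdf_sub]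
  ring

lemma integrableOn_stdCdf_sq_mul_stdPhi (h : ℝ) :
    IntegrableOn (fun q => stdCdf (h - q) ^ 2 * stdPhi (h + q)) (Ioi 0) := by
  have h1 : Integrable fun q => stdPhi (h + q) := integrable_stdPhi.comp_add_left h
  refine (h1.integrableOn (s := Ioi 0)).mono' ?_ (ae_of_all _ fun q => ?_)
  · have := continuous_stdPhi
    have := continuous_stdCdf
    exact Continuous.aestronglyMeasurable (by fun_prop)
  · have h0 := stdCdf_nonneg (h - q)
    have h1 := stdCdf_le_one (h - q)
    rw [norm_of_nonneg (mul_nonneg (sq_nonneg _) (stdPhi_nonneg _))]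
    exact mul_le_of_le_one_left (stdPhi_nonneg _) (pow_le_one₀ h0 h1)

lemma continuous_stdCdfInt : Continuous stdCdfInt :=
  continuous_iff_continuousAt.2 fun x => (hasDerivAt_stdCdfInt x).continuousAt

lemma integrableOn_stdPhi_mul_stdCdfInt (h : ℝ) :
    IntegrableOn (fun q => stdPhi (√2 * q) * stdCdfInt (h - q)) (Ioi 0) := by
  refine (integrableOn_stdCdfInt_sub h).mono' ?_ (ae_of_all _ fun q => ?_)
  · have := continuous_stdPhi
    have := continuous_stdCdfInt
    exact Continuous.aestronglyMeasurable (by fun_prop)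
  · rw [norm_of_nonneg (mul_nonneg (stdPhi_nonneg _) (stdCdfInt_nonneg _))]
    exact mul_le_of_le_one_left (stdCdfInt_nonneg _) (stdPhi_le_one _)

lemma abs_stdCdf_sub_half_le (x : ℝ) : |stdCdf x - 1 / 2| ≤ 1 :=
  abs_le.2 ⟨by linarith [stdCdf_nonneg x], by linarith [stdCdf_le_one x]⟩

lemma integrableOn_stdCdf_mul_stdCdf_sub_half (h : ℝ) :
    IntegrableOn (fun q => stdCdf (h - q) * (stdCdf (√2 * q) - 1 / 2)) (Ioi 0) := by
  refine (integrableOn_stdCdf_sub h).mono' ?_ (ae_of_all _ fun q => ?_)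
  · have := continuous_stdCdf
    exact Continuous.aestronglyMeasurable (by fun_prop)
  · rw [norm_mul, norm_of_nonneg (stdCdf_nonneg _)]
    exact mul_le_of_le_one_right (stdCdf_nonneg _) (abs_stdCdf_sub_half_le _)

lemma integral_stdPhi_mul_stdCdfInt (h : ℝ) :
    ∫ q in Ioi (0 : ℝ), stdPhi (√2 * q) * stdCdfInt (h - q) =
      1 / √2 * ∫ q in Ioi (0 : ℝ), stdCdf (h - q) * (stdCdf (√2 * q) - 1 / 2) := by
  have h2 : √2 ≠ 0 := by positivity
  have hd : ∀ q, HasDerivAt (fun q => (stdCdf (√2 * q) - 1 / 2) * stdCdfInt (h - q))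
      (√2 * (stdPhi (√2 * q) * stdCdfInt (h - q))
        - stdCdf (h - q) * (stdCdf (√2 * q) - 1 / 2)) q := fun q => by
    have d1 : HasDerivAt (fun q => stdCdf (√2 * q) - 1 / 2) (√2 * stdPhi (√2 * q)) q := by
      have := ((hasDerivAt_stdCdf (√2 * q)).comp q ((hasDerivAt_id q).const_mul √2)).sub_const
        (1 / 2)
      exact this.congr_deriv (by ring)
    have d2 : HasDerivAt (fun q => stdCdfInt (h - q)) (-stdCdf (h - q)) q := by
      have := (hasDerivAt_stdCdfInt (h - q)).comp q ((hasDerivAt_id q).const_sub h)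
      exact this.congr_deriv (by ring)
    exact (d1.mul d2).congr_deriv (by ring)
  have hlim : Tendsto (fun q => (stdCdf (√2 * q) - 1 / 2) * stdCdfInt (h - q)) atTop (𝓝 0) := by
    have h1 : Tendsto (fun y : ℝ => h - y) atTop atBot :=
      tendsto_atBot_add_const_left _ h tendsto_neg_atTop_atBot
    refine squeeze_zero_norm (fun q => ?_) (tendsto_stdCdfInt_atBot.comp h1)
    rw [norm_mul, norm_of_nonneg (stdCdfInt_nonneg _)]
    exact mul_le_of_le_one_left (stdCdfInt_nonneg _) (abs_stdCdf_sub_half_le _)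
  have i1 := (integrableOn_stdPhi_mul_stdCdfInt h).const_mul √2
  have i2 := integrableOn_stdCdf_mul_stdCdf_sub_half h
  have := integral_Ioi_of_hasDerivAt_of_tendsto' (fun q _ => hd q) (i1.sub i2) hlim
  rw [integral_sub i1 i2, integral_const_mul, mul_zero, stdCdf_zero, sub_self, zero_mul,
    sub_zero, sub_eq_zero] at this
  rw [← this]
  field_simp

theorem integral_condStayProb (h : ℝ) :
    ∫ w, condStayProb h w
      ∂((gaussianReal 0 1).prod ((gaussianReal 0 1).prod (gaussianReal 0 1))) =
    stdCdf h ^ 2 * stdCdf h - 2 * stdPhi h * stdCdf h * stdCdfInt h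
      + stdPhi h ^ 2 * stdCdfIntInt h
      + (∫ q in Ioi (0 : ℝ), stdCdf (h - q) ^ 2 * stdPhi (h + q))
      - stdPhi (√2 * h) *
        (1 / √2 * ∫ q in Ioi (0 : ℝ), stdCdf (h - q) * (stdCdf (√2 * q) - 1 / 2)) := by
  have i1 := (integrableOn_stdPhi_sub h).const_mul (stdCdf h ^ 2)
  have i2 := (integrableOn_stdCdf_sub h).const_mul (-2 * stdPhi h * stdCdf h)
  have i3 := (integrableOn_stdCdfInt_sub h).const_mul (stdPhi h ^ 2)
  have i4 := integrableOn_stdCdf_sq_mul_stdPhi h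
  have i5 := (integrableOn_stdPhi_mul_stdCdfInt h).const_mul (stdPhi (√2 * h))
  rw [integral_condStayProb_eq_iterated]
  simp only [integral_integral_stdPhi_mul_stayProb]
  rw [integral_sub (((i1.fun_add i2).fun_add i3).fun_add i4) i5,
    integral_add ((i1.fun_add i2).fun_add i3) i4, integral_add (i1.fun_add i2) i3,
    integral_add i1 i2,
    integral_const_mul, integral_const_mul, integral_const_mul, integral_const_mul,
    integral_stdPhi_sub, integral_stdCdf_sub,
    integral_stdCdfInt_sub, integral_stdPhi_mul_stdCdfInt]
  ring

end SlepianIntegral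

/-- The formula for `F_2(h)` as a combination of explicit terms and one-dimensional
integrals. -/
theorem slepF_two {Ω : Type*} [MeasurableSpace Ω] (μ : Measure Ω)
    (S : ℝ → Ω → ℝ) (hS : IsSlepian μ S) (h : ℝ) :
    slepF μ S 2 h =
      stdCdf h ^ 3 + stdPhi h ^ 2 * stdCdf h
        + stdPhi h ^ 2 / 2 * ((h ^ 2 - 1) * stdCdf h + h * stdPhi h)
        + (∫ y in Set.Ioi (0 : ℝ), stdCdf (h - y) ^ 2 * stdPhi (h + y))
        - 2 * stdPhi h * stdCdf h * (h * stdCdf h + stdPhi h)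
        - (1 / Real.sqrt 2) *
            ∫ y in Set.Ioi (0 : ℝ),
              stdCdf (h - y) * stdPhi (Real.sqrt 2 * h) *
                (stdCdf (Real.sqrt 2 * y) - 1 / 2) := by
  have hcomm : ∀ y, stdCdf (h - y) * stdPhi (√2 * h) * (stdCdf (√2 * y) - 1 / 2) =
      stdPhi (√2 * h) * (stdCdf (h - y) * (stdCdf (√2 * y) - 1 / 2)) := fun y => by ring
  simp only [hcomm]
  rw [hS.slepF_two_eq_integral, integral_condStayProb, integral_const_mul]
  unfold stdCdfInt stdCdfIntInt
  ring
end
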